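/- arXiv:1405.7069 — 2 statements merged into one kernel-verified Lean document; each statement's English description precedes it below -/
import Mathlib

section
/- Let α, β > −1. For every θ ∈ (0,π), the limit lim_{ε→0⁺} ∫_{{φ ∈ (0,π) : |φ−θ| > ε}} R_1(θ,φ) dμ(φ) exists and equals 0; that is, pv ∫₀^π R_1(θ,φ) dμ(φ) = 0. -/
open MeasureTheory Real Set Filter
open scoped Classical

noncomputable section

/-- The Jacobi measure dμ_{α,β} on (0,π). -/
def jacobiMeasure (α β : ℝ) : Measure ℝ :=
  (volume.restrict (Set.Ioo 0 π)).withDensity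
    (fun θ => ENNReal.ofReal ((Real.sin (θ/2)) ^ (2*α+1) * (Real.cos (θ/2)) ^ (2*β+1)))

/-- The classical Jacobi polynomial `P_n^{(α,β)}`. -/
def jacobiPoly (α β : ℝ) (n : ℕ) (x : ℝ) : ℝ :=
  ∑ k ∈ Finset.range (n+1),
    (Real.Gamma ((n:ℝ)+α+1) / (Real.Gamma (α+(k:ℝ)+1) * (Nat.factorial (n-k)))) *
    (Real.Gamma ((n:ℝ)+β+1) / (Real.Gamma ((n:ℝ)+β-(k:ℝ)+1) * (Nat.factorial k))) *
    ((x-1)/2)^k * ((x+1)/2)^(n-k)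

/-- Normalized trigonometric Jacobi polynomial `𝒫_n(θ) = c_n P_n^{(α,β)}(cos θ)`. -/
def nJacobi (α β : ℝ) (c : ℕ → ℝ) (n : ℕ) (θ : ℝ) : ℝ :=
  c n * jacobiPoly α β n (Real.cos θ)

def jacobiTau (α β : ℝ) : ℝ := (α + β + 1) / 2

/-- `c` is an admissible sequence of (positive) normalizing constants. -/
def JacobiNormalized (α β : ℝ) (c : ℕ → ℝ) : Prop :=
  (∀ n, 0 < c n) ∧
  ∀ n, ∫ θ, (nJacobi α β c n θ)^2 ∂(jacobiMeasure α β) = 1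

/-- The Jacobi-Poisson kernel. -/
def poissonKer (α β : ℝ) (c : ℕ → ℝ) (t θ φ : ℝ) : ℝ :=
  ∑' n : ℕ, Real.exp (-t * |(n:ℝ) + jacobiTau α β|) * nJacobi α β c n θ * nJacobi α β c n φ

/-- The Riesz-Jacobi kernel of order `N`. -/
def rieszKer (α β : ℝ) (c : ℕ → ℝ) (N : ℕ) (θ φ : ℝ) : ℝ :=
  (1 / Real.Gamma (N:ℝ)) *
    ∫ t in Set.Ioi (0:ℝ), iteratedDeriv N (fun θ' => poissonKer α β c t θ' φ) θ * t ^ (N-1)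

/-- Inner product in `L²(dμ_{α,β})`. -/
def jacobiInner (α β : ℝ) (f g : ℝ → ℝ) : ℝ := ∫ θ, f θ * g θ ∂(jacobiMeasure α β)

/-- The Riesz-Jacobi transform of order `N` on test functions. -/
def rieszTransform (α β : ℝ) (c : ℕ → ℝ) (N : ℕ) (f : ℝ → ℝ) (θ : ℝ) : ℝ :=
  ∑' n : ℕ, |((n:ℝ)+1) + jacobiTau α β| ^ (-(N:ℝ)) *
    jacobiInner α β f (nJacobi α β c (n+1)) *
    iteratedDeriv N (nJacobi α β c (n+1)) θ

/-- `f ∈ C_c^∞(0,π)`. -/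
def IsCcSmooth (f : ℝ → ℝ) : Prop :=
  ContDiff ℝ (⊤ : ℕ∞) f ∧ HasCompactSupport f ∧ tsupport f ⊆ Set.Ioo 0 π

section
namespace RJ
open Polynomial

def U : ℝ[X] := C (1/2) * (X - 1)
def W : ℝ[X] := C (1/2) * (X + 1)

lemma two_mul_half : (2 : ℝ[X]) * C (1/2) = 1 := by
  rw [show (2 : ℝ[X]) = C 2 from rfl, ← C_mul]; norm_num

lemma W_add_U : W + U = X := by
  unfold U W; linear_combination X * two_mul_half
lemma W_sub_U : W - U = 1 := by
  unfold U W; linear_combination two_mul_half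
lemma dU : derivative U = C (1/2) := by simp [U]
lemma dW : derivative W = C (1/2) := by simp [W]
lemma UW_ne : U * W ≠ 0 := by
  have h1 : U ≠ 0 := by
    intro h; have := congrArg (eval 3) h; simp [U] at this; norm_num at this
  have h2 : W ≠ 0 := by
    intro h; have := congrArg (eval 3) h; simp [W] at this; norm_num at this
  exact mul_ne_zero h1 h2

variable (α β : ℝ)

def G (k j : ℕ) : ℝ :=
  1 / (Real.Gamma (α + k + 1) * k.factorial * (Real.Gamma (β + j + 1) * j.factorial))

def S (n : ℕ) (f : ℝ → ℝ → ℝ) : ℝ[X] :=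
  ∑ q ∈ Finset.HasAntidiagonal.antidiagonal n, C (f q.1 q.2 * G α β q.1 q.2) * U ^ q.1 * W ^ q.2

def K (n : ℕ) : ℝ := Real.Gamma (n + α + 1) * Real.Gamma (n + β + 1)

def P (n : ℕ) : ℝ[X] := C (K α β n) * S α β n (fun _ _ => 1)

variable {α β}

lemma G_j (hβ : -1 < β) (k j : ℕ) :
    ((j:ℝ) + 1) * (β + j + 1) * G α β k (j+1) = G α β k j := by
  have h : 0 < β + j + 1 := by have : (0:ℝ) ≤ j := j.cast_nonneg; linarith
  have h2 : Real.Gamma (β + j + 1) ≠ 0 := (Real.Gamma_pos_of_pos h).ne'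
  have e : Real.Gamma (β + (j+1:ℕ) + 1) = (β + j + 1) * Real.Gamma (β + j + 1) := by
    rw [← Real.Gamma_add_one h.ne']; push_cast; ring_nf
  have h3 : ((j:ℝ)+1) ≠ 0 := by positivity
  unfold G
  rw [e, Nat.factorial_succ]
  push_cast
  by_cases hz : Real.Gamma (α + k + 1) = 0
  · simp [hz]
  field_simp

lemma G_k (hα : -1 < α) (k j : ℕ) :
    ((k:ℝ) + 1) * (α + k + 1) * G α β (k+1) j = G α β k j := by
  have := G_j (α := β) hα j k
  simp only [G] at this ⊢
  rw [mul_comm (Real.Gamma (α + (k+1:ℕ) + 1) * _), mul_comm (Real.Gamma (α + k + 1) * _)]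
  exact this

lemma W_S (hβ : -1 < β) (n : ℕ) (f : ℝ → ℝ → ℝ) :
    W * S α β n f = S α β (n+1) (fun k j => f k (j-1) * (j * (β + j))) := by
  unfold S
  rw [Finset.Nat.sum_antidiagonal_succ', Finset.mul_sum]
  simp only [Nat.cast_zero, zero_mul, mul_zero, map_zero, add_zero, zero_add]
  refine Finset.sum_congr rfl fun q _ => ?_
  have := G_j (α := α) hβ q.1 q.2
  rw [← this]; push_cast
  rw [show f q.1 (q.2 + 1 - 1) = f q.1 q.2 by ring_nf, pow_succ]
  simp only [map_mul, map_add]; ring_nf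

lemma U_S (hα : -1 < α) (n : ℕ) (f : ℝ → ℝ → ℝ) :
    U * S α β n f = S α β (n+1) (fun k j => f (k-1) j * (k * (α + k))) := by
  unfold S
  rw [Finset.Nat.sum_antidiagonal_succ, Finset.mul_sum]
  simp only [Nat.cast_zero, zero_mul, mul_zero, map_zero, add_zero, zero_add]
  refine Finset.sum_congr rfl fun q _ => ?_
  have := G_k (β := β) hα q.1 q.2
  rw [← this]; push_cast
  rw [show f (q.1 + 1 - 1) q.2 = f q.1 q.2 by ring_nf, pow_succ]
  simp only [map_mul, map_add]; ring_nf

lemma S_congr (n : ℕ) (f g : ℝ → ℝ → ℝ)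
    (h : ∀ k j : ℕ, k + j = n → f k j = g k j) : S α β n f = S α β n g := by
  unfold S
  refine Finset.sum_congr rfl fun q hq => ?_
  rw [h q.1 q.2 (Finset.HasAntidiagonal.mem_antidiagonal.1 hq)]

lemma S_add (n : ℕ) (f g : ℝ → ℝ → ℝ) :
    S α β n f + S α β n g = S α β n (fun k j => f k j + g k j) := by
  unfold S
  rw [← Finset.sum_add_distrib]
  refine Finset.sum_congr rfl fun q hq => ?_
  rw [add_mul, C_add]; ring

lemma S_smul (n : ℕ) (c : ℝ) (f : ℝ → ℝ → ℝ) :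
    C c * S α β n f = S α β n (fun k j => c * f k j) := by
  unfold S
  rw [Finset.mul_sum]
  refine Finset.sum_congr rfl fun q hq => ?_
  simp only [C_mul]; ring

lemma S_sub (n : ℕ) (f g : ℝ → ℝ → ℝ) :
    S α β n f - S α β n g = S α β n (fun k j => f k j - g k j) := by
  unfold S
  rw [← Finset.sum_sub_distrib]
  refine Finset.sum_congr rfl fun q hq => ?_
  rw [sub_mul, C_sub]; ring

lemma dS (n : ℕ) (f : ℝ → ℝ → ℝ) :
    2 * (U * W) * derivative (S α β n f) =
      W * S α β n (fun k j => k * f k j) + U * S α β n (fun k j => j * f k j) := by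
  unfold S
  rw [derivative_sum, Finset.mul_sum, Finset.mul_sum, Finset.mul_sum, ← Finset.sum_add_distrib]
  refine Finset.sum_congr rfl fun q hq => ?_
  have hU : 2 * U * derivative (U ^ q.1) = C (q.1 : ℝ) * U ^ q.1 := by
    rw [derivative_pow, dU]
    rcases q.1 with _ | m
    · simp
    · simp only [Nat.add_sub_cancel, pow_succ]
      linear_combination C ((m+1:ℕ):ℝ) * U^m * U * two_mul_half
  have hW : 2 * W * derivative (W ^ q.2) = C (q.2 : ℝ) * W ^ q.2 := by
    rw [derivative_pow, dW]
    rcases q.2 with _ | m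
    · simp
    · simp only [Nat.add_sub_cancel, pow_succ]
      linear_combination C ((m+1:ℕ):ℝ) * W^m * W * two_mul_half
  rw [derivative_mul, derivative_mul, derivative_C]
  simp only [C_mul] at *
  linear_combination (C (f q.1 q.2) * C (G α β q.1 q.2)) * (W * W^q.2 * hU + U * U^q.1 * hW)

lemma K_succ (hα : -1 < α) (hβ : -1 < β) (n : ℕ) :
    K α β (n+1) = (n+α+1)*(n+β+1) * K α β n := by
  have hn : (0:ℝ) ≤ n := n.cast_nonneg
  have h1 : (n:ℝ) + α + 1 ≠ 0 := by intro h; linarith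
  have h2 : (n:ℝ) + β + 1 ≠ 0 := by intro h; linarith
  unfold K
  have e1 := Real.Gamma_add_one h1
  have e2 := Real.Gamma_add_one h2
  rw [show (((n+1:ℕ):ℝ) + α + 1) = n + α + 1 + 1 by push_cast; ring,
    show (((n+1:ℕ):ℝ) + β + 1) = n + β + 1 + 1 by push_cast; ring, e1, e2]
  ring

lemma three_term (hα : -1 < α) (hβ : -1 < β) (n : ℕ) :
    C (2*(n+2)*(n+(α+β)+2)*(2*n+2+(α+β))) * P α β (n+2) =
      C (2*n+(α+β)+3) * (C ((2*n+2+(α+β))*(2*n+(α+β)+4)) * X + C (α^2-β^2)) * P α β (n+1)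
      - C (2*(n+1+α)*(n+1+β)*(2*n+(α+β)+4)) * P α β n := by
  have hx : ∀ a b : ℝ, C a * X + C b = C (a+b) * W + C (a-b) * U := by
    intro a b
    rw [C_add, C_sub]
    linear_combination (-C a) * W_add_U - C b * W_sub_U
  have h1 : P α β n = C (K α β n) * ((W - U) * (W - U) * S α β n (fun _ _ => 1)) := by
    rw [W_sub_U]; simp [P]
  rw [hx, h1]
  unfold P
  rw [show ∀ (a k A B : ℝ) (Z : ℝ[X]), C a * (C A * W + C B * U) * (C k * Z) =
    C (a*k*A) * (W*Z) + C (a*k*B) * (U * Z) by intros; simp only [C_mul]; ring]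
  rw [show ∀ (Z : ℝ[X]), (W-U)*(W-U)*Z = W*(W*Z) - C 2*(U*(W*Z)) + U*(U*Z) by
    intro Z; rw [show (C 2 : ℝ[X]) = 2 from rfl]; ring]
  simp only [W_S hβ, U_S hα, S_smul, S_add, S_sub]
  rw [show n+1+1 = n+2 from rfl]
  apply S_congr
  intro k j hkj
  rw [show n + 2 = (n+1)+1 from rfl, K_succ hα hβ (n+1), K_succ hα hβ n]
  have hn : (n:ℝ) = k + j - 2 := by
    have : ((k + j : ℕ):ℝ) = (n+2:ℕ) := by rw [hkj]
    push_cast at this; linarith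
  push_cast
  rw [hn]
  ring

variable (α β) in
def Q (n : ℕ) : ℝ[X] := S α β n (fun k j => 1 / ((α+k+1)*(β+j+1)))

lemma R1 (hα : -1 < α) (hβ : -1 < β) (n : ℕ) :
    2 * derivative (P α β (n+1)) = C (K α β (n+1) * (n+(α+β)+2)) * Q α β n := by
  apply mul_left_cancel₀ UW_ne
  have h := dS (α := α) (β := β) (n+1) (fun _ _ => 1)
  unfold P Q
  rw [derivative_C_mul]
  rw [show ∀ Z k : ℝ[X], U*W*(2*(k*Z)) = k*(2*(U*W)*Z) by intros; ring, h,
    show ∀ Z k : ℝ[X], U*W*((k*Z)) = k*(U*(W*Z)) by intros; ring]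
  simp only [W_S hβ, U_S hα, S_smul, S_add, S_sub]
  rw [show n+1+1 = n+2 from rfl]
  apply S_congr
  intro k j hkj
  have hn : (n:ℝ) = k + j - 2 := by
    have : ((k + j : ℕ):ℝ) = (n+2:ℕ) := by rw [hkj]
    push_cast at this; linarith
  rw [hn]
  have e1 : (k:ℝ) * (α + k) / (α + (k-1) + 1) = k := by
    rcases k with _ | k
    · simp
    · have : 0 < α + k + 1 := by have : (0:ℝ) ≤ k := k.cast_nonneg
                                 linarith
      push_cast
      rw [show α + ((k:ℝ)+1-1)+1 = α + (k + 1) by ring]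
      field_simp [show α + ((k:ℝ)+1) ≠ 0 by linarith]
  have e2 : (j:ℝ) * (β + j) / (β + (j-1) + 1) = j := by
    rcases j with _ | j
    · simp
    · have : 0 < β + j + 1 := by have : (0:ℝ) ≤ j := j.cast_nonneg
                                 linarith
      push_cast
      rw [show β + ((j:ℝ)+1-1)+1 = β + (j + 1) by ring]
      field_simp [show β + ((j:ℝ)+1) ≠ 0 by linarith]
  rw [show (1:ℝ) / ((α + (k-1) + 1) * (β + (j-1) + 1)) * (j * (β+j)) * (k * (α + k)) =
    ((k:ℝ) * (α + k) / (α + (k-1) + 1)) * ((j:ℝ) * (β + j) / (β + (j-1) + 1)) by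
      rw [div_mul_div_comm]; ring, e1, e2]
  ring

lemma R2 (hα : -1 < α) (hβ : -1 < β) (n : ℕ) :
    2 * (U * W) * derivative (Q α β n) + (C (α+1) * W + C (β+1) * U) * Q α β n =
      C ((n:ℝ)+1) * S α β (n+1) (fun _ _ => 1) := by
  unfold Q
  rw [dS, show ∀ a b Z : ℝ[X], (a*W+b*U)*Z = a*(W*Z) + b*(U*Z) by intros; ring]
  simp only [W_S hβ, U_S hα, S_smul, S_add, S_sub]
  apply S_congr
  intro k j hkj
  have hn : (n:ℝ) = k + j - 1 := by
    have : ((k + j : ℕ):ℝ) = (n+1:ℕ) := by rw [hkj]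
    push_cast at this; linarith
  rw [hn]
  have hk : 0 < α + k + 1 := by have : (0:ℝ) ≤ k := k.cast_nonneg
                                linarith
  have hj : 0 < β + j + 1 := by have : (0:ℝ) ≤ j := j.cast_nonneg
                                linarith
  have e1 : (k:ℝ) * (α + k) / (α + (k-1) + 1) = k := by
    rcases k with _ | k
    · simp
    · push_cast at *
      rw [show α + ((k:ℝ)+1-1)+1 = α + (k + 1) by ring]
      have : 0 < α + k + 1 := by have : (0:ℝ) ≤ k := k.cast_nonneg
                                 linarith
      field_simp [show α + ((k:ℝ)+1) ≠ 0 by linarith]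
  have e2 : (j:ℝ) * (β + j) / (β + (j-1) + 1) = j := by
    rcases j with _ | j
    · simp
    · push_cast at *
      rw [show β + ((j:ℝ)+1-1)+1 = β + (j + 1) by ring]
      have : 0 < β + j + 1 := by have : (0:ℝ) ≤ j := j.cast_nonneg
                                 linarith
      field_simp [show β + ((j:ℝ)+1) ≠ 0 by linarith]
  have t1 : (k + (α+1)) * (1 / ((α + k + 1) * (β + (j-1) + 1)) * (j * (β + j))) = (j:ℝ) := by
    rw [show (k + (α+1)) * (1 / ((α + k + 1) * (β + (j-1) + 1)) * (j * (β + j))) =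
      ((α+k+1)/(α+k+1)) * ((j:ℝ) * (β + j) / (β + (j-1) + 1)) by
      rw [div_mul_div_comm]; ring, e2, div_self hk.ne', one_mul]
  have t2 : (j + (β+1)) * (1 / ((α + (k-1) + 1) * (β + j + 1)) * (k * (α + k))) = (k:ℝ) := by
    rw [show (j + (β+1)) * (1 / ((α + (k-1) + 1) * (β + j + 1)) * (k * (α + k))) =
      ((β+j+1)/(β+j+1)) * ((k:ℝ) * (α + k) / (α + (k-1) + 1)) by
      rw [div_mul_div_comm]; ring, e1, div_self hj.ne', one_mul]
  linear_combination t1 + t2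

lemma P_zero (hα : -1 < α) (hβ : -1 < β) : P α β 0 = 1 := by
  have h1 := Real.Gamma_pos_of_pos (show 0 < α + 1 by linarith)
  have h2 := Real.Gamma_pos_of_pos (show 0 < β + 1 by linarith)
  simp [P, S, K, G]
  simp only [← C_mul]
  rw [show (1:ℝ[X]) = C 1 from rfl]
  congr 1
  field_simp

lemma rec_zero (hα : -1 < α) (hβ : -1 < β) :
    C (α+β+2) * X * P α β 0 = C 2 * P α β 1 + C (β-α) * P α β 0 := by
  have h1 := Real.Gamma_pos_of_pos (show 0 < α + 1 by linarith)
  have h2 := Real.Gamma_pos_of_pos (show 0 < β + 1 by linarith)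
  have hP : P α β 1 = C (α+1) * W + C (β+1) * U := by
    unfold P
    rw [show K α β 1 = (α+1)*(β+1) * K α β 0 by have := K_succ hα hβ 0; simpa using this, C_mul,
      mul_assoc]
    have a1 := W_S (α := α) hβ 0 (fun _ _ => 1)
    have a2 := U_S (β := β) hα 0 (fun _ _ => 1)
    have hz := P_zero hα hβ
    unfold P at hz
    have e : C (α+1) * W + C (β+1) * U = C (K α β 0) * (C (α+1) * (W * S α β 0 (fun _ _ => 1)) +
        C (β+1) * (U * S α β 0 (fun _ _ => 1))) := by
      linear_combination (-(C (α+1) * W) - C (β+1) * U) * hz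
    rw [e, a1, a2]
    simp only [← mul_assoc, ← C_mul]
    simp only [S_smul, S_add]
    apply S_congr
    intro k j hkj
    have : (k = 0 ∧ j = 1) ∨ (k = 1 ∧ j = 0) := by omega
    rcases this with ⟨rfl, rfl⟩ | ⟨rfl, rfl⟩ <;> · push_cast; ring
  rw [hP, P_zero hα hβ]
  simp only [C_add, C_sub]
  rw [show (C 2 : ℝ[X]) = 2 from rfl, show (C 1 : ℝ[X]) = 1 from C_1]
  linear_combination (-(C α + C β + 2)) * W_add_U - (C α - C β) * W_sub_U

lemma UW4 : 4 * (U * W) = X^2 - 1 := by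
  have := two_mul_half
  unfold U W
  linear_combination (X^2-1) * (2 * C (1/2) + 1) * two_mul_half

lemma ode (hα : -1 < α) (hβ : -1 < β) (n : ℕ) :
    (1 - X^2) * derivative (derivative (P α β n)) +
      (C (β-α) - C (α+β+2) * X) * derivative (P α β n) = - C (n*(n+(α+β)+1)) * P α β n := by
  rcases n with _ | n
  · rw [P_zero hα hβ]; simp
  · have h1 := R1 hα hβ n
    have h2 := R2 hα hβ n
    have h3 : 2 * derivative (derivative (P α β (n+1))) =
        C (K α β (n+1) * (n+(α+β)+2)) * derivative (Q α β n) := by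
      rw [← derivative_C_mul, ← h1, show (2:ℝ[X]) = C 2 from rfl, derivative_C_mul]
    have h4 : (C (β-α) - C (α+β+2) * X) = -2 * (C (α+1) * W + C (β+1) * U) := by
      simp only [C_add, C_sub]
      rw [show (C 2 : ℝ[X]) = 2 from rfl, show (C 1 : ℝ[X]) = 1 from C_1]
      linear_combination ((C α + C β + 2)) * W_add_U + (C α - C β) * W_sub_U
    have h5 : 2 * ((1 - X^2) * derivative (derivative (P α β (n+1))) +
      (C (β-α) - C (α+β+2) * X) * derivative (P α β (n+1))) =
       2 * (- C ((n+1:ℕ)*((n+1:ℕ)+(α+β)+1)) * P α β (n+1)) := by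
      rw [h4]
      have h6 : P α β (n+1) = C (K α β (n+1)) * S α β (n+1) (fun _ _ => 1) := rfl
      rw [show C (((n+1:ℕ):ℝ)*((n+1:ℕ)+(α+β)+1)) = C ((n:ℝ)+1) * C ((n:ℝ)+(α+β)+2) by
        rw [← C_mul]; congr 1; push_cast; ring]
      rw [C_mul] at h1 h3
      have h7 : (1 - X^2 : ℝ[X]) = - (4 * (U * W)) := by rw [UW4]; ring
      rw [h7]
      linear_combination (-(4 * (U * W))) * h3 + (-2 * (C (α+1) * W + C (β+1) * U)) * h1 - 2 * C (K α β (n+1)) * C ((n:ℝ)+(α+β)+2) * h2 + (2 * C ((n:ℝ)+1) * C ((n:ℝ)+(α+β)+2)) * h6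
    exact mul_left_cancel₀ two_ne_zero h5

lemma eval_P (n : ℕ) (x : ℝ) : (P α β n).eval x = jacobiPoly α β n x := by
  unfold P S jacobiPoly
  rw [eval_mul, eval_finsetSum, Finset.mul_sum,
    Finset.Nat.sum_antidiagonal_eq_sum_range_succ_mk]
  refine Finset.sum_congr rfl fun k hk => ?_
  have hk' : k ≤ n := by simpa [Nat.lt_succ_iff] using hk
  simp only [eval_mul, eval_pow, eval_C, G, K, U, W, eval_sub, eval_add, eval_X, eval_one, one_mul]
  rw [Nat.cast_sub hk', show β + ((n:ℝ) - k) + 1 = n + β - k + 1 by ring,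
    show 1/2 * (x-1) = (x-1)/2 by ring, show 1/2 * (x+1) = (x+1)/2 by ring]
  simp only [div_eq_mul_inv, mul_inv]
  ring

end RJ
end

section
namespace RJ

structure JData (τ : ℝ) (μ : Measure ℝ) (p : ℝ → ℝ) (v dv : ℕ → ℝ → ℝ) (a b : ℕ → ℝ)
    (e f : ℝ) : Prop where
  hτ : -1/2 < τ
  hd : ∀ n φ, HasDerivAt (v n) (dv n φ) φ
  dv0 : ∀ φ, dv 0 φ = 0
  cdv : ∀ n, Continuous (dv n)
  rec0 : ∀ φ, cos φ * v 0 φ = a 0 * v 1 φ + b 0 * v 0 φ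
  recs : ∀ n φ, cos φ * v (n+1) φ = a (n+1) * v (n+2) φ + b (n+1) * v (n+1) φ + a n * v n φ
  apos : ∀ n, 0 < a n
  aasy : ∃ C, ∀ n : ℕ, |a n - 1/2| ≤ C / ((n:ℝ)+1)^2
  basy : ∃ C, ∀ n : ℕ, |b n| ≤ C / ((n:ℝ)+1)^2
  str : ∀ n φ, sin φ * dv (n+1) φ = 1/2 * (a (n+1) * (2*n+3+2*τ) * v (n+2) φ
    - a n * (2*n+1+2*τ) * v n φ + (e - f * cos φ) * v (n+1) φ)
  fin : IsFiniteMeasure μ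
  conc : ∀ᵐ x ∂μ, x ∈ Ioo 0 π
  bdd : ∀ n, ∃ B, ∀ φ, |v n φ| ≤ B
  orth : ∀ m n, ∫ φ, v m φ * v n φ ∂μ = if m = n then 1 else 0
  tot : ∀ n, ∫ φ, v (n+1) φ ∂μ = 0
  int : ∀ n x y, 0 < x → x ≤ y → y < π → ∫ φ in Icc x y, v (n+1) φ ∂μ =
    -(p y * dv (n+1) y - p x * dv (n+1) x) / (((n:ℝ)+1) * (n + 1 + 2 * τ))
  psm : ContDiffOn ℝ 1 p (Ioo 0 π)

end RJ
end

section
namespace RJ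

def wt (α β : ℝ) (θ : ℝ) : ℝ := (Real.sin (θ/2)) ^ (2*α+1) * (Real.cos (θ/2)) ^ (2*β+1)
def wt1 (α β : ℝ) (θ : ℝ) : ℝ := (Real.sin (θ/2)) ^ (2*α+2) * (Real.cos (θ/2)) ^ (2*β+2)

variable {α β : ℝ} {c : ℕ → ℝ}

lemma sin_pos' {θ : ℝ} (h : θ ∈ Ioo 0 π) : 0 < sin (θ/2) :=
  sin_pos_of_pos_of_lt_pi (by linarith [h.1]) (by linarith [h.2, pi_pos])
lemma cos_pos' {θ : ℝ} (h : θ ∈ Ioo 0 π) : 0 < cos (θ/2) :=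
  cos_pos_of_mem_Ioo ⟨by linarith [h.1, pi_pos], by linarith [h.2]⟩

lemma wt_pos {θ : ℝ} (h : θ ∈ Ioo 0 π) : 0 < wt α β θ :=
  mul_pos (rpow_pos_of_pos (sin_pos' h) _) (rpow_pos_of_pos (cos_pos' h) _)

lemma wt_meas : Measurable (wt α β) := by unfold wt; fun_prop

lemma jm_eq : jacobiMeasure α β =
    (volume.restrict (Ioo 0 π)).withDensity (fun θ => ENNReal.ofReal (wt α β θ)) := rfl

lemma wt1_eq {θ : ℝ} (h : θ ∈ Ioo 0 π) : wt1 α β θ = wt α β θ * sin θ / 2 := by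
  have e : sin θ = 2 * sin (θ/2) * cos (θ/2) := by rw [← sin_two_mul]; ring_nf
  unfold wt wt1
  rw [e, show 2*α+2 = (2*α+1)+1 by ring, show 2*β+2 = (2*β+1)+1 by ring,
    rpow_add_one (sin_pos' h).ne', rpow_add_one (cos_pos' h).ne']
  ring

lemma wt1_cont (hα : -1 < α) (hβ : -1 < β) : Continuous (wt1 α β) := by
  unfold wt1
  apply Continuous.mul
  · exact Continuous.rpow_const (by fun_prop) (fun x => Or.inr (by linarith))
  · exact Continuous.rpow_const (by fun_prop) (fun x => Or.inr (by linarith))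

lemma wt1_deriv {θ : ℝ} (h : θ ∈ Ioo 0 π) :
    HasDerivAt (wt1 α β) (wt α β θ * (((α-β) + (α+β+2) * cos θ) / 2)) θ := by
  have hs := sin_pos' h
  have hc := cos_pos' h
  have h0 : HasDerivAt (fun θ : ℝ => θ/2) (1/2) θ := (hasDerivAt_id θ).div_const 2
  have h1 := (h0.sin).rpow_const (p := 2*α+2) (Or.inl hs.ne')
  have h2 := (h0.cos).rpow_const (p := 2*β+2) (Or.inl hc.ne')
  have h3 := h1.mul h2
  refine h3.congr_deriv ?_
  have e : cos θ = cos (θ/2)^2 - sin (θ/2)^2 := by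
    rw [← cos_two_mul']; ring_nf
  have e2 := sin_sq_add_cos_sq (θ/2)
  unfold wt
  have eS : sin (θ/2) ^ (2*α+2) = sin (θ/2) ^ (2*α+1) * sin (θ/2) := by
    rw [show 2*α+2 = (2*α+1)+1 by ring, rpow_add_one hs.ne']
  have eC : cos (θ/2) ^ (2*β+2) = cos (θ/2) ^ (2*β+1) * cos (θ/2) := by
    rw [show 2*β+2 = (2*β+1)+1 by ring, rpow_add_one hc.ne']
  rw [e, eS, eC, show 2*α+2-1 = 2*α+1 by ring, show 2*β+2-1 = 2*β+1 by ring]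
  linear_combination (sin (θ/2) ^ (2*α+1) * cos (θ/2) ^ (2*β+1) * ((α-β)/2)) * e2

lemma wt1_zero (hα : -1 < α) : wt1 α β 0 = 0 := by
  simp [wt1, zero_rpow (show 2*α+2 ≠ 0 by intro h; linarith)]
lemma wt1_pi (hβ : -1 < β) : wt1 α β π = 0 := by
  simp [wt1, zero_rpow (show 2*β+2 ≠ 0 by intro h; linarith)]

lemma wt_smooth : ContDiffOn ℝ 1 (wt α β) (Ioo 0 π) := by
  unfold wt
  apply ContDiffOn.mul
  · exact ContDiffOn.rpow_const_of_ne (by fun_prop) (fun x hx => (sin_pos' hx).ne')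
  · exact ContDiffOn.rpow_const_of_ne (by fun_prop) (fun x hx => (cos_pos' hx).ne')

variable (α β c) in
def vv (n : ℕ) (φ : ℝ) : ℝ := c n * (P α β n).eval (cos φ)
variable (α β c) in
def dvv (n : ℕ) (φ : ℝ) : ℝ := -(c n * sin φ * (P α β n).derivative.eval (cos φ))

lemma vv_eq : nJacobi α β c = vv α β c := by
  funext n φ; unfold nJacobi vv; rw [eval_P]

lemma vv_deriv (n : ℕ) (φ : ℝ) : HasDerivAt (vv α β c n) (dvv α β c n φ) φ := by
  have h := (((P α β n).hasDerivAt (cos φ)).comp φ (hasDerivAt_cos φ)).const_mul (c n)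
  refine h.congr_deriv ?_
  unfold dvv; ring

lemma vv_cont (n : ℕ) : Continuous (vv α β c n) := by unfold vv; fun_prop
lemma dvv_cont (n : ℕ) : Continuous (dvv α β c n) := by unfold dvv; fun_prop

lemma vv_bdd (n : ℕ) : ∃ B, ∀ φ, |vv α β c n φ| ≤ B := by
  obtain ⟨B, hB⟩ := (isCompact_Icc (a := (-1:ℝ)) (b := 1)).exists_bound_of_continuousOn
    ((P α β n).continuous.continuousOn)
  refine ⟨|c n| * B, fun φ => ?_⟩
  unfold vv
  rw [abs_mul]
  exact mul_le_mul_of_nonneg_left (hB _ ⟨neg_one_le_cos φ, cos_le_one φ⟩) (abs_nonneg _)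

lemma jm_fin (hα : -1 < α) (hβ : -1 < β) (hc : JacobiNormalized α β c) :
    IsFiniteMeasure (jacobiMeasure α β) := by
  have h := hc.2 0
  rw [vv_eq] at h
  have e : ∀ φ, vv α β c 0 φ = c 0 := fun φ => by simp [vv, P_zero hα hβ]
  simp only [e, integral_const, smul_eq_mul] at h
  constructor
  by_contra hcon
  rw [not_lt, top_le_iff] at hcon
  simp [Measure.real, hcon] at h

lemma jm_conc : ∀ᵐ x ∂(jacobiMeasure α β), x ∈ Ioo 0 π := by
  rw [jm_eq]
  exact (withDensity_absolutelyContinuous _ _).ae_le (ae_restrict_mem measurableSet_Ioo)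

lemma ftc [IsFiniteMeasure (jacobiMeasure α β)] {x y : ℝ} (hx : 0 ≤ x) (hxy : x ≤ y) (hy : y ≤ π)
    {F g : ℝ → ℝ} (hF : ContinuousOn F (Icc x y)) (hg : Continuous g)
    (hB : ∃ B, ∀ φ, |g φ| ≤ B)
    (hd : ∀ φ ∈ Ioo x y, HasDerivAt F (wt α β φ * g φ) φ) :
    ∫ φ in Icc x y, g φ ∂(jacobiMeasure α β) = F y - F x := by
  obtain ⟨B, hB⟩ := hB
  have hgInt : Integrable g (jacobiMeasure α β) :=
    Integrable.of_bound hg.aestronglyMeasurable B (ae_of_all _ hB)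
  have hm : Measurable (fun θ => ENNReal.ofReal (wt α β θ)) := wt_meas.ennreal_ofReal
  have hset : (Icc x y ∩ Ioo 0 π : Set ℝ) =ᵐ[volume] Ioc x y := by
    have : ∀ z : ℝ, ∀ᵐ φ : ℝ, φ ≠ z := fun z => by
      rw [ae_iff]; simp
    filter_upwards [this x, this π] with φ h1 h2
    apply propext
    change (φ ∈ Icc x y ∩ Ioo 0 π) ↔ φ ∈ Ioc x y
    simp only [mem_inter_iff, mem_Icc, mem_Ioo, mem_Ioc]
    constructor
    · rintro ⟨⟨a, b⟩, d, e⟩; exact ⟨lt_of_le_of_ne a (Ne.symm h1), b⟩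
    · rintro ⟨a, b⟩; exact ⟨⟨a.le, b⟩, by linarith, lt_of_le_of_ne (by linarith) h2⟩
  have hgInt2 : IntegrableOn (fun φ => wt α β φ * g φ) (Ioo 0 π) := by
    rw [jm_eq, integrable_withDensity_iff_integrable_smul' hm (by simp)] at hgInt
    refine (integrable_congr ?_).1 hgInt
    filter_upwards [ae_restrict_mem measurableSet_Ioo] with φ hφ
    rw [ENNReal.toReal_ofReal (wt_pos hφ).le, smul_eq_mul]
  have hgInt3 : IntervalIntegrable (fun φ => wt α β φ * g φ) volume x y := by
    rw [intervalIntegrable_iff_integrableOn_Ioc_of_le hxy]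
    exact (hgInt2.mono_set inter_subset_right).congr_set_ae hset.symm
  rw [← intervalIntegral.integral_eq_sub_of_hasDerivAt_of_le hxy hF hd hgInt3,
    intervalIntegral.integral_of_le hxy, ← setIntegral_congr_set hset, jm_eq,
    setIntegral_withDensity_eq_setIntegral_toReal_smul hm (by simp) _ measurableSet_Icc,
    Measure.restrict_restrict measurableSet_Icc]
  refine setIntegral_congr_fun (measurableSet_Icc.inter measurableSet_Ioo) fun φ hφ => ?_
  change (ENNReal.ofReal (wt α β φ)).toReal • g φ = _
  rw [ENNReal.toReal_ofReal (wt_pos hφ.2).le, smul_eq_mul]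

lemma full (f : ℝ → ℝ) : ∫ φ, f φ ∂(jacobiMeasure α β) =
    ∫ φ in Icc 0 π, f φ ∂(jacobiMeasure α β) := by
  symm
  apply setIntegral_eq_integral_of_ae_compl_eq_zero
  filter_upwards [jm_conc] with φ h1 h2
  exact absurd (Ioo_subset_Icc_self h1) h2

/-- weight times derivative, in a form that is continuous up to the end points -/
def pv (α β : ℝ) (c : ℕ → ℝ) (n : ℕ) (φ : ℝ) : ℝ :=
  -(2 * c n * (wt1 α β φ * (P α β n).derivative.eval (cos φ)))

def lam (α β : ℝ) (n : ℕ) : ℝ := n * (n + (α+β) + 1)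

lemma pv_eq {φ : ℝ} (h : φ ∈ Ioo 0 π) (n : ℕ) : pv α β c n φ = wt α β φ * dvv α β c n φ := by
  unfold pv dvv; rw [wt1_eq h]; ring

lemma pv_cont (hα : -1 < α) (hβ : -1 < β) (n : ℕ) : Continuous (pv α β c n) := by
  have := wt1_cont hα hβ
  unfold pv
  fun_prop

lemma pv_deriv (hα : -1 < α) (hβ : -1 < β) {φ : ℝ} (h : φ ∈ Ioo 0 π) (n : ℕ) :
    HasDerivAt (pv α β c n) (wt α β φ * (- lam α β n * vv α β c n φ)) φ := by
  have h1 := ((wt1_deriv (α := α) (β := β) h).mul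
    (((P α β n).derivative.hasDerivAt (cos φ)).comp φ (hasDerivAt_cos φ))).const_mul (2 * c n)
  refine h1.neg.congr_deriv ?_
  have ho := congrArg (Polynomial.eval (cos φ)) (ode hα hβ n)
  simp only [Polynomial.eval_add, Polynomial.eval_mul, Polynomial.eval_sub, Polynomial.eval_neg,
    Polynomial.eval_pow, Polynomial.eval_one, Polynomial.eval_X, Polynomial.eval_C] at ho
  simp only [Function.comp]
  rw [wt1_eq h]
  unfold vv lam
  have e2 := sin_sq_add_cos_sq φ
  linear_combination (wt α β φ * c n) * ho + c n * wt α β φ * (P α β n).derivative.derivative.eval (cos φ) * e2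

lemma pv_zero (hα : -1 < α) (n : ℕ) : pv α β c n 0 = 0 := by simp [pv, wt1_zero hα]
lemma pv_pi (hβ : -1 < β) (n : ℕ) : pv α β c n π = 0 := by simp [pv, wt1_pi hβ]

lemma vv_orth (hα : -1 < α) (hβ : -1 < β) (hc : JacobiNormalized α β c) (m n : ℕ) :
    ∫ φ, vv α β c m φ * vv α β c n φ ∂(jacobiMeasure α β) = if m = n then 1 else 0 := by
  have hfin := jm_fin hα hβ hc
  split_ifs with hmn
  · subst hmn
    have := hc.2 m
    rw [vv_eq] at this
    rw [← this]; congr 1; ext φ; ring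
  · have hl : lam α β m - lam α β n ≠ 0 := by
      have e : lam α β m - lam α β n = ((m:ℝ) - n) * (m + n + (α+β) + 1) := by unfold lam; ring
      rw [e]
      apply mul_ne_zero
      · rw [sub_ne_zero]; exact_mod_cast hmn
      · have : (1:ℝ) ≤ m + n := by
          have : 1 ≤ m + n := by omega
          exact_mod_cast this
        intro h; linarith
    obtain ⟨B1, hB1⟩ := vv_bdd (α := α) (β := β) (c := c) m
    obtain ⟨B2, hB2⟩ := vv_bdd (α := α) (β := β) (c := c) n
    have key := ftc (α := α) (β := β) (le_refl 0) pi_pos.le (le_refl π)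
      (F := fun φ => vv α β c m φ * pv α β c n φ - vv α β c n φ * pv α β c m φ)
      (g := fun φ => (lam α β m - lam α β n) * (vv α β c m φ * vv α β c n φ))
      (((vv_cont m).mul (pv_cont hα hβ n)).sub ((vv_cont n).mul (pv_cont hα hβ m))).continuousOn
      (continuous_const.mul ((vv_cont m).mul (vv_cont n)))
      ⟨|lam α β m - lam α β n| * (B1 * B2), fun φ => by
        rw [abs_mul, abs_mul]
        have := hB1 φ
        have := hB2 φ
        have : 0 ≤ B1 := (abs_nonneg _).trans (hB1 φ)
        gcongr⟩
      (fun φ hφ => by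
        have h1 := ((vv_deriv (α := α) (β := β) (c := c) m φ).mul (pv_deriv (c := c) hα hβ hφ n)).sub
          ((vv_deriv (α := α) (β := β) (c := c) n φ).mul (pv_deriv (c := c) hα hβ hφ m))
        refine h1.congr_deriv ?_
        rw [pv_eq hφ, pv_eq hφ]; ring)
    rw [← full] at key
    simp only [pv_zero hα, pv_pi hβ, mul_zero, sub_zero] at key
    rw [integral_const_mul] at key
    exact (mul_eq_zero.1 key).resolve_left hl

end RJ
end

section
namespace RJ

def rA (α β : ℝ) (n : ℕ) : ℝ := if n = 0 then 2/(α+β+2) else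
  2*((n:ℝ)+1)*(n+(α+β)+1)/((2*n+(α+β)+1)*(2*n+(α+β)+2))
def rb (α β : ℝ) (n : ℕ) : ℝ := if n = 0 then (β-α)/(α+β+2) else
  (β^2-α^2)/((2*(n:ℝ)+(α+β))*(2*n+(α+β)+2))
def rC (α β : ℝ) (n : ℕ) : ℝ :=
  2*((n:ℝ)+1+α)*(n+1+β)/((2*n+(α+β)+3)*(2*n+(α+β)+2))

variable {α β : ℝ} {c : ℕ → ℝ}

lemma rA_pos (hα : -1 < α) (hβ : -1 < β) (n : ℕ) : 0 < rA α β n := by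
  unfold rA
  split_ifs with h
  · apply div_pos <;> linarith
  · have : (1:ℝ) ≤ n := by exact_mod_cast Nat.one_le_iff_ne_zero.2 h
    have h1 : 0 < (n:ℝ)+(α+β)+1 := by linarith
    have h2 : 0 < 2*(n:ℝ)+(α+β)+1 := by linarith
    have h3 : 0 < 2*(n:ℝ)+(α+β)+2 := by linarith
    positivity

lemma prec0 (hα : -1 < α) (hβ : -1 < β) : (Polynomial.X : Polynomial ℝ) * P α β 0 =
    Polynomial.C (rA α β 0) * P α β 1 + Polynomial.C (rb α β 0) * P α β 0 := by
  have h := rec_zero hα hβ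
  have h0 : α+β+2 ≠ 0 := by intro h; linarith
  have hC : (Polynomial.C (1/(α+β+2)) : Polynomial ℝ) * Polynomial.C (α+β+2) = 1 := by
    rw [← Polynomial.C_mul]; simp [h0]
  have e1 : (Polynomial.C (rA α β 0) : Polynomial ℝ) = Polynomial.C (1/(α+β+2)) * Polynomial.C 2 := by
    rw [← Polynomial.C_mul]; congr 1; simp [rA]; ring
  have e2 : (Polynomial.C (rb α β 0) : Polynomial ℝ) = Polynomial.C (1/(α+β+2)) * Polynomial.C (β-α) := by
    rw [← Polynomial.C_mul]; congr 1; simp [rb]; ring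
  rw [e1, e2]
  linear_combination (Polynomial.C (1/(α+β+2))) * h - (Polynomial.X * P α β 0) * hC

lemma precs (hα : -1 < α) (hβ : -1 < β) (n : ℕ) : (Polynomial.X : Polynomial ℝ) * P α β (n+1) =
    Polynomial.C (rA α β (n+1)) * P α β (n+2) + Polynomial.C (rb α β (n+1)) * P α β (n+1)
     + Polynomial.C (rC α β n) * P α β n := by
  have h := three_term hα hβ n
  have hn : (0:ℝ) ≤ n := Nat.cast_nonneg n
  have h1 : 2*(n:ℝ)+(α+β)+3 ≠ 0 := by intro h; linarith
  have h2 : 2*(n:ℝ)+2+(α+β) ≠ 0 := by intro h; linarith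
  have h3 : 2*(n:ℝ)+(α+β)+4 ≠ 0 := by intro h; linarith
  set q : ℝ := (2*n+(α+β)+3)*((2*n+2+(α+β))*(2*n+(α+β)+4)) with hq
  have hq0 : q ≠ 0 := by positivity
  have hC : (Polynomial.C (1/q) : Polynomial ℝ) * (Polynomial.C (2*(n:ℝ)+(α+β)+3) *
      Polynomial.C ((2*(n:ℝ)+2+(α+β))*(2*n+(α+β)+4))) = 1 := by
    rw [← Polynomial.C_mul, ← hq, ← Polynomial.C_mul]; simp [hq0]
  have e1 : (Polynomial.C (rA α β (n+1)) : Polynomial ℝ) = Polynomial.C (1/q) *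
      Polynomial.C (2*(n+2)*(n+(α+β)+2)*(2*n+2+(α+β))) := by
    rw [← Polynomial.C_mul]; congr 1; simp only [rA, Nat.succ_ne_zero, if_false]
    rw [hq]; push_cast
    rw [show 2*((n:ℝ)+1)+(α+β)+1 = 2*n+(α+β)+3 by ring, show 2*((n:ℝ)+1)+(α+β)+2 = 2*n+(α+β)+4 by ring]
    rw [div_mul_eq_mul_div, one_mul, div_eq_div_iff (mul_ne_zero h1 h3) (mul_ne_zero h1 (mul_ne_zero h2 h3))]
    ring
  have e2 : (Polynomial.C (rb α β (n+1)) : Polynomial ℝ) = - (Polynomial.C (1/q) *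
      (Polynomial.C (2*n+(α+β)+3) * Polynomial.C (α^2-β^2))) := by
    rw [← Polynomial.C_mul, ← Polynomial.C_mul, ← Polynomial.C_neg]; congr 1
    simp only [rb, Nat.succ_ne_zero, if_false]
    rw [hq]; push_cast
    rw [show 2*((n:ℝ)+1)+(α+β)+2 = 2*n+(α+β)+4 by ring, show 2*((n:ℝ)+1)+(α+β) = 2*n+2+(α+β) by ring]
    field_simp; ring
  have e3 : (Polynomial.C (rC α β n) : Polynomial ℝ) = Polynomial.C (1/q) *
      Polynomial.C (2*(n+1+α)*(n+1+β)*(2*n+(α+β)+4)) := by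
    rw [← Polynomial.C_mul]; congr 1; simp only [rC]
    rw [hq]
    rw [show 2*(n:ℝ)+(α+β)+2 = 2*n+2+(α+β) by ring]
    field_simp
  rw [e1, e2, e3]
  linear_combination (-Polynomial.C (1/q)) * h - (Polynomial.X * P α β (n+1)) * hC

lemma pstr (hα : -1 < α) (hβ : -1 < β) (n : ℕ) (x : ℝ) :
    2 * (1 - x^2) * (P α β (n+1)).derivative.eval x =
    -(rA α β (n+1) * (2*n+4+(α+β)) * (P α β (n+2)).eval x)
    + rC α β n * (2*n+2+(α+β)) * (P α β n).eval x
    - ((β-α) - (α+β+2)*x) * (P α β (n+1)).eval x := by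
  have h0 := precs hα hβ n
  have h1 := congrArg Polynomial.derivative h0
  have h2 := congrArg Polynomial.derivative h1
  have o0 := congrArg (Polynomial.eval x) (ode hα hβ n)
  have o1 := congrArg (Polynomial.eval x) (ode hα hβ (n+1))
  have o2 := congrArg (Polynomial.eval x) (ode hα hβ (n+2))
  replace h0 := congrArg (Polynomial.eval x) h0
  replace h1 := congrArg (Polynomial.eval x) h1
  replace h2 := congrArg (Polynomial.eval x) h2
  simp only [Polynomial.derivative_mul, Polynomial.derivative_add, Polynomial.derivative_X,
    Polynomial.derivative_C, Polynomial.derivative_one,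
    Polynomial.eval_add, Polynomial.eval_mul, Polynomial.eval_sub, Polynomial.eval_neg,
    Polynomial.eval_pow, Polynomial.eval_one, Polynomial.eval_X, Polynomial.eval_C, zero_mul,
    zero_add, one_mul] at h0 h1 h2 o0 o1 o2
  push_cast at o1 o2
  linear_combination (1-x^2) * h2 + ((β-α) - (α+β+2)*x) * h1 + (n+1)*(n+1+(α+β)+1) * h0
    - x * o1 + rA α β (n+1) * o2 + rb α β (n+1) * o1 + rC α β n * o0

def ra (α β : ℝ) (c : ℕ → ℝ) (n : ℕ) : ℝ := rA α β n * c n / c (n+1)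

lemma vrec0 (hα : -1 < α) (hβ : -1 < β) (hc : JacobiNormalized α β c) (φ : ℝ) :
    cos φ * vv α β c 0 φ = ra α β c 0 * vv α β c 1 φ + rb α β 0 * vv α β c 0 φ := by
  have h := congrArg (Polynomial.eval (cos φ)) (prec0 hα hβ)
  simp only [Polynomial.eval_add, Polynomial.eval_mul, Polynomial.eval_X, Polynomial.eval_C] at h
  unfold vv ra
  have h1 := (hc.1 (0+1)).ne'
  rw [zero_add] at *
  field_simp
  linear_combination c 0 * h

lemma vrecs' (hα : -1 < α) (hβ : -1 < β) (hc : JacobiNormalized α β c) (n : ℕ) (φ : ℝ) :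
    cos φ * vv α β c (n+1) φ = ra α β c (n+1) * vv α β c (n+2) φ + rb α β (n+1) * vv α β c (n+1) φ
      + (rC α β n * c (n+1) / c n) * vv α β c n φ := by
  have h := congrArg (Polynomial.eval (cos φ)) (precs hα hβ n)
  simp only [Polynomial.eval_add, Polynomial.eval_mul, Polynomial.eval_X, Polynomial.eval_C] at h
  unfold vv ra
  have h1 := (hc.1 (n+1+1)).ne'
  have h2 := (hc.1 (n)).ne'
  field_simp
  linear_combination c (n+1) * h

lemma vv_int (hα : -1 < α) (hβ : -1 < β) (hc : JacobiNormalized α β c) (m n : ℕ) :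
    Integrable (fun φ => vv α β c m φ * vv α β c n φ) (jacobiMeasure α β) := by
  have := jm_fin hα hβ hc
  obtain ⟨B1, hB1⟩ := vv_bdd (α := α) (β := β) (c := c) m
  obtain ⟨B2, hB2⟩ := vv_bdd (α := α) (β := β) (c := c) n
  refine Integrable.of_bound ((vv_cont m).mul (vv_cont n)).aestronglyMeasurable (B1*B2)
    (ae_of_all _ fun φ => ?_)
  rw [norm_eq_abs, abs_mul]
  have := hB1 φ
  have := hB2 φ
  have : 0 ≤ B1 := (abs_nonneg _).trans (hB1 φ)
  gcongr

lemma int3 {f g h : ℝ → ℝ} {μ : Measure ℝ} (hf : Integrable f μ) (hg : Integrable g μ)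
    (hh : Integrable h μ) (x y z : ℝ) : ∫ φ, (x * f φ + y * g φ + z * h φ) ∂μ =
    x * ∫ φ, f φ ∂μ + y * ∫ φ, g φ ∂μ + z * ∫ φ, h φ ∂μ := by
  have h1 : Integrable (fun φ => x * f φ + y * g φ) μ := (hf.const_mul x).add (hg.const_mul y)
  rw [integral_add h1 (hh.const_mul z), integral_add (hf.const_mul x) (hg.const_mul y)]
  simp only [integral_const_mul]

lemma ra_eq (hα : -1 < α) (hβ : -1 < β) (hc : JacobiNormalized α β c) (n : ℕ) :
    rC α β n * c (n+1) / c n = ra α β c n := by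
  have ho := vv_orth hα hβ hc
  have hi := vv_int hα hβ hc
  have h1 : ∫ φ, (cos φ * vv α β c (n+1) φ) * vv α β c n φ ∂(jacobiMeasure α β) =
      rC α β n * c (n+1) / c n := by
    have : ∀ φ, (cos φ * vv α β c (n+1) φ) * vv α β c n φ =
      ra α β c (n+1) * (vv α β c (n+2) φ * vv α β c n φ) +
      rb α β (n+1) * (vv α β c (n+1) φ * vv α β c n φ)
      + (rC α β n * c (n+1) / c n) * (vv α β c n φ * vv α β c n φ) := fun φ => by
        rw [vrecs' hα hβ hc]; ring
    simp only [this]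
    rw [int3 (hi _ _) (hi _ _) (hi _ _)]
    simp only [ho]
    simp
  rw [← h1]
  rcases n with _ | n
  · have : ∀ φ, (cos φ * vv α β c (0+1) φ) * vv α β c 0 φ =
      ra α β c 0 * (vv α β c 1 φ * vv α β c 1 φ) +
      rb α β 0 * (vv α β c 0 φ * vv α β c 1 φ) := fun φ => by
        rw [zero_add]
        linear_combination (vv α β c 1 φ) * vrec0 hα hβ hc φ
    simp only [this]
    rw [integral_add ((hi _ _).const_mul _) ((hi _ _).const_mul _)]
    simp only [integral_const_mul, ho]
    simp
  · have : ∀ φ, (cos φ * vv α β c (n+1+1) φ) * vv α β c (n+1) φ =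
      ra α β c (n+1) * (vv α β c (n+2) φ * vv α β c (n+2) φ) +
      rb α β (n+1) * (vv α β c (n+1) φ * vv α β c (n+2) φ)
      + (rC α β n * c (n+1) / c n) * (vv α β c n φ * vv α β c (n+2) φ) := fun φ => by
        linear_combination (vv α β c (n+2) φ) * vrecs' hα hβ hc n φ
    simp only [this]
    rw [int3 (hi _ _) (hi _ _) (hi _ _)]
    simp only [ho]
    simp

lemma ra_sq (hα : -1 < α) (hβ : -1 < β) (hc : JacobiNormalized α β c) (n : ℕ) :
    ra α β c n ^ 2 = rA α β n * rC α β n := by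
  have h1 := (hc.1 (n+1)).ne'
  have h2 := (hc.1 (n)).ne'
  rw [sq]
  nth_rw 1 [← ra_eq hα hβ hc]
  unfold ra
  field_simp

lemma ra_pos (hα : -1 < α) (hβ : -1 < β) (hc : JacobiNormalized α β c) (n : ℕ) :
    0 < ra α β c n := div_pos (mul_pos (rA_pos hα hβ n) (hc.1 n)) (hc.1 _)

lemma ra_asy (hα : -1 < α) (hβ : -1 < β) (hc : JacobiNormalized α β c) :
    ∃ C, ∀ n : ℕ, |ra α β c n - 1/2| ≤ C / ((n:ℝ)+1)^2 := by
  obtain ⟨σ, hσ⟩ : ∃ σ, σ = α+β := ⟨_, rfl⟩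
  obtain ⟨δ, hδ⟩ : ∃ δ, δ = (α-β)^2 := ⟨_, rfl⟩
  have hδ0 : 0 ≤ δ := by rw [hδ]; positivity
  set K := 1 + σ^2 + δ + σ^2*δ with hK
  have hK0 : 0 ≤ K := by positivity
  refine ⟨max (|ra α β c 0 - 1/2|) (2*K), fun n => ?_⟩
  rcases Nat.eq_zero_or_pos n with rfl | hn
  · simp
  have hn1 : (1:ℝ) ≤ n := by exact_mod_cast hn
  refine le_trans ?_ (div_le_div_of_nonneg_right (le_max_right _ _) (by positivity))
  have hp := ra_pos hα hβ hc n
  obtain ⟨s, hs⟩ : ∃ s, s = 2*(n:ℝ)+2+σ := ⟨_, rfl⟩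
  have hs2 : (n:ℝ)+1 ≤ s := by linarith
  have hs3 : 2 ≤ s := by linarith
  have hsq : ra α β c n ^ 2 = (s^2-σ^2)*(s^2-δ)/(4*s^2*(s^2-1)) := by
    rw [ra_sq hα hβ hc]
    unfold rA rC
    rw [if_neg hn.ne', show 2*(n:ℝ)+(α+β)+1 = s-1 by rw [hs,hσ]; ring, show 2*(n:ℝ)+(α+β)+2 = s by rw [hs,hσ]; ring,
      show 2*(n:ℝ)+(α+β)+3 = s+1 by rw [hs,hσ]; ring]
    have h1 : s - 1 ≠ 0 := by intro h; linarith
    have h2 : s + 1 ≠ 0 := by intro h; linarith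
    have h3 : s ≠ 0 := by intro h; linarith
    have h4 : s^2-1 ≠ 0 := by
      rw [show s^2-1 = (s-1)*(s+1) by ring]; positivity
    rw [show s^2-1 = (s-1)*(s+1) by ring]
    field_simp
    rw [hs, hσ, hδ]
    ring
  have hq : |ra α β c n ^ 2 - 1/4| ≤ K / s^2 := by
    have h4 : 0 < s^2-1 := by nlinarith
    have h5 : 0 < s := by linarith
    have : ra α β c n ^ 2 - 1/4 = ((1-σ^2-δ)*s^2 + σ^2*δ)/(4*s^2*(s^2-1)) := by
      rw [hsq]; field_simp; ring
    rw [this, abs_div, abs_of_pos (show 0 < 4*s^2*(s^2-1) by positivity), div_le_div_iff₀ (by positivity) (by positivity)]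
    have hn : |(1-σ^2-δ)*s^2 + σ^2*δ| ≤ K*s^2 := by
      have : 0 ≤ σ^2*δ := by positivity
      have : σ^2*δ ≤ σ^2*δ*s^2 := by nlinarith
      have hs0 : 0 ≤ s^2 := by positivity
      have : 0 ≤ σ^2*s^2 := by positivity
      have : 0 ≤ δ*s^2 := by positivity
      rw [abs_le, hK]; constructor <;> nlinarith
    calc _ ≤ (K*s^2)*s^2 := by gcongr
      _ ≤ K*(4*s^2*(s^2-1)) := by
        have : s^2 ≤ 4*(s^2-1) := by nlinarith
        have : K*s^2*s^2 ≤ K*s^2*(4*(s^2-1)) := by gcongr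
        linarith
  have h6 : |ra α β c n - 1/2| ≤ 2 * |ra α β c n ^ 2 - 1/4| := by
    rw [show ra α β c n ^ 2 - 1/4 = (ra α β c n - 1/2)*(ra α β c n + 1/2) by ring, abs_mul,
      abs_of_pos (show 0 < ra α β c n + 1/2 by linarith)]
    nlinarith [abs_nonneg (ra α β c n - 1/2)]
  calc _ ≤ 2 * (K / s^2) := h6.trans (by gcongr)
    _ = 2*K/s^2 := by ring
    _ ≤ _ := by gcongr

lemma rb_asy (hα : -1 < α) (hβ : -1 < β) :
    ∃ C, ∀ n : ℕ, |rb α β n| ≤ C / ((n:ℝ)+1)^2 := by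
  obtain ⟨κ, hκ⟩ : ∃ κ, κ = min 1 ((2+α+β)/2) := ⟨_, rfl⟩
  have k0 : 0 < κ := by rw [hκ]; apply lt_min <;> linarith
  have k1 : κ ≤ 1 := hκ ▸ min_le_left _ _
  have k2 : κ ≤ (2+α+β)/2 := hκ ▸ min_le_right _ _
  refine ⟨max |rb α β 0| (|β^2-α^2|/κ), fun n => ?_⟩
  rcases Nat.eq_zero_or_pos n with rfl | hn
  · simp
  refine le_trans ?_ (div_le_div_of_nonneg_right (le_max_right _ _) (by positivity))
  have hn1 : (1:ℝ) ≤ n := by exact_mod_cast hn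
  unfold rb
  rw [if_neg hn.ne', abs_div, div_div]
  have h1 : κ * (n+1) ≤ 2*(n:ℝ)+(α+β) := by nlinarith
  have h2 : (n:ℝ)+1 ≤ 2*n+(α+β)+2 := by linarith
  have h3 : κ * ((n:ℝ)+1)^2 ≤ |(2*(n:ℝ)+(α+β))*(2*n+(α+β)+2)| := by
    refine le_trans ?_ (le_abs_self _)
    calc _ = κ * (n+1) * ((n:ℝ)+1) := by ring
      _ ≤ _ := mul_le_mul h1 h2 (by positivity) (le_trans (by positivity) h1)
  exact div_le_div_of_nonneg_left (abs_nonneg _) (by positivity) h3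

theorem jdata (hα : -1 < α) (hβ : -1 < β) (hc : JacobiNormalized α β c) :
    JData (jacobiTau α β) (jacobiMeasure α β) (wt α β) (vv α β c) (dvv α β c) (ra α β c) (rb α β)
      (β-α) (α+β+2) where
  hτ := by unfold jacobiTau; linarith
  hd := vv_deriv
  dv0 φ := by simp [dvv, P_zero hα hβ]
  cdv := dvv_cont
  rec0 := vrec0 hα hβ hc
  recs n φ := by rw [vrecs' hα hβ hc, ra_eq hα hβ hc]
  apos := ra_pos hα hβ hc
  aasy := ra_asy hα hβ hc
  basy := rb_asy hα hβ
  str n φ := by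
    have h := pstr hα hβ n (cos φ)
    rw [← ra_eq hα hβ hc n]
    unfold vv dvv ra jacobiTau
    have h1 := (hc.1 (n+1+1)).ne'
    have h2 := (hc.1 (n)).ne'
    have e2 := sin_sq_add_cos_sq φ
    field_simp
    linear_combination c (n+1) * (-h - 2 * (P α β (n+1)).derivative.eval (cos φ) * e2)
  fin := jm_fin hα hβ hc
  conc := jm_conc
  bdd := vv_bdd
  orth := vv_orth hα hβ hc
  tot n := by
    have h := vv_orth hα hβ hc 0 (n+1)
    simp only [vv, P_zero hα hβ, Polynomial.eval_one, mul_one] at h ⊢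
    rw [integral_const_mul] at h
    simpa [(hc.1 0).ne'] using h
  int n x y hx hxy hy := by
    have := jm_fin hα hβ hc
    have hl : lam α β (n+1) ≠ 0 := by
      unfold lam; push_cast
      have : 0 < ((n:ℝ)+1) + (α+β)+1 := by have : (0:ℝ) ≤ n := Nat.cast_nonneg n
                                           linarith
      positivity
    have hl2 : lam α β (n+1) = ((n:ℝ)+1) * (n + 1 + 2 * jacobiTau α β) := by
      unfold lam jacobiTau; push_cast; ring
    rw [← hl2, ftc (α := α) (β := β) hx.le hxy hy.le (F := fun φ => pv α β c (n+1) φ / (-lam α β (n+1)))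
      (pv_cont hα hβ _ |>.div_const _).continuousOn (vv_cont _) (vv_bdd _)
      (fun φ hφ => by
        refine ((pv_deriv hα hβ (c := c) (φ := φ) ⟨by linarith [hφ.1], by linarith [hφ.2]⟩ (n+1)).div_const _).congr_deriv ?_
        field_simp),
      pv_eq ⟨by linarith, by linarith⟩, pv_eq ⟨by linarith, by linarith⟩]
    field_simp
    ring
  psm := wt_smooth

end RJ
end

section
namespace RJ

def E (x : ℝ) : ℂ := Complex.exp (x * Complex.I)
lemma E_norm (x : ℝ) : ‖E x‖ = 1 := Complex.norm_exp_ofReal_mul_I x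
lemma E_add (x y : ℝ) : E (x+y) = E x * E y := by
  unfold E; rw [← Complex.exp_add]; push_cast; ring_nf
lemma E_zero : E 0 = 1 := by simp [E]
lemma E_re (x : ℝ) : (E x).re = cos x := Complex.exp_ofReal_mul_I_re x
lemma E_im (x : ℝ) : (E x).im = sin x := Complex.exp_ofReal_mul_I_im x
lemma E_neg_mul (x : ℝ) : E (-x) * E x = 1 := by rw [← E_add]; simp [E_zero]
lemma E_conj (x : ℝ) : (starRingEnd ℂ) (E x) = E (-x) := by
  apply Complex.ext <;> simp [E_re, E_im]
lemma E_lip (x y : ℝ) : ‖E x - E y‖ ≤ |x - y| := by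
  have h : E x - E y = E y * (E (x-y) - 1) := by
    rw [mul_sub, ← E_add]; ring_nf
  rw [h, norm_mul, E_norm, one_mul]
  have := Real.norm_exp_I_mul_ofReal_sub_one_le (x := x - y)
  unfold E
  rw [mul_comm]
  simpa using this

lemma two_cos (φ : ℝ) : (2 * cos φ : ℂ) = E φ + E (-φ) := by
  apply Complex.ext
  · simp [E_re, Complex.cos_ofReal_re, ← Complex.ofReal_cos]; ring
  · simp [E_im, ← Complex.ofReal_cos]

/-- the Prüfer-type complex amplitude -/
def zz (φ : ℝ) (v : ℕ → ℝ) (n : ℕ) : ℂ := E (-(n*φ)) * ((v (n+1) : ℂ) - E (-φ) * v n)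

lemma zz_norm (φ : ℝ) (v : ℕ → ℝ) (n : ℕ) : ‖zz φ v n‖ = ‖(v (n+1) : ℂ) - E (-φ) * v n‖ := by
  unfold zz; rw [norm_mul, E_norm, one_mul]

lemma zz_mul (φ : ℝ) (v : ℕ → ℝ) (n : ℕ) : E (n*φ) * zz φ v n = (v (n+1) : ℂ) - E (-φ) * v n := by
  unfold zz; rw [← mul_assoc, mul_comm (E _) (E (-_)), E_neg_mul, one_mul]

lemma zz_im (φ : ℝ) (v : ℕ → ℝ) (n : ℕ) : (E (n*φ) * zz φ v n).im = sin φ * v n := by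
  rw [zz_mul]; simp [E_im, E_re]
lemma zz_re (φ : ℝ) (v : ℕ → ℝ) (n : ℕ) : (E (n*φ) * zz φ v n).re = v (n+1) - cos φ * v n := by
  rw [zz_mul]; simp [E_im, E_re]

lemma zz_step (φ : ℝ) (v : ℕ → ℝ) (n : ℕ) : zz φ v (n+1) - zz φ v n =
    E (-((n+1:ℕ)*φ)) * ((v (n+2) - 2 * cos φ * v (n+1) + v n : ℝ) : ℂ) := by
  have h1 : E (-(n*φ)) = E (-((n+1:ℕ)*φ)) * E φ := by rw [← E_add]; congr 1; push_cast; ring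
  unfold zz
  rw [h1]
  push_cast
  have h2 := two_cos φ
  have h3 := E_neg_mul φ
  push_cast at h2
  linear_combination (E (-((n+1)*φ)) * v (n+1)) * h2 + (E (-((n+1)*φ)) * v n) * h3

lemma asym (s C B : ℝ) (hs : 0 < s) (hC : 0 ≤ C) (hB : 0 ≤ B) : ∃ M, 0 ≤ M ∧ ∀ φ, s ≤ sin φ → ∀ v : ℕ → ℝ,
    |v 0| ≤ B → |v 1| ≤ B →
    (∀ n : ℕ, |v (n+2) - 2 * cos φ * v (n+1) + v n| ≤ C/((n:ℝ)+1)^2*(|v n|+|v (n+1)|)) →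
    (∀ n, |v n| ≤ M) ∧ ∃ Z : ℂ, ∀ n : ℕ, ‖Z - zz φ v n‖ ≤ M/((n:ℝ)+1) := by
  obtain ⟨K, hK⟩ : ∃ K, K = C * (1+2/s) := ⟨_, rfl⟩
  have hK0 : 0 ≤ K := by rw [hK]; positivity
  obtain ⟨M0, hM0⟩ : ∃ M0, M0 = exp (2*K) * (2*B) := ⟨_, rfl⟩
  have hM00 : 0 ≤ M0 := by rw [hM0]; positivity
  refine ⟨max (M0/s) (2*K*M0), le_max_of_le_left (by positivity), fun φ hφ v h0 h1 hr => ?_⟩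
  have hv : ∀ n, |v n| ≤ ‖zz φ v n‖ / s := fun n => by
    rw [le_div_iff₀ hs]
    have h2 := Complex.abs_im_le_norm (E (n*φ) * zz φ v n)
    rw [zz_im, norm_mul, E_norm, one_mul, abs_mul, abs_of_pos (hs.trans_le hφ)] at h2
    nlinarith [abs_nonneg (v n)]
  have hv1 : ∀ n, |v (n+1)| ≤ ‖zz φ v n‖ * (1+1/s) := fun n => by
    have h2 : (v (n+1) : ℂ) = E (n*φ) * zz φ v n + E (-φ) * v n := by rw [zz_mul]; ring
    have h3 : |v (n+1)| ≤ ‖zz φ v n‖ + |v n| := by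
      calc |v (n+1)| = ‖(v (n+1) : ℂ)‖ := by simp
        _ ≤ ‖E (n*φ) * zz φ v n‖ + ‖E (-φ) * v n‖ := by rw [h2]; exact norm_add_le _ _
        _ = _ := by simp [E_norm]
    have := hv n
    have e : ‖zz φ v n‖ * (1+1/s) = ‖zz φ v n‖ + ‖zz φ v n‖ / s := by ring
    linarith
  have htel : ∀ n : ℕ, 1/((n:ℝ)+1)^2 ≤ 2*(1/((n:ℝ)+1) - 1/((n:ℝ)+2)) := fun n => by
    have : (0:ℝ) ≤ n := Nat.cast_nonneg n
    rw [div_sub_div _ _ (by positivity) (by positivity), ← mul_div_assoc, div_le_div_iff₀ (by positivity) (by positivity)]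
    nlinarith
  have hst : ∀ n : ℕ, ‖zz φ v (n+1) - zz φ v n‖ ≤ 2*K*(1/((n:ℝ)+1) - 1/((n:ℝ)+2)) * ‖zz φ v n‖ := fun n => by
    rw [zz_step, norm_mul, E_norm, one_mul, Complex.norm_real]
    refine (hr n).trans ?_
    have h2 : |v n| + |v (n+1)| ≤ (1+2/s) * ‖zz φ v n‖ := by
      have := hv n
      have := hv1 n
      have e : (1+2/s) * ‖zz φ v n‖ = ‖zz φ v n‖ / s + ‖zz φ v n‖ * (1+1/s) := by ring
      linarith
    calc C/((n:ℝ)+1)^2*(|v n|+|v (n+1)|) ≤ C/((n:ℝ)+1)^2*((1+2/s) * ‖zz φ v n‖) := by gcongr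
      _ = K * (1/((n:ℝ)+1)^2) * ‖zz φ v n‖ := by rw [hK]; ring
      _ ≤ K * (2*(1/((n:ℝ)+1) - 1/((n:ℝ)+2))) * ‖zz φ v n‖ := by gcongr; exact htel n
      _ = _ := by ring
  have hz0 : ‖zz φ v 0‖ ≤ 2*B := by
    rw [zz_norm]
    refine (norm_sub_le _ _).trans ?_
    rw [norm_mul, E_norm, one_mul, Complex.norm_real, Complex.norm_real, norm_eq_abs, norm_eq_abs, zero_add]
    linarith
  have hz : ∀ n : ℕ, ‖zz φ v n‖ ≤ exp (2*K*(1-1/((n:ℝ)+1))) * (2*B) := by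
    intro n
    induction n with
    | zero => simpa using hz0
    | succ n ih =>
      have h2 : ‖zz φ v (n+1)‖ ≤ (1 + 2*K*(1/((n:ℝ)+1) - 1/((n:ℝ)+2))) * ‖zz φ v n‖ := by
        have := norm_le_norm_add_norm_sub' (zz φ v (n+1)) (zz φ v n)
        have := hst n
        linarith
      refine h2.trans ?_
      have h3 : 1 + 2*K*(1/((n:ℝ)+1) - 1/((n:ℝ)+2)) ≤ exp (2*K*(1/((n:ℝ)+1) - 1/((n:ℝ)+2))) := by
        rw [add_comm]; exact add_one_le_exp _
      calc _ ≤ exp (2*K*(1/((n:ℝ)+1) - 1/((n:ℝ)+2))) * (exp (2*K*(1-1/((n:ℝ)+1))) * (2*B)) := by gcongr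
        _ = _ := by
          rw [← mul_assoc, ← exp_add]; congr 2; push_cast; ring
  have hzM : ∀ n : ℕ, ‖zz φ v n‖ ≤ M0 := fun n => (hz n).trans (by
    rw [hM0]
    have : 0 ≤ 1/((n:ℝ)+1) := by positivity
    exact mul_le_mul_of_nonneg_right (exp_le_exp.2 (by nlinarith)) (by positivity))
  refine ⟨fun n => le_max_of_le_left ((hv n).trans (by gcongr; exact hzM n)), ?_⟩
  have hd : ∀ n k : ℕ, ‖zz φ v (n+k) - zz φ v n‖ ≤ 2*K*M0*(1/((n:ℝ)+1) - 1/((n:ℝ)+k+1)) := by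
    intro n k
    induction k with
    | zero => simp
    | succ k ih =>
      have h2 := hst (n+k)
      have h3 : 0 ≤ 2*K*(1/(((n+k:ℕ):ℝ)+1) - 1/(((n+k:ℕ):ℝ)+2)) := by
        have := htel (n+k)
        have : 0 ≤ 1/(((n+k:ℕ):ℝ)+1)^2 := by positivity
        apply mul_nonneg <;> linarith
      have h4 := h2.trans (mul_le_mul_of_nonneg_left (hzM (n+k)) h3)
      have h5 := norm_sub_le_norm_sub_add_norm_sub (zz φ v (n+(k+1))) (zz φ v (n+k)) (zz φ v n)
      refine h5.trans ((add_le_add h4 ih).trans (le_of_eq ?_))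
      push_cast
      ring_nf
  have hd2 : ∀ n m : ℕ, n ≤ m → dist (zz φ v n) (zz φ v m) ≤ 2*K*M0/((n:ℝ)+1) := fun n m hnm => by
    obtain ⟨k, rfl⟩ := Nat.exists_eq_add_of_le hnm
    rw [dist_comm, dist_eq_norm]
    refine (hd n k).trans ?_
    have : 0 ≤ 1/((n:ℝ)+k+1) := by positivity
    have h6 : 0 ≤ 2*K*M0 := by positivity
    rw [div_eq_mul_one_div (2*K*M0)]
    gcongr
    linarith
  have ht : Tendsto (fun n : ℕ => 2*K*M0/((n:ℝ)+1)) atTop (nhds 0) := by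
    have := (tendsto_one_div_add_atTop_nhds_zero_nat (𝕜 := ℝ)).const_mul (2*K*M0)
    simpa [div_eq_mul_inv] using this
  obtain ⟨Z, hZ⟩ := cauchySeq_tendsto_of_complete (cauchySeq_of_le_tendsto_0' _ hd2 ht)
  refine ⟨Z, fun n => ?_⟩
  have h7 : ‖Z - zz φ v n‖ ≤ 2*K*M0/((n:ℝ)+1) := by
    refine le_of_tendsto ((hZ.sub_const (zz φ v n)).norm) ?_
    filter_upwards [eventually_ge_atTop n] with m hm
    rw [← dist_eq_norm, dist_comm]; exact hd2 n m hm
  exact h7.trans (by gcongr; exact le_max_right _ _)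

end RJ
end

section
namespace RJ

variable {τ : ℝ} {μ : Measure ℝ} {p : ℝ → ℝ} {v dv : ℕ → ℝ → ℝ} {a b : ℕ → ℝ} {e f : ℝ}

lemma abdd (h : JData τ μ p v dv a b e f) : ∃ C, 0 ≤ C ∧ ∀ n : ℕ, |a n - 1/2| ≤ C / ((n:ℝ)+1)^2 ∧
    |b n| ≤ C / ((n:ℝ)+1)^2 := by
  obtain ⟨C1, h1⟩ := h.aasy
  obtain ⟨C2, h2⟩ := h.basy
  refine ⟨max (max C1 C2) 0, le_max_right _ _, fun n => ⟨(h1 n).trans ?_, (h2 n).trans ?_⟩⟩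
  · gcongr; exact (le_max_left _ _).trans (le_max_left _ _)
  · gcongr; exact (le_max_right _ _).trans (le_max_left _ _)

lemma a_tendsto (h : JData τ μ p v dv a b e f) : Tendsto a atTop (nhds (1/2)) := by
  obtain ⟨C, hC, hab⟩ := abdd h
  rw [tendsto_iff_dist_tendsto_zero]
  have ht : Tendsto (fun n : ℕ => C/((n:ℝ)+1)) atTop (nhds 0) := by
    have := (tendsto_one_div_add_atTop_nhds_zero_nat (𝕜 := ℝ)).const_mul C
    simpa [div_eq_mul_inv] using this
  refine squeeze_zero (fun n => dist_nonneg) (fun n => ?_) ht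
  rw [dist_eq_norm, norm_eq_abs]
  refine (hab n).1.trans ?_
  gcongr
  have : (0:ℝ) ≤ n := Nat.cast_nonneg n
  nlinarith

lemma ainv (h : JData τ μ p v dv a b e f) : ∃ L, 0 ≤ L ∧ ∀ n, 1 / a n ≤ L := by
  have h1 : Tendsto (fun n => 1 / a n) atTop (nhds (1/(1/2))) :=
    tendsto_const_nhds.div (a_tendsto h) (by norm_num)
  obtain ⟨L, hL⟩ := h1.bddAbove_range
  have h2 : ∀ n, 1 / a n ≤ L := fun n => hL ⟨n, rfl⟩
  exact ⟨L, (one_div_pos.2 (h.apos 0)).le.trans (h2 0), h2⟩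

lemma abnd (h : JData τ μ p v dv a b e f) : ∃ L, 0 ≤ L ∧ ∀ n, |a n| ≤ L ∧ |b n| ≤ L := by
  obtain ⟨C, hC, hab⟩ := abdd h
  have h1 : ∀ n : ℕ, C / ((n:ℝ)+1)^2 ≤ C := fun n => by
    apply div_le_self hC
    have : (0:ℝ) ≤ n := Nat.cast_nonneg n
    nlinarith
  refine ⟨C + 1/2, by positivity, fun n => ⟨?_, ?_⟩⟩
  · have := (hab n).1.trans (h1 n)
    have h2 := abs_add_le (a n - 1/2) (1/2)
    rw [sub_add_cancel, abs_of_pos (show (0:ℝ) < 1/2 by norm_num)] at h2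
    linarith
  · have := (hab n).2.trans (h1 n)
    linarith

lemma rec_err (h : JData τ μ p v dv a b e f) : ∃ C, 0 ≤ C ∧ ∀ (φ : ℝ) (n : ℕ),
    |v (n+2) φ - 2 * cos φ * v (n+1) φ + v n φ| ≤ C/((n:ℝ)+1)^2*(|v n φ|+|v (n+1) φ|) := by
  obtain ⟨C, hC, hab⟩ := abdd h
  obtain ⟨L, hL, hLa⟩ := ainv h
  refine ⟨L * (3*C), by positivity, fun φ n => ?_⟩
  set d := C / ((n:ℝ)+1)^2 with hd
  have hd0 : 0 ≤ d := by positivity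
  have hmono : C / (((n+1:ℕ):ℝ)+1)^2 ≤ d := by
    rw [hd]; gcongr; push_cast; linarith
  have ha1 := (hab (n+1)).1.trans hmono
  have hb1 := (hab (n+1)).2.trans hmono
  have ha0 := (hab n).1
  have hp := h.apos (n+1)
  have e1 : v (n+2) φ - 2 * cos φ * v (n+1) φ + v n φ =
      (1 / a (n+1)) * ((-(2 * cos φ * (a (n+1) - 1/2)) - b (n+1)) * v (n+1) φ
        + ((a (n+1) - 1/2) - (a n - 1/2)) * v n φ) := by
    have := h.recs n φ
    field_simp
    linear_combination -2 * this
  rw [e1, abs_mul, abs_of_pos (one_div_pos.2 hp)]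
  have hcos := abs_cos_le_one φ
  have e2 : |-(2 * cos φ * (a (n+1) - 1/2)) - b (n+1)| ≤ 3 * d := by
    refine (abs_sub _ _).trans ?_
    rw [abs_neg, abs_mul, abs_mul, abs_two]
    nlinarith [abs_nonneg (a (n+1) - 1/2), abs_nonneg (cos φ)]
  have e3 : |(a (n+1) - 1/2) - (a n - 1/2)| ≤ 3 * d := by
    refine (abs_sub _ _).trans ?_
    linarith
  calc _ ≤ L * (3 * d * |v (n+1) φ| + 3 * d * |v n φ|) := by
        gcongr
        · exact hLa _
        · refine (abs_add_le _ _).trans ?_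
          rw [abs_mul, abs_mul]; gcongr
    _ = _ := by rw [hd]; ring

set_option maxHeartbeats 1000000 in
lemma loc (h : JData τ μ p v dv a b e f) {s : ℝ} (hs : 0 < s) : ∃ M, 0 ≤ M ∧ ∀ φ, s ≤ sin φ →
    (∀ n, |v n φ| ≤ M) ∧ (∀ n : ℕ, |dv n φ| ≤ M * ((n:ℝ)+1)) ∧ ∃ Z : ℂ, ‖Z‖ ≤ M ∧
    (∀ n : ℕ, ‖Z - zz φ (fun k => v k φ) n‖ ≤ M/((n:ℝ)+1)) ∧
    ∀ n : ℕ, |sin φ * dv (n+1) φ - ((n:ℝ)+1) * (E (((n:ℝ)+1)*φ) * Z).re| ≤ M := by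
  obtain ⟨C, hC, hr⟩ := rec_err h
  obtain ⟨C', hC', hab⟩ := abdd h
  obtain ⟨B0, hB0⟩ := h.bdd 0
  obtain ⟨B1, hB1⟩ := h.bdd 1
  have hB00 : 0 ≤ B0 := (abs_nonneg _).trans (hB0 0)
  obtain ⟨M, hM, hasym⟩ := asym s C (max B0 B1) hs hC (le_max_of_le_left hB00)
  obtain ⟨T, hT⟩ : ∃ T, T = 3 + 2*|τ| := ⟨_, rfl⟩
  have hT0 : 0 ≤ T := by rw [hT]; positivity
  obtain ⟨K, hK⟩ : ∃ K, K = 1/2*((T + C'*T) + (T+C'*T) + (|e|+|f|) + 2*C)*M := ⟨_, rfl⟩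
  have hK0 : 0 ≤ K := by rw [hK]; positivity
  refine ⟨max (3*M+K) ((1/s)*(4*M+K)), le_max_of_le_left (by positivity), fun φ hφ => ?_⟩
  obtain ⟨hv, Z, hZ⟩ := hasym φ hφ (fun k => v k φ) ((hB0 φ).trans (le_max_left _ _))
    ((hB1 φ).trans (le_max_right _ _)) (hr φ)
  have hZn : ‖Z‖ ≤ 3*M := by
    have h1 := hZ 0
    have h2 : ‖zz φ (fun k => v k φ) 0‖ ≤ M + M := by
      rw [zz_norm]
      refine (norm_sub_le _ _).trans ?_
      rw [norm_mul, E_norm, one_mul, Complex.norm_real, Complex.norm_real]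
      exact add_le_add (hv _) (hv _)
    have h3 := norm_le_norm_add_norm_sub' Z (zz φ (fun k => v k φ) 0)
    simp only [Nat.cast_zero, zero_add, div_one] at h1
    linarith
  have hMM : M ≤ max (3*M+K) ((1/s)*(4*M+K)) := le_max_of_le_left (by linarith)
  have hS : ∀ n : ℕ, |sin φ * dv (n+1) φ - ((n:ℝ)+1) * (E (((n:ℝ)+1)*φ) * Z).re| ≤ M + K := fun n => by
    have hn : (0:ℝ) ≤ n := Nat.cast_nonneg n
    have h1 := zz_re φ (fun k => v k φ) (n+1)
    push_cast at h1
    have h2 : |(((n:ℝ)+1)) * (E (((n:ℝ)+1)*φ) * (Z - zz φ (fun k => v k φ) (n+1))).re| ≤ M := by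
      rw [abs_mul, abs_of_pos (by positivity)]
      have h3 := hZ (n+1)
      have h4 := Complex.abs_re_le_norm (E (((n:ℝ)+1)*φ) * (Z - zz φ (fun k => v k φ) (n+1)))
      rw [norm_mul, E_norm, one_mul] at h4
      have h5 := h4.trans h3
      calc _ ≤ ((n:ℝ)+1) * (M / (((n+1:ℕ):ℝ)+1)) := by gcongr
        _ ≤ M := by
          rw [← mul_div_assoc, div_le_iff₀ (by positivity)]; push_cast; nlinarith
    have h6 : ∀ m : ℕ, n ≤ m → |a m - 1/2| * ((n:ℝ)+1) ≤ C' := fun m hm => by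
      have hm' : (n:ℝ) ≤ m := by exact_mod_cast hm
      calc _ ≤ C' / ((m:ℝ)+1)^2 * ((n:ℝ)+1) := by gcongr; exact (hab m).1
        _ ≤ C' := by
          rw [div_mul_eq_mul_div, div_le_iff₀ (by positivity)]
          gcongr; nlinarith
    have h7 : |2*(n:ℝ)+3+2*τ| ≤ T * ((n:ℝ)+1) := by
      have := neg_abs_le τ
      have := le_abs_self τ
      have := mul_nonneg (abs_nonneg τ) hn
      rw [abs_le, hT]; constructor <;> nlinarith
    have h8 : |2*(n:ℝ)+1+2*τ| ≤ T * ((n:ℝ)+1) := by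
      have := neg_abs_le τ
      have := le_abs_self τ
      have := mul_nonneg (abs_nonneg τ) hn
      rw [abs_le, hT]; constructor <;> nlinarith
    have e1 : sin φ * dv (n+1) φ - ((n:ℝ)+1) * (E (((n:ℝ)+1)*φ) * Z).re =
      1/2 * ((1/2*(1+2*τ) + (a (n+1) - 1/2) * (2*n+3+2*τ)) * v (n+2) φ -
        (1/2*(2*τ-1) + (a n - 1/2) * (2*n+1+2*τ)) * v n φ + (e - f * cos φ) * v (n+1) φ
        - (n+1) * (v (n+2) φ - 2 * cos φ * v (n+1) φ + v n φ))
      - (((n:ℝ)+1)) * (E (((n:ℝ)+1)*φ) * (Z - zz φ (fun k => v k φ) (n+1))).re := by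
      rw [mul_sub (E _), Complex.sub_re, h1, h.str]; ring
    have b1 : |1/2*(1+2*τ) + (a (n+1) - 1/2) * (2*n+3+2*τ)| ≤ T + C'*T := by
      refine (abs_add_le _ _).trans (add_le_add ?_ ?_)
      · have := neg_abs_le τ
        have := le_abs_self τ
        rw [abs_le, hT]; constructor <;> linarith
      · rw [abs_mul]
        have := h6 (n+1) (by omega)
        calc _ ≤ |a (n+1) - 1/2| * (T * ((n:ℝ)+1)) := by gcongr
          _ = (|a (n+1) - 1/2| * ((n:ℝ)+1)) * T := by ring
          _ ≤ _ := by gcongr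
    have b2 : |1/2*(2*τ-1) + (a n - 1/2) * (2*n+1+2*τ)| ≤ T + C'*T := by
      refine (abs_add_le _ _).trans (add_le_add ?_ ?_)
      · have := neg_abs_le τ
        have := le_abs_self τ
        rw [abs_le, hT]; constructor <;> linarith
      · rw [abs_mul]
        have := h6 n le_rfl
        calc _ ≤ |a n - 1/2| * (T * ((n:ℝ)+1)) := by gcongr
          _ = (|a n - 1/2| * ((n:ℝ)+1)) * T := by ring
          _ ≤ _ := by gcongr
    have b3 : |e - f * cos φ| ≤ |e| + |f| := by
      refine (abs_sub _ _).trans ?_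
      rw [abs_mul]
      have := abs_cos_le_one φ
      nlinarith [abs_nonneg f]
    have b4 : |((n:ℝ)+1) * (v (n+2) φ - 2 * cos φ * v (n+1) φ + v n φ)| ≤ 2*C*M := by
      rw [abs_mul, abs_of_pos (by positivity : (0:ℝ) < (n:ℝ)+1)]
      calc _ ≤ ((n:ℝ)+1) * (C/((n:ℝ)+1)^2*(M+M)) := by
            have h9 := hr φ n
            have h10 := hv n
            have h11 := hv (n+1)
            refine mul_le_mul_of_nonneg_left (h9.trans ?_) (by positivity)
            gcongr
        _ = C*(2*M)/((n:ℝ)+1) := by field_simp; ring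
        _ ≤ _ := by rw [div_le_iff₀ (by positivity)]; nlinarith [mul_nonneg hC hM, mul_nonneg (mul_nonneg hC hM) hn]
    rw [e1]
    have b5 : ∀ w x y z : ℝ, |w - x + y - z| ≤ |w| + |x| + |y| + |z| := fun w x y z => by
      have := abs_sub (w - x + y) z
      have := abs_add_le (w-x) y
      have := abs_sub w x
      linarith
    refine (abs_sub _ _).trans ?_
    rw [add_comm M K]
    refine add_le_add ?_ h2
    rw [abs_mul, abs_of_pos (show (0:ℝ) < 1/2 by norm_num), hK, mul_assoc (1/2) _ M]
    refine mul_le_mul_of_nonneg_left ((b5 _ _ _ _).trans ?_) (by norm_num)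
    rw [abs_mul, abs_mul (1/2*(2*τ-1) + (a n - 1/2) * (2*n+1+2*τ)), abs_mul (e - f * cos φ)]
    calc _ ≤ (T + C'*T) * M + (T + C'*T) * M + (|e| + |f|) * M + 2*C*M := by
          gcongr
          · exact hv _
          · exact hv _
          · exact hv _
      _ = _ := by ring
  refine ⟨fun n => (hv n).trans hMM, ?_, Z, hZn.trans (le_max_of_le_left (by linarith)), fun n => (hZ n).trans (by gcongr),
    fun n => (hS n).trans (le_max_of_le_left (by linarith))⟩
  intro n
  rcases n with _ | n
  · rw [h.dv0]; simp; exact Or.inl (by positivity)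
  · refine le_trans ?_ (mul_le_mul_of_nonneg_right (le_max_right _ _) (by positivity))
    have h1 := hS n
    have hs' : s * |dv (n+1) φ| ≤ |sin φ * dv (n+1) φ| := by
      rw [abs_mul, abs_of_pos (hs.trans_le hφ)]; gcongr
    have h2 : |((n:ℝ)+1) * (E (((n:ℝ)+1)*φ) * Z).re| ≤ ((n:ℝ)+1) * (3*M) := by
      rw [abs_mul, abs_of_pos (by positivity : (0:ℝ) < (n:ℝ)+1)]
      have h4 := Complex.abs_re_le_norm (E (((n:ℝ)+1)*φ) * Z)
      rw [norm_mul, E_norm, one_mul] at h4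
      gcongr; linarith
    have h3 : |sin φ * dv (n+1) φ| ≤ (M + K) + ((n:ℝ)+1) * (3*M) := by
      have := abs_add_le (sin φ * dv (n+1) φ - ((n:ℝ)+1) * (E (((n:ℝ)+1)*φ) * Z).re) (((n:ℝ)+1) * (E (((n:ℝ)+1)*φ) * Z).re)
      rw [sub_add_cancel] at this
      linarith
    have hn : (0:ℝ) ≤ n := Nat.cast_nonneg n
    rw [mul_assoc, div_mul_eq_mul_div, one_mul, le_div_iff₀ hs, mul_comm _ s]
    push_cast
    nlinarith [mul_nonneg hn hM, mul_nonneg hn hK0]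

end RJ
end

section
namespace RJ

variable {τ : ℝ} {μ : Measure ℝ} {p : ℝ → ℝ} {v dv : ℕ → ℝ → ℝ} {a b : ℕ → ℝ} {e f : ℝ}

lemma pick {x A B w : ℝ} (hx : 0 ≤ x) (hx1 : x ≤ 1) (hA : 0 ≤ A) (hB : 0 ≤ B)
    (h : ∀ n : ℕ, w ≤ A/((n:ℝ)+1) + B*((n:ℝ)+1)*x) : w ≤ (A + 2*B) * √x := by
  rcases hx.eq_or_lt with rfl | hx0
  · simp only [sqrt_zero, mul_zero, add_zero] at h ⊢
    have ht : Tendsto (fun n : ℕ => A/((n:ℝ)+1)) atTop (nhds 0) := by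
      have := (tendsto_one_div_add_atTop_nhds_zero_nat (𝕜 := ℝ)).const_mul A
      simpa [div_eq_mul_inv] using this
    exact ge_of_tendsto' ht h
  · have hq : 0 < √x := sqrt_pos.2 hx0
    have hq1 : √x ≤ 1 := by rw [sqrt_le_one]; exact hx1
    have hqq : √x * √x = x := mul_self_sqrt hx
    have h1 := h ⌊1/√x⌋₊
    have h2 : 1/√x < (⌊1/√x⌋₊:ℝ)+1 := Nat.lt_floor_add_one _
    have h3 : (⌊1/√x⌋₊:ℝ) ≤ 1/√x := Nat.floor_le (by positivity)
    have h4 : (1:ℝ) ≤ 1/√x := by rw [le_div_iff₀ hq]; linarith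
    have h5 : A/((⌊1/√x⌋₊:ℝ)+1) ≤ A * √x := by
      calc _ ≤ A/(1/√x) := by gcongr
        _ = _ := by field_simp
    have h6 : B*((⌊1/√x⌋₊:ℝ)+1)*x ≤ 2*B*√x := by
      calc _ ≤ B*(2*(1/√x))*x := by gcongr; linarith
        _ = B*(2*(1/√x))*(√x*√x) := by rw [hqq]
        _ = _ := by field_simp
    calc w ≤ _ := h1
      _ ≤ A * √x + 2*B*√x := by gcongr
      _ = _ := by ring

structure LD (p : ℝ → ℝ) (v dv : ℕ → ℝ → ℝ) (θ r s M : ℝ) (W : ℝ → ℂ) (Y : ℂ) : Prop where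
  r0 : 0 < r
  r1 : r ≤ 1
  rl : 0 < θ - r
  rr : θ + r < π
  s0 : 0 < s
  M0 : 0 ≤ M
  WY : W θ = p θ * Y
  Yb : ‖Y‖ ≤ M
  dY : ∀ n : ℕ, |dv (n+1) θ - ((n:ℝ)+1) * (E (((n:ℝ)+1)*θ) * Y).re| ≤ M
  sb : ∀ φ, |φ-θ| ≤ r → s ≤ sin φ
  pb : ∀ φ, |φ-θ| ≤ r → |p φ| ≤ M
  vb : ∀ φ, |φ-θ| ≤ r → ∀ n, |v n φ| ≤ M
  dvb : ∀ φ, |φ-θ| ≤ r → ∀ n : ℕ, |dv n φ| ≤ M * ((n:ℝ)+1)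
  Wb : ∀ φ, |φ-θ| ≤ r → ‖W φ‖ ≤ M
  Wh : ∀ φ, |φ-θ| ≤ r → ‖W φ - W θ‖ ≤ M * √|φ-θ|
  dW : ∀ φ, |φ-θ| ≤ r → ∀ n : ℕ, |p φ * dv (n+1) φ - ((n:ℝ)+1) * (E (((n:ℝ)+1)*φ) * W φ).re| ≤ M

set_option maxHeartbeats 1000000 in
lemma asymp (h : JData τ μ p v dv a b e f) {θ : ℝ} (hθ : θ ∈ Ioo 0 π) :
    ∃ r s M W Y, LD p v dv θ r s M W Y := by
  obtain ⟨r, hr⟩ : ∃ r, r = min 1 (min (θ/2) ((π-θ)/2)) := ⟨_, rfl⟩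
  have hθ1 := hθ.1
  have hθ2 := hθ.2
  have r0 : 0 < r := by
    rw [hr]; refine lt_min one_pos (lt_min ?_ ?_) <;> linarith
  have r1 : r ≤ 1 := hr ▸ min_le_left _ _
  have r2 : r ≤ θ/2 := hr ▸ (min_le_right _ _).trans (min_le_left _ _)
  have r3 : r ≤ (π-θ)/2 := hr ▸ (min_le_right _ _).trans (min_le_right _ _)
  have rl : 0 < θ - r := by linarith
  have rr : θ + r < π := by linarith
  set I := Icc (θ-r) (θ+r) with hI
  have hIc : IsCompact I := isCompact_Icc
  have hIv : Convex ℝ I := convex_Icc _ _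
  have hθI : θ ∈ I := ⟨by linarith, by linarith⟩
  have hIsub : I ⊆ Ioo 0 π := fun x hx => ⟨by linarith [hx.1], by linarith [hx.2]⟩
  have hmem : ∀ φ, |φ-θ| ≤ r → φ ∈ I := fun φ hφ => by
    rw [abs_le] at hφ; exact ⟨by linarith, by linarith⟩
  have hsinpos : ∀ φ ∈ I, 0 < sin φ := fun φ hφ => sin_pos_of_mem_Ioo (hIsub hφ)
  obtain ⟨s, s0, hs⟩ : ∃ s, 0 < s ∧ ∀ φ ∈ I, s ≤ sin φ := by
    obtain ⟨x, hx, hx2⟩ := hIc.exists_isMinOn ⟨θ, hθI⟩ continuous_sin.continuousOn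
    exact ⟨sin x, hsinpos x hx, fun φ hφ => hx2 hφ⟩
  obtain ⟨M, hM, hloc⟩ := loc h s0
  have hq : ContDiffOn ℝ 1 (fun φ => p φ / sin φ) I :=
    (h.psm.mono hIsub).div (contDiff_sin.contDiffOn) (fun x hx => (hsinpos x hx).ne')
  obtain ⟨L, hL⟩ := hq.exists_lipschitzOnWith one_ne_zero hIv hIc
  obtain ⟨Q, hQ⟩ := hIc.exists_bound_of_continuousOn hq.continuousOn
  obtain ⟨Pb, hPb⟩ := hIc.exists_bound_of_continuousOn (h.psm.mono hIsub).continuousOn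
  have hQ0 : 0 ≤ Q := (norm_nonneg _).trans (hQ θ hθI)
  have hPb0 : 0 ≤ Pb := (norm_nonneg _).trans (hPb θ hθI)
  have hL0 : (0:ℝ) ≤ L := L.2
  have hZ : ∀ φ, ∃ Z : ℂ, φ ∈ I → ‖Z‖ ≤ M ∧
    (∀ n : ℕ, ‖Z - zz φ (fun k => v k φ) n‖ ≤ M/((n:ℝ)+1)) ∧
    ∀ n : ℕ, |sin φ * dv (n+1) φ - ((n:ℝ)+1) * (E (((n:ℝ)+1)*φ) * Z).re| ≤ M := fun φ => by
    by_cases hφ : φ ∈ I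
    · obtain ⟨Z, hZ⟩ := (hloc φ (hs φ hφ)).2.2
      exact ⟨Z, fun _ => hZ⟩
    · exact ⟨0, fun h => absurd h hφ⟩
  choose Z hZ using hZ
  have hv : ∀ φ ∈ I, ∀ n, |v n φ| ≤ M := fun φ hφ => (hloc φ (hs φ hφ)).1
  have hdv : ∀ φ ∈ I, ∀ n : ℕ, |dv n φ| ≤ M * ((n:ℝ)+1) := fun φ hφ => (hloc φ (hs φ hφ)).2.1
  have hvl : ∀ φ ∈ I, ∀ n : ℕ, |v n φ - v n θ| ≤ M * ((n:ℝ)+1) * |φ - θ| := fun φ hφ n =>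
    Convex.norm_image_sub_le_of_norm_hasDerivWithin_le (f := v n) (f' := dv n) (s := I)
      (fun x hx => (h.hd n x).hasDerivWithinAt) (fun x hx => hdv x hx n) hIv hθI hφ
  have hzz : ∀ φ ∈ I, ∀ n : ℕ, ‖zz φ (fun k => v k φ) n - zz θ (fun k => v k θ) n‖ ≤
      4 * M * ((n:ℝ)+1) * |φ - θ| := fun φ hφ n => by
    have e1 : zz φ (fun k => v k φ) n - zz θ (fun k => v k θ) n =
      (E (-(n*φ)) - E (-(n*θ))) * ((v (n+1) φ : ℂ) - E (-φ) * v n φ) +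
      E (-(n*θ)) * (((v (n+1) φ - v (n+1) θ : ℝ) : ℂ) - ((E (-φ) - E (-θ)) * v n φ +
        E (-θ) * ((v n φ - v n θ : ℝ) : ℂ))) := by
      unfold zz; push_cast; ring
    have l1 : ‖E (-(n*φ)) - E (-(n*θ))‖ ≤ n * |φ-θ| := by
      refine (E_lip _ _).trans (le_of_eq ?_)
      rw [show -(n*φ) - -(n*θ) = -(n*(φ-θ)) by ring, abs_neg, abs_mul, Nat.abs_cast]
    have l2 : ‖E (-φ) - E (-θ)‖ ≤ |φ-θ| := by
      refine (E_lip _ _).trans (le_of_eq ?_)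
      rw [show -φ - -θ = -(φ-θ) by ring, abs_neg]
    have l3 : ‖(v (n+1) φ : ℂ) - E (-φ) * v n φ‖ ≤ 2*M := by
      refine (norm_sub_le _ _).trans ?_
      rw [norm_mul, E_norm, one_mul, Complex.norm_real, Complex.norm_real]
      have h1 := hv φ hφ (n+1)
      have h2 := hv φ hφ n
      simp only [norm_eq_abs]; linarith
    have l4 := hvl φ hφ (n+1)
    have l5 := hvl φ hφ n
    have l6 := hv φ hφ n
    push_cast at l4
    rw [e1]
    calc _ ≤ ‖E (-(n*φ)) - E (-(n*θ))‖ * ‖(v (n+1) φ : ℂ) - E (-φ) * v n φ‖ +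
        (|v (n+1) φ - v (n+1) θ| + (‖E (-φ) - E (-θ)‖ * |v n φ| + |v n φ - v n θ|)) := by
          refine (norm_add_le _ _).trans ?_
          rw [norm_mul, norm_mul (E _), E_norm, one_mul]
          gcongr
          refine (norm_sub_le _ _).trans ?_
          gcongr
          · rw [Complex.norm_real]; rfl
          · refine (norm_add_le _ _).trans ?_
            rw [norm_mul, norm_mul (E _), E_norm, one_mul, Complex.norm_real, Complex.norm_real]; rfl
      _ ≤ n * |φ-θ| * (2*M) + (M * ((n:ℝ)+1+1) * |φ - θ| + (|φ-θ| * M + M * ((n:ℝ)+1) * |φ - θ|)) := by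
          gcongr
      _ = _ := by ring
  have hZh : ∀ φ, |φ-θ| ≤ r → ‖Z φ - Z θ‖ ≤ 10 * M * √|φ-θ| := fun φ hφr => by
    have hφ := hmem φ hφr
    have := pick (x := |φ-θ|) (A := 2*M) (B := 4*M) (w := ‖Z φ - Z θ‖) (abs_nonneg _) (hφr.trans r1)
      (by positivity) (by positivity) (fun n => by
        have h1 := (hZ φ hφ).2.1 n
        have h2 := (hZ θ hθI).2.1 n
        have h3 := hzz φ hφ n
        have e1 : Z φ - Z θ = (Z φ - zz φ (fun k => v k φ) n) - (Z θ - zz θ (fun k => v k θ) n) +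
          (zz φ (fun k => v k φ) n - zz θ (fun k => v k θ) n) := by ring
        have h4 := norm_add_le ((Z φ - zz φ (fun k => v k φ) n) - (Z θ - zz θ (fun k => v k θ) n))
          (zz φ (fun k => v k φ) n - zz θ (fun k => v k θ) n)
        have h5 := norm_sub_le (Z φ - zz φ (fun k => v k φ) n) (Z θ - zz θ (fun k => v k θ) n)
        rw [← e1] at h4
        have e2 : 2*M/((n:ℝ)+1) = M/((n:ℝ)+1) + M/((n:ℝ)+1) := by ring
        rw [e2]
        linarith)
    refine this.trans (le_of_eq (by ring))
  obtain ⟨M1, hM1⟩ : ∃ M1, M1 = Pb + M + Q*M + M/s + (Q*(10*M) + L*M) := ⟨_, rfl⟩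
  have p1 : 0 ≤ Q*M := by positivity
  have p2 : 0 ≤ M/s := by positivity
  have p3 : 0 ≤ Q*(10*M) + L*M := by positivity
  refine ⟨r, s, M1, fun φ => ((p φ / sin φ : ℝ) : ℂ) * Z φ, ((1 / sin θ : ℝ) : ℂ) * Z θ, ?_⟩
  have hsθ := hs θ hθI
  refine ⟨r0, r1, rl, rr, s0, by linarith, ?_, ?_, ?_, fun φ hφ => hs φ (hmem φ hφ),
    fun φ hφ => (hPb φ (hmem φ hφ)).trans (by linarith),
    fun φ hφ n => (hv φ (hmem φ hφ) n).trans (by linarith),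
    fun φ hφ n => (hdv φ (hmem φ hφ) n).trans (by gcongr; linarith), ?_, ?_, ?_⟩
  · push_cast; ring
  · rw [norm_mul, Complex.norm_real, norm_eq_abs, abs_of_pos (one_div_pos.2 (s0.trans_le hsθ))]
    have h1 := (hZ θ hθI).1
    calc _ ≤ 1/s * M := by gcongr
      _ = M/s := by ring
      _ ≤ _ := by linarith
  · intro n
    have h1 := (hZ θ hθI).2.2 n
    have hsp := s0.trans_le hsθ
    have e1 : dv (n+1) θ - ((n:ℝ)+1) * (E (((n:ℝ)+1)*θ) * (((1 / sin θ : ℝ) : ℂ) * Z θ)).re =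
      1/sin θ * (sin θ * dv (n+1) θ - ((n:ℝ)+1) * (E (((n:ℝ)+1)*θ) * Z θ).re) := by
      rw [mul_left_comm, Complex.re_ofReal_mul]; field_simp
    rw [e1, abs_mul, abs_of_pos (one_div_pos.2 hsp)]
    calc _ ≤ 1/s * M := by gcongr
      _ = M/s := by ring
      _ ≤ _ := by linarith
  · intro φ hφ
    rw [norm_mul, Complex.norm_real]
    calc _ ≤ Q * M := by
          gcongr
          · exact hQ φ (hmem φ hφ)
          · exact (hZ φ (hmem φ hφ)).1
      _ ≤ _ := by linarith
  · intro φ hφ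
    have e1 : ((p φ / sin φ : ℝ) : ℂ) * Z φ - ((p θ / sin θ : ℝ) : ℂ) * Z θ =
      ((p φ / sin φ : ℝ) : ℂ) * (Z φ - Z θ) + ((p φ / sin φ - p θ / sin θ : ℝ) : ℂ) * Z θ := by
      push_cast; ring
    have h1 := hL.dist_le_mul φ (hmem φ hφ) θ hθI
    rw [dist_eq_norm, dist_eq_norm, norm_eq_abs (φ - θ)] at h1
    have h2 : |φ-θ| ≤ √|φ-θ| := by
      have := mul_self_sqrt (abs_nonneg (φ-θ))
      have h3 : √|φ-θ| ≤ 1 := by rw [sqrt_le_one]; linarith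
      nlinarith [sqrt_nonneg |φ-θ|]
    have h4 := (hZ θ hθI).1
    rw [e1]
    refine (norm_add_le _ _).trans ?_
    rw [norm_mul, norm_mul, Complex.norm_real, Complex.norm_real]
    calc _ ≤ Q * (10 * M * √|φ-θ|) + (L * √|φ-θ|) * M := by
          gcongr
          · exact hQ φ (hmem φ hφ)
          · exact hZh φ hφ
          · exact h1.trans (by gcongr)
      _ = (Q*(10*M) + L*M) * √|φ-θ| := by ring
      _ ≤ _ := by gcongr; linarith
  · intro φ hφ n
    have h1 := (hZ φ (hmem φ hφ)).2.2 n
    have hsp := hsinpos φ (hmem φ hφ)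
    have e1 : p φ * dv (n+1) φ - ((n:ℝ)+1) * (E (((n:ℝ)+1)*φ) * (((p φ / sin φ : ℝ) : ℂ) * Z φ)).re =
      p φ / sin φ * (sin φ * dv (n+1) φ - ((n:ℝ)+1) * (E (((n:ℝ)+1)*φ) * Z φ).re) := by
      rw [mul_left_comm, Complex.re_ofReal_mul]; field_simp
    rw [e1, abs_mul]
    calc _ ≤ Q * M := by
          gcongr
          exact hQ φ (hmem φ hφ)
      _ ≤ _ := by linarith

end RJ
end

section
namespace RJ

variable {τ : ℝ} {μ : Measure ℝ} {p : ℝ → ℝ} {v dv : ℕ → ℝ → ℝ} {a b : ℕ → ℝ} {e f : ℝ}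

lemma ex_pow (t τ : ℝ) (n : ℕ) : exp (-t*((n:ℝ)+1+τ)) = exp (-t*(1+τ)) * exp (-t)^n := by
  rw [← exp_nat_mul, ← exp_add]; ring_nf

lemma ex_sum {t : ℝ} (ht : 0 < t) (τ : ℝ) : Summable (fun n : ℕ => exp (-t*((n:ℝ)+1+τ))) := by
  simp only [ex_pow]
  exact (summable_geometric_of_lt_one (exp_pos _).le (by rw [exp_lt_one_iff]; linarith)).mul_left _

lemma E_pow (x : ℝ) (n : ℕ) : E (((n:ℝ)+1)*x) = E x * E x^n := by
  unfold E; rw [← Complex.exp_nat_mul, ← Complex.exp_add]; push_cast; ring_nf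

lemma geo {t : ℝ} (ht : 0 < t) (τ x : ℝ) :
    ∃ S : ℂ, HasSum (fun n : ℕ => (exp (-t*((n:ℝ)+1+τ)) : ℂ) * E (((n:ℝ)+1)*x)) S ∧
    (sin (x/2) ≠ 0 → ‖S‖ ≤ exp (-t*(1/2+τ)) / (2*√(t*|sin (x/2)|))) := by
  have hlt : exp (-t) < 1 := by rw [exp_lt_one_iff]; linarith
  have hn : ‖(exp (-t) : ℂ) * E x‖ < 1 := by
    rw [norm_mul, E_norm, mul_one, Complex.norm_real,
      norm_eq_abs, abs_of_pos (exp_pos _)]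
    exact hlt
  have h1 := (hasSum_geometric_of_norm_lt_one hn).mul_left ((exp (-t*(1+τ)) : ℂ) * E x)
  refine ⟨_, h1.congr_fun ?_, fun hx => ?_⟩
  · intro n
    rw [E_pow]
    rw [ex_pow, mul_pow, Complex.ofReal_mul, Complex.ofReal_pow]; ring
  · have key : 2 * exp (-t/2) * √(t*|sin (x/2)|) ≤ ‖1 - (exp (-t) : ℂ) * E x‖ := by
      apply abs_le_of_sq_le_sq' _ (norm_nonneg _) |>.2
      rw [mul_pow, mul_pow, sq_sqrt (by positivity), Complex.sq_norm, Complex.normSq_apply]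
      simp only [Complex.sub_re, Complex.one_re, Complex.re_ofReal_mul, E_re, Complex.sub_im,
        Complex.one_im, Complex.im_ofReal_mul, E_im]
      have e1 : exp (-t) = exp (-t/2)^2 := by rw [sq, ← exp_add]; ring_nf
      have e2 := sin_sq_add_cos_sq x
      have e3 : cos x = 1 - 2 * sin (x/2)^2 := by
        have h5 := cos_two_mul (x/2)
        rw [show 2*(x/2) = x by ring] at h5
        have h4 := sin_sq_add_cos_sq (x/2)
        linarith
      have e4 : t * exp (-t/2) ≤ 1 - exp (-t) := by
        have h5 : exp (-t) = exp (-t/2) * exp (-t/2) := by rw [← exp_add]; ring_nf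
        have h6 : 1 = exp (-t/2) * exp (t/2) := by rw [← exp_add]; ring_nf; simp
        have h7 : t ≤ exp (t/2) - exp (-t/2) := by
          have := Real.self_le_sinh_iff.2 (show 0 ≤ t/2 by linarith)
          rw [sinh_eq] at this
          rw [show -t/2 = -(t/2) by ring]
          linarith
        nlinarith [exp_pos (-t/2)]
      set ρ := exp (-t/2)
      have hρ : 0 < ρ := exp_pos _
      have e5 : |sin (x/2)|^2 = sin (x/2)^2 := sq_abs _
      have h8 := abs_nonneg (sin (x/2))
      set y := |sin (x/2)|
      have e6 : (1 - exp (-t) * cos x) * (1 - exp (-t) * cos x) + (0 - exp (-t) * sin x) * (0 - exp (-t) * sin x)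
        = (1-exp (-t))^2 + 4*exp (-t)*y^2 := by
        rw [e5]
        linear_combination (exp (-t))^2 * e2 - 2*exp (-t) * e3
      rw [e6]
      have h9 : 4 * ρ * y * (1 - exp (-t)) ≤ (1-exp (-t))^2 + 4*exp (-t)*y^2 := by
        rw [e1]; nlinarith [sq_nonneg ((1-ρ^2) - 2*ρ*y)]
      have h10 : 4 * ρ * y * (t*ρ) ≤ 4 * ρ * y * (1 - exp (-t)) := by gcongr
      nlinarith
    have hpos : 0 < 2 * exp (-t/2) * √(t*|sin (x/2)|) := by
      have : 0 < √(t*|sin (x/2)|) := sqrt_pos.2 (by positivity)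
      positivity
    rw [norm_mul, norm_mul, E_norm, mul_one, norm_inv]
    rw [Complex.norm_real, norm_eq_abs, abs_of_pos (exp_pos _), ← div_eq_mul_inv]
    calc _ ≤ exp (-t*(1+τ)) / (2 * exp (-t/2) * √(t*|sin (x/2)|)) := by gcongr
      _ = _ := by
        rw [show -t*(1+τ) = -t*(1/2+τ) + -t/2 by ring, exp_add]
        field_simp

end RJ
end

section
namespace RJ

variable {τ : ℝ} {μ : Measure ℝ} {p : ℝ → ℝ} {v dv : ℕ → ℝ → ℝ} {a b : ℕ → ℝ} {e f : ℝ}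
  {θ r s M : ℝ} {W : ℝ → ℂ} {Y : ℂ}

/-- coefficients of the truncated integral -/
def qc (τ : ℝ) (p : ℝ → ℝ) (dv : ℕ → ℝ → ℝ) (θ ε : ℝ) (n : ℕ) : ℝ :=
  dv (n+1) θ * (p (θ+ε) * dv (n+1) (θ+ε) - p (θ-ε) * dv (n+1) (θ-ε)) / (((n:ℝ)+1) * (n+1+2*τ))

lemma EW_le {x : ℝ} {w : ℂ} {M : ℝ} (hw : ‖w‖ ≤ M) : |(E x * w).re| ≤ M := by
  have h4 := Complex.abs_re_le_norm (E x * w)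
  rw [norm_mul, E_norm, one_mul] at h4
  exact h4.trans hw

lemma tau_lb (hτ : -1/2 < τ) : ∃ k, 0 < k ∧ ∀ n : ℕ, k * ((n:ℝ)+1) ≤ (n:ℝ)+1+2*τ := by
  refine ⟨min 1 (1+2*τ), lt_min one_pos (by linarith), fun n => ?_⟩
  have hn : (0:ℝ) ≤ n := Nat.cast_nonneg n
  rcases le_total 0 τ with h | h
  · have := min_le_left 1 (1+2*τ)
    nlinarith
  · have := min_le_right 1 (1+2*τ)
    nlinarith

lemma qc_main (hτ : -1/2 < τ) (h : LD p v dv θ r s M W Y) : ∃ C, 0 ≤ C ∧ ∀ ε, 0 ≤ ε → ε ≤ r → ∀ n : ℕ,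
    |qc τ p dv θ ε n - (E (((n:ℝ)+1)*θ) * Y).re * ((E (((n:ℝ)+1)*(θ+ε)) * W (θ+ε)).re
      - (E (((n:ℝ)+1)*(θ-ε)) * W (θ-ε)).re)| ≤ C / ((n:ℝ)+1) := by
  obtain ⟨k, hk, hkn⟩ := tau_lb hτ
  have hM := h.M0
  refine ⟨(6*M^2 + 4 * (|τ|) * M^2)/k, by positivity, fun ε hε hεr n => ?_⟩
  have m1 : |θ+ε-θ| ≤ r := by rw [add_sub_cancel_left, abs_of_nonneg hε]; exact hεr
  have m2 : |θ-ε-θ| ≤ r := by rw [sub_sub_cancel_left, abs_neg, abs_of_nonneg hε]; exact hεr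
  have hA := EW_le (x := ((n:ℝ)+1)*θ) h.Yb
  have hB1 := EW_le (x := ((n:ℝ)+1)*(θ+ε)) (h.Wb _ m1)
  have hB2 := EW_le (x := ((n:ℝ)+1)*(θ-ε)) (h.Wb _ m2)
  have hα := h.dY n
  have hb1 := h.dW _ m1 n
  have hb2 := h.dW _ m2 n
  unfold qc
  set A := (E (((n:ℝ)+1)*θ) * Y).re
  set B1 := (E (((n:ℝ)+1)*(θ+ε)) * W (θ+ε)).re
  set B2 := (E (((n:ℝ)+1)*(θ-ε)) * W (θ-ε)).re
  have hm : (1:ℝ) ≤ (n:ℝ)+1 := by have : (0:ℝ) ≤ n := Nat.cast_nonneg n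
                                  linarith
  have hkn := hkn n
  obtain ⟨m, hmm⟩ : ∃ m, m = (n:ℝ)+1 := ⟨_, rfl⟩
  rw [← hmm] at hα hb1 hb2 hm hkn ⊢
  obtain ⟨x, hx⟩ : ∃ x, x = dv (n+1) θ - m * A := ⟨_, rfl⟩
  obtain ⟨y1, hy1⟩ : ∃ x, x = p (θ+ε) * dv (n+1) (θ+ε) - m * B1 := ⟨_, rfl⟩
  obtain ⟨y2, hy2⟩ : ∃ x, x = p (θ-ε) * dv (n+1) (θ-ε) - m * B2 := ⟨_, rfl⟩
  rw [← hx] at hα; rw [← hy1] at hb1; rw [← hy2] at hb2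
  rw [show dv (n+1) θ = m*A + x by rw [hx]; ring,
    show p (θ+ε) * dv (n+1) (θ+ε) = m*B1 + y1 by rw [hy1]; ring,
    show p (θ-ε) * dv (n+1) (θ-ε) = m*B2 + y2 by rw [hy2]; ring]
  have hkm : 0 < k*m := by positivity
  have hd : 0 < m+2*τ := hkm.trans_le hkn
  have e1 : (m*A+x) * (m*B1+y1 - (m*B2+y2)) / (m*(m+2*τ)) - A * (B1-B2) =
    ((A * (y1-y2) + x * (B1-B2) + (x/m) * (y1-y2)) - 2*τ * (A * (B1-B2)))/(m+2*τ) := by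
    field_simp; ring
  have f1 : |B1 - B2| ≤ 2*M := (abs_sub _ _).trans (by linarith)
  have f2 : |y1 - y2| ≤ 2*M := (abs_sub _ _).trans (by linarith)
  have f3 : |x/m| ≤ M := by
    rw [abs_div, abs_of_pos (by linarith : 0 < m)]
    exact (div_le_self (abs_nonneg _) hm).trans hα
  have g1 : |A * (y1-y2)| ≤ M*(2*M) := by rw [abs_mul]; gcongr
  have g2 : |x * (B1-B2)| ≤ M*(2*M) := by rw [abs_mul]; gcongr
  have g3 : |(x/m) * (y1-y2)| ≤ M*(2*M) := by rw [abs_mul]; gcongr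
  have g4 : |2*τ * (A * (B1-B2))| ≤ 2 * (|τ|) * (M*(2*M)) := by
    rw [abs_mul, abs_mul, abs_two, abs_mul]; gcongr
  rw [e1, abs_div, abs_of_pos hd, div_div]
  have g5 : |(A * (y1-y2) + x * (B1-B2) + (x/m) * (y1-y2)) - 2*τ * (A * (B1-B2))| ≤ 6*M^2 + 4 * (|τ|) * M^2 := by
    have := abs_sub (A * (y1-y2) + x * (B1-B2) + (x/m) * (y1-y2)) (2*τ * (A * (B1-B2)))
    have := abs_add_le (A * (y1-y2) + x * (B1-B2)) ((x/m) * (y1-y2))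
    have := abs_add_le (A * (y1-y2)) (x * (B1-B2))
    linarith
  gcongr

lemma qc_bdd (hτ : -1/2 < τ) (h : LD p v dv θ r s M W Y) : ∃ C, 0 ≤ C ∧ ∀ ε, 0 ≤ ε → ε ≤ r → ∀ n : ℕ,
    |qc τ p dv θ ε n| ≤ C := by
  obtain ⟨C, hC, h1⟩ := qc_main hτ h
  have hM := h.M0
  refine ⟨C + M*(2*M), by positivity, fun ε hε hεr n => ?_⟩
  have m1 : |θ+ε-θ| ≤ r := by rw [add_sub_cancel_left, abs_of_nonneg hε]; exact hεr
  have m2 : |θ-ε-θ| ≤ r := by rw [sub_sub_cancel_left, abs_neg, abs_of_nonneg hε]; exact hεr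
  have hA := EW_le (x := ((n:ℝ)+1)*θ) h.Yb
  have hB1 := EW_le (x := ((n:ℝ)+1)*(θ+ε)) (h.Wb _ m1)
  have hB2 := EW_le (x := ((n:ℝ)+1)*(θ-ε)) (h.Wb _ m2)
  have h2 := h1 ε hε hεr n
  set A := (E (((n:ℝ)+1)*θ) * Y).re
  set B1 := (E (((n:ℝ)+1)*(θ+ε)) * W (θ+ε)).re
  set B2 := (E (((n:ℝ)+1)*(θ-ε)) * W (θ-ε)).re
  have f1 : |B1 - B2| ≤ 2*M := (abs_sub _ _).trans (by linarith)
  have g1 : |A * (B1-B2)| ≤ M*(2*M) := by rw [abs_mul]; gcongr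
  have h3 : C / ((n:ℝ)+1) ≤ C := div_le_self hC (by
    have : (0:ℝ) ≤ n := Nat.cast_nonneg n
    linarith)
  have := abs_add_le (qc τ p dv θ ε n - A * (B1-B2)) (A * (B1-B2))
  rw [sub_add_cancel] at this
  linarith

lemma re_mul_re (x y : ℂ) : x.re * y.re = ((1/2:ℂ) * (x*y)).re + ((1/2:ℂ) * (x * (starRingEnd ℂ) y)).re := by
  simp [Complex.mul_re]; ring

lemma qc_split (h : LD p v dv θ r s M W Y) (ε : ℝ) (n : ℕ) :
    (E (((n:ℝ)+1)*θ) * Y).re * ((E (((n:ℝ)+1)*(θ+ε)) * W (θ+ε)).re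
      - (E (((n:ℝ)+1)*(θ-ε)) * W (θ-ε)).re) =
    (E (((n:ℝ)+1)*(2*θ+ε)) * (1/2 * (Y * W (θ+ε))) + E (((n:ℝ)+1)*(2*θ-ε)) * (-(1/2) * (Y * W (θ-ε)))
    + E (((n:ℝ)+1)*(-ε)) * (1/2 * (Y * (starRingEnd ℂ) (W (θ+ε) - W θ))) +
    E (((n:ℝ)+1)*ε) * (-(1/2) * (Y * (starRingEnd ℂ) (W (θ-ε) - W θ)))).re := by
  set m := (n:ℝ)+1
  have e1 : E (m*(2*θ+ε)) = E (m*θ) * E (m*(θ+ε)) := by rw [← E_add]; ring_nf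
  have e2 : E (m*(2*θ-ε)) = E (m*θ) * E (m*(θ-ε)) := by rw [← E_add]; ring_nf
  have e3 : E (m*(-ε)) = E (m*θ) * E (-(m*(θ+ε))) := by rw [← E_add]; ring_nf
  have e4 : E (m*ε) = E (m*θ) * E (-(m*(θ-ε))) := by rw [← E_add]; ring_nf
  have e5 : ((1/2:ℂ) * (E (m*(-ε)) * (Y * (starRingEnd ℂ) (W θ)))).re =
      ((1/2:ℂ) * (E (m*ε) * (Y * (starRingEnd ℂ) (W θ)))).re := by
    rw [h.WY, map_mul, Complex.conj_ofReal, mul_left_comm Y, Complex.mul_conj, ← Complex.ofReal_mul,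
      show (1/2:ℂ) = ((1/2:ℝ):ℂ) by push_cast; rfl, Complex.re_ofReal_mul, Complex.re_ofReal_mul, Complex.re_mul_ofReal,
      Complex.re_mul_ofReal, E_re, E_re, mul_neg, cos_neg]
  rw [mul_sub, re_mul_re, re_mul_re]
  simp only [map_mul, E_conj]
  have e6 := e5
  rw [e3, e4] at e6
  rw [e1, e2, e3, e4]
  have : ∀ x y z : ℂ, x.re = y.re → z.re = z.re - (x - y).re := fun x y z h => by simp [h]
  rw [← Complex.add_re, ← Complex.add_re, ← Complex.sub_re, this _ _ _ e6, ← Complex.sub_re]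
  congr 1
  simp only [map_sub]
  ring

lemma exp_sqrt {y : ℝ} (hy : 0 < y) : exp (-y) ≤ 1/√y := by
  have hq : 0 < √y := sqrt_pos.2 hy
  rw [le_div_iff₀ hq, exp_neg, inv_mul_le_iff₀ (exp_pos _), mul_one]
  have h1 := add_one_le_exp y
  have h2 := mul_self_sqrt hy.le
  nlinarith [sq_nonneg (√y - 1)]

set_option maxHeartbeats 1000000 in
lemma D_bound (hτ : -1/2 < τ) (h : LD p v dv θ r s M W Y) : ∃ C, 0 ≤ C ∧ ∀ ε, 0 < ε → ε ≤ r → ∀ t, 0 < t →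
    |∑' n : ℕ, exp (-t*((n:ℝ)+1+τ)) * qc τ p dv θ ε n| ≤ C * (exp (-t*(1/2+τ)) / √t) := by
  obtain ⟨C, hC, hmain⟩ := qc_main hτ h
  have hM := h.M0
  have hs0 := h.s0
  have hz : Summable (fun n : ℕ => 1/((n:ℝ)+1)*(√2/√((n:ℝ)+1))) := by
    have h1 : Summable (fun n : ℕ => √2 * (1/((n+1:ℕ):ℝ)^(3/2:ℝ))) :=
      ((summable_nat_add_iff 1).2 (Real.summable_one_div_nat_rpow.2 (show (1:ℝ) < 3/2 by norm_num))).mul_left _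
    refine h1.congr fun n => ?_
    have hp : 0 < ((n+1:ℕ):ℝ) := by positivity
    rw [show (3/2:ℝ) = 1 + 1/2 by norm_num, rpow_add hp, rpow_one, ← sqrt_eq_rpow]
    push_cast
    field_simp
  set S0 := ∑' n : ℕ, 1/((n:ℝ)+1)*(√2/√((n:ℝ)+1)) with hS0
  have hS00 : 0 ≤ S0 := tsum_nonneg fun n => by positivity
  refine ⟨C*S0 + (M^2/(2*√s) + M^2*√π/2), by positivity, fun ε hε hεr t ht => ?_⟩
  have hε1 : ε ≤ 1 := hεr.trans h.r1
  have m1 : |θ+ε-θ| ≤ r := by rw [add_sub_cancel_left, abs_of_pos hε]; exact hεr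
  have m2 : |θ-ε-θ| ≤ r := by rw [sub_sub_cancel_left, abs_neg, abs_of_pos hε]; exact hεr
  obtain ⟨S1, hS1, hb1⟩ := geo ht τ (2*θ+ε)
  obtain ⟨S2, hS2, hb2⟩ := geo ht τ (2*θ-ε)
  obtain ⟨S3, hS3, hb3⟩ := geo ht τ (-ε)
  obtain ⟨S4, hS4, hb4⟩ := geo ht τ ε
  set c1 := 1/2 * (Y * W (θ+ε)) with hc1
  set c2 := -(1/2) * (Y * W (θ-ε)) with hc2
  set c3 := 1/2 * (Y * (starRingEnd ℂ) (W (θ+ε) - W θ)) with hc3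
  set c4 := -(1/2) * (Y * (starRingEnd ℂ) (W (θ-ε) - W θ)) with hc4
  set X : ℕ → ℝ := fun n => (E (((n:ℝ)+1)*θ) * Y).re * ((E (((n:ℝ)+1)*(θ+ε)) * W (θ+ε)).re
      - (E (((n:ℝ)+1)*(θ-ε)) * W (θ-ε)).re) with hX
  set κ := exp (-t*(1/2+τ)) / √t with hκ
  have hκ0 : 0 ≤ κ := by positivity
  have hst : 0 < √t := sqrt_pos.2 ht
  have hsum := (((hS1.mul_right c1).add (hS2.mul_right c2)).add (hS3.mul_right c3)).add (hS4.mul_right c4)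
  have hsumX : HasSum (fun n : ℕ => exp (-t*((n:ℝ)+1+τ)) * X n) (S1*c1+S2*c2+S3*c3+S4*c4).re := by
    have := Complex.hasSum_re hsum
    refine this.congr_fun fun n => ?_
    rw [hX]
    simp only
    rw [qc_split h ε n, ← Complex.re_ofReal_mul]
    congr 1
    ring
  have hY := h.Yb
  have n1 : ‖c1‖ ≤ M^2/2 := by
    rw [hc1, norm_mul, norm_mul]
    have := h.Wb _ m1
    calc _ ≤ ‖(1/2:ℂ)‖ * (M * M) := by gcongr
      _ = _ := by norm_num; ring
  have n2 : ‖c2‖ ≤ M^2/2 := by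
    rw [hc2, norm_mul, norm_mul]
    have := h.Wb _ m2
    calc _ ≤ ‖(-(1/2):ℂ)‖ * (M * M) := by gcongr
      _ = _ := by norm_num; ring
  have n3 : ‖c3‖ ≤ M^2*√ε/2 := by
    rw [hc3, norm_mul, norm_mul, RCLike.norm_conj]
    have := h.Wh _ m1
    rw [add_sub_cancel_left, abs_of_pos hε] at this
    calc _ ≤ ‖(1/2:ℂ)‖ * (M * (M * √ε)) := by gcongr
      _ = _ := by norm_num; ring
  have n4 : ‖c4‖ ≤ M^2*√ε/2 := by
    rw [hc4, norm_mul, norm_mul, RCLike.norm_conj]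
    have := h.Wh _ m2
    rw [sub_sub_cancel_left, abs_neg, abs_of_pos hε] at this
    calc _ ≤ ‖(-(1/2):ℂ)‖ * (M * (M * √ε)) := by gcongr
      _ = _ := by norm_num; ring
  have hssin1 : s ≤ sin ((2*θ+ε)/2) := h.sb _ (by
    rw [show (2*θ+ε)/2-θ = ε/2 by ring, abs_of_pos (by linarith)]; linarith)
  have hssin2 : s ≤ sin ((2*θ-ε)/2) := h.sb _ (by
    rw [show (2*θ-ε)/2-θ = -(ε/2) by ring, abs_neg, abs_of_pos (by linarith)]; linarith)
  have hsinε : ε/π ≤ sin (ε/2) := by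
    have := Real.mul_le_sin (x := ε/2) (by linarith) (by linarith [pi_gt_three])
    calc ε/π = 2/π*(ε/2) := by ring
      _ ≤ _ := this
  have gen : ∀ {y : ℝ} {S : ℂ} {w : ℝ}, 0 < w → w ≤ |sin (y/2)| →
      (sin (y/2) ≠ 0 → ‖S‖ ≤ exp (-t*(1/2+τ)) / (2*√(t*|sin (y/2)|))) → ‖S‖ ≤ κ / (2*√w) := by
    intro y S w hw hwy hb
    have h0 : sin (y/2) ≠ 0 := by intro h0; rw [h0, abs_zero] at hwy; linarith
    refine (hb h0).trans ?_
    have hsw := sqrt_pos.2 hw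
    calc _ ≤ exp (-t*(1/2+τ)) / (2*√(t*w)) := by gcongr
      _ = _ := by rw [sqrt_mul ht.le, hκ]; field_simp
  have k1 := gen (y := 2*θ+ε) hs0 (hssin1.trans (le_abs_self _)) hb1
  have k2 := gen (y := 2*θ-ε) hs0 (hssin2.trans (le_abs_self _)) hb2
  have hεπ : 0 < ε/π := by positivity
  have k3 := gen (y := -ε) hεπ (by rw [neg_div, sin_neg, abs_neg]; exact hsinε.trans (le_abs_self _)) hb3
  have k4 := gen (y := ε) hεπ (hsinε.trans (le_abs_self _)) hb4
  have hsε : 0 < √ε := sqrt_pos.2 hε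
  have hsπ : 0 < √π := sqrt_pos.2 pi_pos
  have hss : 0 < √s := sqrt_pos.2 hs0
  have e34 : κ / (2*√(ε/π)) = κ * √π/(2*√ε) := by
    rw [sqrt_div hε.le]; field_simp
  rw [e34] at k3 k4
  have bX : |(S1*c1+S2*c2+S3*c3+S4*c4).re| ≤ (M^2/(2*√s) + M^2*√π/2) * κ := by
    refine (Complex.abs_re_le_norm _).trans ?_
    have t1 : ‖S1*c1‖ ≤ κ / (2*√s) * (M^2/2) := by rw [norm_mul]; gcongr
    have t2 : ‖S2*c2‖ ≤ κ / (2*√s) * (M^2/2) := by rw [norm_mul]; gcongr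
    have t3 : ‖S3*c3‖ ≤ κ * √π/(2*√ε) * (M^2*√ε/2) := by rw [norm_mul]; gcongr
    have t4 : ‖S4*c4‖ ≤ κ * √π/(2*√ε) * (M^2*√ε/2) := by rw [norm_mul]; gcongr
    have u1 := norm_add_le (S1*c1+S2*c2+S3*c3) (S4*c4)
    have u2 := norm_add_le (S1*c1+S2*c2) (S3*c3)
    have u3 := norm_add_le (S1*c1) (S2*c2)
    have e8 : (M^2/(2*√s) + M^2*√π/2) * κ = κ / (2*√s) * (M^2/2) + κ / (2*√s) * (M^2/2)
      + κ * √π/(2*√ε) * (M^2*√ε/2) + κ * √π/(2*√ε) * (M^2*√ε/2) := by field_simp; ring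
    rw [e8]; linarith
  have berr : ∀ n : ℕ, ‖exp (-t*((n:ℝ)+1+τ)) * (qc τ p dv θ ε n - X n)‖ ≤
      C * κ * (1/((n:ℝ)+1)*(√2/√((n:ℝ)+1))) := fun n => by
    have hn : (0:ℝ) < (n:ℝ)+1 := by positivity
    have hm := hmain ε hε.le hεr n
    have e9 : exp (-t*((n:ℝ)+1+τ)) ≤ κ * (√2/√((n:ℝ)+1)) := by
      have h1 : -t*((n:ℝ)+1+τ) ≤ -t*(1/2+τ) + -(t*((n:ℝ)+1)/2) := by
        have : (0:ℝ) ≤ n := Nat.cast_nonneg n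
        nlinarith [mul_nonneg ht.le this]
      calc _ ≤ exp (-t*(1/2+τ) + -(t*((n:ℝ)+1)/2)) := exp_le_exp.2 h1
        _ = exp (-t*(1/2+τ)) * exp (-(t*((n:ℝ)+1)/2)) := exp_add _ _
        _ ≤ exp (-t*(1/2+τ)) * (1/√(t*((n:ℝ)+1)/2)) := by
          gcongr; exact exp_sqrt (by positivity)
        _ = _ := by
          rw [sqrt_div (by positivity), sqrt_mul ht.le, hκ]; field_simp
    rw [norm_mul, norm_eq_abs, norm_eq_abs, abs_of_pos (exp_pos _)]
    calc _ ≤ (κ * (√2/√((n:ℝ)+1))) * (C/((n:ℝ)+1)) := by gcongr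
      _ = _ := by ring
  have hserr := Summable.of_norm_bounded (hz.mul_left (C*κ)) berr
  have hnerr : ‖∑' n : ℕ, exp (-t*((n:ℝ)+1+τ)) * (qc τ p dv θ ε n - X n)‖ ≤ C * κ * S0 := by
    rw [hS0, ← tsum_mul_left]
    exact tsum_of_norm_bounded (hz.mul_left (C*κ)).hasSum berr
  have hfin : ∑' n : ℕ, exp (-t*((n:ℝ)+1+τ)) * qc τ p dv θ ε n =
      ∑' n : ℕ, exp (-t*((n:ℝ)+1+τ)) * (qc τ p dv θ ε n - X n) + (S1*c1+S2*c2+S3*c3+S4*c4).re := by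
    rw [← hsumX.tsum_eq, ← hserr.tsum_add hsumX.summable]
    congr 1; ext n; ring
  rw [hfin]
  refine (abs_add_le _ _).trans ((add_le_add hnerr bX).trans (le_of_eq (by ring)))

lemma D_tendsto (hτ : -1/2 < τ) (h : LD p v dv θ r s M W Y) (hp : ContinuousAt p θ)
    (hdv : ∀ n, Continuous (dv n)) {t : ℝ} (ht : 0 < t) :
    Tendsto (fun ε => ∑' n : ℕ, exp (-t*((n:ℝ)+1+τ)) * qc τ p dv θ ε n) (nhdsWithin 0 (Ioi 0)) (nhds 0) := by
  obtain ⟨C, hC, hb⟩ := qc_bdd hτ h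
  have h0 : (∑' n : ℕ, (fun _ : ℕ => (0:ℝ)) n) = 0 := tsum_zero
  suffices hsuf : Tendsto (fun ε => ∑' n : ℕ, exp (-t*((n:ℝ)+1+τ)) * qc τ p dv θ ε n) (nhdsWithin 0 (Ioi 0))
      (nhds (∑' n : ℕ, (fun _ : ℕ => (0:ℝ)) n)) by rwa [h0] at hsuf
  refine tendsto_tsum_of_dominated_convergence (bound := fun n : ℕ => exp (-t*((n:ℝ)+1+τ)) * C)
    ((ex_sum ht τ).mul_right C) (fun n => ?_) ?_
  · have hq0 : qc τ p dv θ 0 n = 0 := by simp [qc]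
    have hc : ContinuousAt (fun ε => exp (-t*((n:ℝ)+1+τ)) * qc τ p dv θ ε n) 0 := by
      unfold qc
      have c1 : ContinuousAt (fun ε : ℝ => θ + ε) 0 := by fun_prop
      have c2 : ContinuousAt (fun ε : ℝ => θ - ε) 0 := by fun_prop
      have p1 : ContinuousAt (fun ε : ℝ => p (θ + ε)) 0 :=
        ContinuousAt.comp (g := p) (by simpa using hp) c1
      have p2 : ContinuousAt (fun ε : ℝ => p (θ - ε)) 0 :=
        ContinuousAt.comp (g := p) (by simpa using hp) c2
      have d1 : ContinuousAt (fun ε : ℝ => dv (n+1) (θ + ε)) 0 := ((hdv (n+1)).comp (by fun_prop)).continuousAt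
      have d2 : ContinuousAt (fun ε : ℝ => dv (n+1) (θ - ε)) 0 := ((hdv (n+1)).comp (by fun_prop)).continuousAt
      exact continuousAt_const.mul (((continuousAt_const.mul ((p1.mul d1).sub (p2.mul d2)))).div_const _)
    have := hc.tendsto
    rw [hq0, mul_zero] at this
    exact this.mono_left nhdsWithin_le_nhds
  · filter_upwards [Ioc_mem_nhdsGT h.r0] with ε hε n
    rw [norm_mul, norm_eq_abs, norm_eq_abs, abs_of_pos (exp_pos _)]
    gcongr
    exact hb ε hε.1.le hε.2 n

end RJ
end

section
namespace RJ

variable {τ : ℝ} {μ : Measure ℝ} {p : ℝ → ℝ} {v dv : ℕ → ℝ → ℝ} {a b : ℕ → ℝ} {e f : ℝ}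
  {θ r s M : ℝ} {W : ℝ → ℂ} {Y : ℂ}

/-- coefficients after multiplication by `x - cos` -/
def ee (a b : ℕ → ℝ) (x : ℝ) (U : ℕ → ℝ) : ℕ → ℝ
  | 0 => x * U 0 - b 0 * U 0 - a 0 * U 1
  | n+1 => x * U (n+1) - a n * U n - b (n+1) * U (n+1) - a (n+1) * U (n+2)

lemma ee_sum (h : JData τ μ p v dv a b e f) (x : ℝ) (U : ℕ → ℝ) (φ : ℝ) (N : ℕ) :
    ∑ n ∈ Finset.range (N+1), ee a b x U n * v n φ =
      (x - cos φ) * ∑ n ∈ Finset.range (N+1), U n * v n φ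
        - a N * (U (N+1) * v N φ - U N * v (N+1) φ) := by
  induction N with
  | zero =>
    have := h.rec0 φ
    simp only [zero_add, Finset.range_one, Finset.sum_singleton, ee]
    linear_combination (U 0) * this
  | succ N ih =>
    rw [Finset.sum_range_succ, ih, Finset.sum_range_succ _ (N+1)]
    have := h.recs N φ
    simp only [ee]
    linear_combination (U (N+1)) * this

lemma v_cont (h : JData τ μ p v dv a b e f) (n : ℕ) : Continuous (v n) :=
  continuous_iff_continuousAt.2 fun φ => (h.hd n φ).continuousAt

lemma int_of_bdd (h : JData τ μ p v dv a b e f) {g : ℝ → ℝ} (hg : Continuous g) {B : ℝ} (hb : ∀ x, |g x| ≤ B) :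
    Integrable g μ := by
  haveI := h.fin
  exact Integrable.of_bound hg.aestronglyMeasurable B (ae_of_all _ hb)

lemma fin_sq (h : JData τ μ p v dv a b e f) (U : ℕ → ℝ) (N : ℕ) :
    ∫ φ, (∑ n ∈ Finset.range N, U n * v n φ)^2 ∂μ = ∑ n ∈ Finset.range N, U n ^2 := by
  choose B hB using h.bdd
  have hi : ∀ m n, Integrable (fun φ => (U m * v m φ) * (U n * v n φ)) μ := fun m n => by
    refine int_of_bdd h (B := |U m| * B m * (|U n| * B n))
      ((continuous_const.mul (v_cont h m)).mul (continuous_const.mul (v_cont h n))) fun x => ?_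
    have h1 := hB m x
    have h2 := hB n x
    have h3 := (abs_nonneg _).trans h1
    rw [abs_mul, abs_mul, abs_mul]
    gcongr
  simp_rw [sq, Finset.sum_mul_sum]
  rw [integral_finsetSum _ fun m _ => integrable_finsetSum _ fun n _ => hi m n]
  refine Finset.sum_congr rfl fun m hm => ?_
  rw [integral_finsetSum _ fun n _ => hi m n]
  have : ∀ n, ∫ φ, (U m * v m φ) * (U n * v n φ) ∂μ = if m = n then U m * U n else 0 := fun n => by
    have h1 : ∀ φ, (U m * v m φ) * (U n * v n φ) = (U m * U n) * (v m φ * v n φ) := fun φ => by ring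
    simp_rw [h1]
    rw [integral_const_mul, h.orth]
    split_ifs <;> simp
  simp_rw [this]
  rw [Finset.sum_ite_eq, if_pos hm]

lemma fin_abs (h : JData τ μ p v dv a b e f) (U : ℕ → ℝ) (N : ℕ) {S δ : ℝ} (hS : ∑ n ∈ Finset.range N, U n ^2 ≤ S)
    (hδ : 0 < δ) : Integrable (fun φ => ∑ n ∈ Finset.range N, U n * v n φ) μ ∧
      ∫ φ, |∑ n ∈ Finset.range N, U n * v n φ| ∂μ ≤ 1/2 * (δ * μ.real univ + S/δ) := by
  haveI := h.fin
  choose B hB using h.bdd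
  have hc : Continuous (fun φ => ∑ n ∈ Finset.range N, U n * v n φ) :=
    continuous_finsetSum _ fun n _ => continuous_const.mul (v_cont h n)
  have hbd : ∀ φ, |∑ n ∈ Finset.range N, U n * v n φ| ≤ ∑ n ∈ Finset.range N, |U n| * B n := fun φ => by
    refine (Finset.abs_sum_le_sum_abs _ _).trans (Finset.sum_le_sum fun n _ => ?_)
    rw [abs_mul]
    have := hB n φ
    gcongr
  have hi := int_of_bdd h hc hbd
  have hi2 : Integrable (fun φ => (∑ n ∈ Finset.range N, U n * v n φ)^2) μ := by
    refine int_of_bdd h (hc.pow 2) (B := (∑ n ∈ Finset.range N, |U n| * B n)^2) fun φ => ?_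
    rw [abs_pow]
    have := hbd φ
    gcongr
  refine ⟨hi, ?_⟩
  calc ∫ φ, |∑ n ∈ Finset.range N, U n * v n φ| ∂μ
      ≤ ∫ φ, (1/2 * δ + 1/2/δ * (∑ n ∈ Finset.range N, U n * v n φ)^2) ∂μ := by
        refine integral_mono hi.abs ((integrable_const _).add (hi2.const_mul _)) fun φ => ?_
        simp only
        set y := ∑ n ∈ Finset.range N, U n * v n φ
        have : (1/2 * δ + 1/2/δ * y^2) - |y| = (δ - |y|)^2/(2*δ) := by
          rw [sub_sq, sq_abs]; field_simp; ring
        have h2 : 0 ≤ (δ - |y|)^2/(2*δ) := by positivity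
        linarith
    _ = 1/2 * (δ * μ.real univ) + 1/2/δ * ∑ n ∈ Finset.range N, U n ^2 := by
        rw [integral_add (integrable_const _) (hi2.const_mul _), integral_const, integral_const_mul, fin_sq h]
        simp only [smul_eq_mul]; ring
    _ ≤ 1/2 * (δ * μ.real univ) + 1/2/δ * S := by gcongr
    _ = _ := by ring

/-- differentiated recurrence -/
lemma drec (h : JData τ μ p v dv a b e f) (n : ℕ) (φ : ℝ) : cos φ * dv (n+1) φ - sin φ * v (n+1) φ =
    a (n+1) * dv (n+2) φ + b (n+1) * dv (n+1) φ + a n * dv n φ := by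
  have h1 := (hasDerivAt_cos φ).mul (h.hd (n+1) φ)
  have h2 := (((h.hd (n+2) φ).const_mul (a (n+1))).add ((h.hd (n+1) φ).const_mul (b (n+1)))).add
    ((h.hd n φ).const_mul (a n))
  have h3 : (cos * v (n+1)) = ((fun y => a (n+1) * v (n+2) y) + fun y => b (n+1) * v (n+1) y) +
      fun y => a n * v n y := by
    ext y; simpa using h.recs n y
  rw [h3] at h1
  have := h1.unique h2
  linarith

end RJ
end

section
namespace RJ

variable {τ : ℝ} {μ : Measure ℝ} {p : ℝ → ℝ} {v dv : ℕ → ℝ → ℝ} {a b : ℕ → ℝ} {e f : ℝ}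
  {θ r s M : ℝ} {W : ℝ → ℂ} {Y : ℂ}

def UU (τ : ℝ) (dv : ℕ → ℝ → ℝ) (θ t : ℝ) (n : ℕ) : ℝ := exp (-t*((n:ℝ)+τ)) * dv n θ

lemma mul_exp_le {x k : ℝ} (hk : 0 < k) : x ≤ 1/k * exp (k*x) := by
  have := add_one_le_exp (k*x)
  rw [one_div, inv_mul_eq_div, le_div_iff₀ hk]
  linarith

lemma ee_bd (h : JData τ μ p v dv a b e f) (h' : LD p v dv θ r s M W Y) : ∃ C, 0 ≤ C ∧ ∀ t, 0 < t → ∀ n : ℕ,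
    |ee a b (cos θ) (UU τ dv θ t) n| ≤ C * exp (-t*((n:ℝ)+1)/16) := by
  obtain ⟨L, hL, hab⟩ := abnd h
  have hM := h'.M0
  have hτ := h.hτ
  have m0 : |θ-θ| ≤ r := by simpa using h'.r0.le
  have vb := h'.vb θ m0
  have dvb := h'.dvb θ m0
  refine ⟨M + 20*(L*M), by positivity, fun t ht n => ?_⟩
  have hLM : 0 ≤ L*M := by positivity
  rcases n with _ | m
  · have e0 : ee a b (cos θ) (UU τ dv θ t) 0 = - (a 0 * (exp (-t*(1+τ)) * dv 1 θ)) := by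
      simp [ee, UU, h.dv0]
    rw [e0, abs_neg, abs_mul, abs_mul, abs_of_pos (exp_pos _)]
    have h1 := dvb 1
    have h2 := (hab 0).1
    have h3 : exp (-t*(1+τ)) ≤ exp (-t*(((0:ℕ):ℝ)+1)/16) := by
      apply exp_le_exp.2; push_cast; nlinarith
    calc _ ≤ L * (exp (-t*(((0:ℕ):ℝ)+1)/16) * (M * (((1:ℕ):ℝ)+1))) := by gcongr
      _ = (2*(L*M)) * exp (-t*(((0:ℕ):ℝ)+1)/16) := by push_cast; ring
      _ ≤ _ := by gcongr; linarith
  · have hm : (0:ℝ) ≤ m := Nat.cast_nonneg m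
    have e1 : ee a b (cos θ) (UU τ dv θ t) (m+1) = exp (-t*((m:ℝ)+1+τ)) * (sin θ * v (m+1) θ)
        + exp (-t*((m:ℝ)+1+τ)) * (a (m+1) * (dv (m+2) θ * (1 - exp (-t))))
        - a m * (dv m θ * (exp (-t*((m:ℝ)+τ)) * (1 - exp (-t)))) := by
      have := drec h m θ
      simp only [ee, UU]
      have x1 : exp (-t*(((m+2:ℕ):ℝ)+τ)) = exp (-t*((m:ℝ)+1+τ)) * exp (-t) := by
        rw [← exp_add]; push_cast; ring_nf
      have x2 : exp (-t*((m:ℝ)+1+τ)) = exp (-t*((m:ℝ)+τ)) * exp (-t) := by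
        rw [← exp_add]; ring_nf
      have x3 : exp (-t*(((m+1:ℕ):ℝ)+τ)) = exp (-t*((m:ℝ)+1+τ)) := by push_cast; rfl
      rw [x1, x3, x2]
      linear_combination (exp (-t*((m:ℝ)+τ)) * exp (-t)) * this
    have q0 : 0 ≤ 1 - exp (-t) := by
      have := exp_le_one_iff.2 (show -t ≤ 0 by linarith); linarith
    have q1 : 1 - exp (-t) ≤ t := by have := add_one_le_exp (-t); linarith
    set Q := exp (-t*((m:ℝ)+1)/8) with hQ
    have hQ0 : 0 < Q := exp_pos _
    have hE : exp (-t*((m:ℝ)+1+τ)) ≤ exp (-t*((m:ℝ)+1)/2) := by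
      apply exp_le_exp.2; nlinarith
    have hE1 : exp (-t*((m:ℝ)+1)/2) ≤ Q := by
      apply exp_le_exp.2; nlinarith
    have b1 : |exp (-t*((m:ℝ)+1+τ)) * (sin θ * v (m+1) θ)| ≤ M * Q := by
      rw [abs_mul, abs_mul, abs_of_pos (exp_pos _)]
      have := abs_sin_le_one θ
      have := vb (m+1)
      calc _ ≤ Q * (1 * M) := by gcongr; exact hE.trans hE1
        _ = _ := by ring
    have b2 : |exp (-t*((m:ℝ)+1+τ)) * (a (m+1) * (dv (m+2) θ * (1 - exp (-t))))| ≤ 12*(L*M) * Q := by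
      rw [abs_mul, abs_mul, abs_mul, abs_of_pos (exp_pos _), abs_of_nonneg q0]
      have h1 := (hab (m+1)).1
      have h2 := dvb (m+2)
      have h3 := mul_exp_le (x := t*((m:ℝ)+1)) (k := 1/4) (by norm_num)
      have h4 : exp (-t*((m:ℝ)+1)/2) * exp (1/4*(t*((m:ℝ)+1))) ≤ Q := by
        rw [← exp_add, hQ]; apply exp_le_exp.2; nlinarith
      have h5 : (((m+2:ℕ):ℝ)+1) ≤ 3*((m:ℝ)+1) := by push_cast; linarith
      calc _ ≤ exp (-t*((m:ℝ)+1)/2) * (L * ((M * (3*((m:ℝ)+1))) * t)) := by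
            gcongr; exact h2.trans (by gcongr)
        _ = 3 * (L*M) * (exp (-t*((m:ℝ)+1)/2) * (t*((m:ℝ)+1))) := by ring
        _ ≤ 3 * (L*M) * (exp (-t*((m:ℝ)+1)/2) * (1/(1/4) * exp (1/4*(t*((m:ℝ)+1))))) := by gcongr
        _ = 12 * (L*M) * (exp (-t*((m:ℝ)+1)/2) * exp (1/4*(t*((m:ℝ)+1)))) := by ring
        _ ≤ _ := by gcongr
    have b3 : |a m * (dv m θ * (exp (-t*((m:ℝ)+τ)) * (1 - exp (-t))))| ≤ 8*(L*M) * Q := by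
      rcases m with _ | k
      · rw [h.dv0, zero_mul, mul_zero, abs_zero]; positivity
      · rw [abs_mul, abs_mul, abs_mul, abs_of_pos (exp_pos _), abs_of_nonneg q0]
        have h1 := (hab (k+1)).1
        have h2 := dvb (k+1)
        have hk : (0:ℝ) ≤ k := Nat.cast_nonneg k
        have h3 := mul_exp_le (x := t*(((k+1:ℕ):ℝ)+1)) (k := 1/8) (by norm_num)
        have h6 : exp (-t*(((k+1:ℕ):ℝ)+τ)) ≤ exp (-t*(((k+1:ℕ):ℝ)+1)/4) := by
          apply exp_le_exp.2; push_cast; nlinarith [mul_nonneg ht.le hk]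
        have h4 : exp (-t*(((k+1:ℕ):ℝ)+1)/4) * exp (1/8*(t*(((k+1:ℕ):ℝ)+1))) ≤ Q := by
          rw [← exp_add, hQ]; apply exp_le_exp.2; nlinarith
        calc _ ≤ L * ((M * (((k+1:ℕ):ℝ)+1)) * (exp (-t*(((k+1:ℕ):ℝ)+1)/4) * t)) := by gcongr
          _ = (L*M) * (exp (-t*(((k+1:ℕ):ℝ)+1)/4) * (t*(((k+1:ℕ):ℝ)+1))) := by ring
          _ ≤ (L*M) * (exp (-t*(((k+1:ℕ):ℝ)+1)/4) * (1/(1/8) * exp (1/8*(t*(((k+1:ℕ):ℝ)+1))))) := by gcongr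
          _ = 8 * (L*M) * (exp (-t*(((k+1:ℕ):ℝ)+1)/4) * exp (1/8*(t*(((k+1:ℕ):ℝ)+1)))) := by ring
          _ ≤ _ := by gcongr
    have hQe : Q ≤ exp (-t*(((m+1:ℕ):ℝ)+1)/16) := by
      apply exp_le_exp.2; push_cast; nlinarith [mul_nonneg ht.le hm]
    rw [e1]
    have s1 := abs_sub (exp (-t*((m:ℝ)+1+τ)) * (sin θ * v (m+1) θ)
        + exp (-t*((m:ℝ)+1+τ)) * (a (m+1) * (dv (m+2) θ * (1 - exp (-t)))))
        (a m * (dv m θ * (exp (-t*((m:ℝ)+τ)) * (1 - exp (-t)))))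
    have s2 := abs_add_le (exp (-t*((m:ℝ)+1+τ)) * (sin θ * v (m+1) θ))
        (exp (-t*((m:ℝ)+1+τ)) * (a (m+1) * (dv (m+2) θ * (1 - exp (-t)))))
    calc _ ≤ (M + 20*(L*M)) * Q := by linarith
      _ ≤ _ := by gcongr

lemma geo_sq {t C : ℝ} (ht : 0 < t) (N : ℕ) {U : ℕ → ℝ} (hU : ∀ n : ℕ, |U n| ≤ C * exp (-t*((n:ℝ)+1)/16)) :
    ∑ n ∈ Finset.range N, U n ^ 2 ≤ C^2 * (16/t * exp (-t/16)) := by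
  set y := exp (-t/16) with hy
  have hy0 : 0 < y := exp_pos _
  have hy1 : y < 1 := by rw [hy, ← exp_zero]; exact exp_lt_exp.2 (by linarith)
  have h1 : ∀ n : ℕ, U n ^2 ≤ C^2 * y^2 * (y^2)^n := fun n => by
    have h2 : exp (-t*((n:ℝ)+1)/16) = y^(n+1) := by
      rw [hy, ← exp_nat_mul]; congr 1; push_cast; ring
    have := hU n
    rw [h2] at this
    calc U n ^2 = |U n|^2 := (sq_abs _).symm
      _ ≤ (C * y^(n+1))^2 := by gcongr
      _ = _ := by ring
  have hq : y^2 < 1 := by nlinarith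
  calc _ ≤ ∑ n ∈ Finset.range N, C^2 * y^2 * (y^2)^n := Finset.sum_le_sum fun n _ => h1 n
    _ = C^2 * y^2 * ∑ n ∈ Finset.range N, (y^2)^n := by rw [Finset.mul_sum]
    _ ≤ C^2 * y^2 * (1 - y^2)⁻¹ := by
      gcongr
      rw [← tsum_geometric_of_lt_one (by positivity) hq]
      exact (summable_geometric_of_lt_one (by positivity) hq).sum_le_tsum _ (fun _ _ => by positivity)
    _ = C^2 * (y * (y * (1 - y^2)⁻¹)) := by ring
    _ ≤ C^2 * (y * (16/t)) := by
      gcongr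
      rw [← div_eq_mul_inv, div_le_div_iff₀ (by linarith) ht]
      have h3 := add_one_le_exp (t/16)
      have h4 : exp (t/16) * y = 1 := by rw [hy, ← exp_add]; ring_nf; exact exp_zero
      have h5 : y * (t/16+1) ≤ 1 := by
        calc y * (t/16+1) ≤ y * exp (t/16) := by gcongr
          _ = 1 := by rw [mul_comm]; exact h4
      nlinarith
    _ = _ := by ring

end RJ
end

section
namespace RJ

variable {τ : ℝ} {μ : Measure ℝ} {p : ℝ → ℝ} {v dv : ℕ → ℝ → ℝ} {a b : ℕ → ℝ} {e f : ℝ}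
  {θ r s M : ℝ} {W : ℝ → ℂ} {Y : ℂ}

def hker (τ : ℝ) (v dv : ℕ → ℝ → ℝ) (θ t φ : ℝ) : ℝ := ∑' n : ℕ, UU τ dv θ t n * v n φ

lemma nexp_sum {t : ℝ} (ht : 0 < t) : Summable (fun n : ℕ => exp (-t*n) * ((n:ℝ)+1)) := by
  have h1 := Real.summable_pow_mul_exp_neg_nat_mul 1 ht
  have h2 := Real.summable_pow_mul_exp_neg_nat_mul 0 ht
  refine (h1.add h2).congr fun n => ?_
  rw [show -t*(n:ℝ) = -t*n by rfl]; ring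

lemma UU_bd (h' : LD p v dv θ r s M W Y) (t : ℝ) (n : ℕ) :
    |UU τ dv θ t n| ≤ exp (-t*τ) * M * (exp (-t*n) * ((n:ℝ)+1)) := by
  have m0 : |θ-θ| ≤ r := by simpa using h'.r0.le
  have dvb := h'.dvb θ m0 n
  unfold UU
  rw [abs_mul, abs_of_pos (exp_pos _), mul_add, exp_add]
  calc _ ≤ exp (-t*n) * exp (-t*τ) * (M * ((n:ℝ)+1)) := by gcongr
    _ = _ := by ring

lemma UU_sum (h' : LD p v dv θ r s M W Y) {t : ℝ} (ht : 0 < t) : Summable (fun n => |UU τ dv θ t n|) :=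
  Summable.of_nonneg_of_le (fun _ => abs_nonneg _) (fun n => UU_bd h' t n) ((nexp_sum ht).mul_left _)

lemma vbd (h : JData τ μ p v dv a b e f) {φ : ℝ} (hφ : φ ∈ Ioo 0 π) : ∃ B, 0 ≤ B ∧ ∀ n, |v n φ| ≤ B := by
  obtain ⟨B, hB, hb⟩ := loc h (sin_pos_of_mem_Ioo hφ)
  exact ⟨B, hB, (hb φ le_rfl).1⟩

lemma hker_sum (h : JData τ μ p v dv a b e f) (h' : LD p v dv θ r s M W Y) {t : ℝ} (ht : 0 < t) {φ : ℝ}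
    (hφ : φ ∈ Ioo 0 π) : Summable (fun n : ℕ => UU τ dv θ t n * v n φ) := by
  obtain ⟨B, hB, hb⟩ := vbd h hφ
  refine Summable.of_norm_bounded ((UU_sum (τ := τ) h' ht).mul_right B) fun n => ?_
  rw [norm_mul, norm_eq_abs, norm_eq_abs]
  have := hb n
  gcongr

lemma ee_tendsto (h : JData τ μ p v dv a b e f) (h' : LD p v dv θ r s M W Y) {t : ℝ} (ht : 0 < t) {φ : ℝ}
    (hφ : φ ∈ Ioo 0 π) : Tendsto (fun N : ℕ => ∑ n ∈ Finset.range (N+1), ee a b (cos θ) (UU τ dv θ t) n * v n φ)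
      atTop (nhds ((cos θ - cos φ) * hker τ v dv θ t φ)) := by
  obtain ⟨B, hB, hb⟩ := vbd h hφ
  obtain ⟨L, hL, hab⟩ := abnd h
  have h1 := ((hker_sum h h' ht hφ).hasSum.tendsto_sum_nat.comp (tendsto_add_atTop_nat 1)).const_mul (cos θ - cos φ)
  have hU := (UU_sum (τ := τ) h' ht).tendsto_atTop_zero
  have hU1 := hU.comp (tendsto_add_atTop_nat 1)
  have h2 : Tendsto (fun N => a N * (UU τ dv θ t (N+1) * v N φ - UU τ dv θ t N * v (N+1) φ)) atTop (nhds 0) := by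
    have h3 := (hU1.add hU).const_mul (L*B)
    rw [add_zero, mul_zero] at h3
    refine squeeze_zero_norm (fun N => ?_) h3
    rw [norm_eq_abs, abs_mul]
    have b1 := (hab N).1
    have b2 := hb N
    have b3 := hb (N+1)
    have b4 : |UU τ dv θ t (N+1) * v N φ - UU τ dv θ t N * v (N+1) φ| ≤
        |UU τ dv θ t (N+1)| * B + |UU τ dv θ t N| * B := by
      refine (abs_sub _ _).trans ?_
      rw [abs_mul, abs_mul]
      gcongr
    calc _ ≤ L * (|UU τ dv θ t (N+1)| * B + |UU τ dv θ t N| * B) := by gcongr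
      _ = _ := by simp only [Function.comp]; ring
  have h4 := h1.sub h2
  rw [sub_zero] at h4
  refine h4.congr fun N => ?_
  rw [ee_sum h]
  rfl

lemma hker_deriv (h : JData τ μ p v dv a b e f) (h' : LD p v dv θ r s M W Y) {t : ℝ} (ht : 0 < t) {φ : ℝ}
    (hφ : φ ∈ Ioo 0 π) : HasDerivAt (fun θ' => ∑' n : ℕ, exp (-t * |(n:ℝ)+τ|) * v n θ' * v n φ)
      (hker τ v dv θ t φ) θ := by
  obtain ⟨B, hB, hb⟩ := vbd h hφ
  have hM := h'.M0
  have hτ := h.hτ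
  have hexp : ∀ n : ℕ, exp (-t * |(n:ℝ)+τ|) ≤ exp (t * |τ|) * exp (-t*n) := fun n => by
    rw [← exp_add]
    apply exp_le_exp.2
    have h1 : (n:ℝ) - |τ| ≤ |(n:ℝ)+τ| := by
      have := neg_abs_le τ
      have := le_abs_self ((n:ℝ)+τ)
      linarith
    nlinarith
  have hbound : ∀ (n : ℕ) (y : ℝ), y ∈ Metric.ball θ r →
      ‖exp (-t * |(n:ℝ)+τ|) * dv n y * v n φ‖ ≤ exp (t * |τ|) * M * B * (exp (-t*n) * ((n:ℝ)+1)) := fun n y hy => by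
    rw [Metric.mem_ball, dist_eq_norm, norm_eq_abs] at hy
    have h1 := h'.dvb y hy.le n
    have h2 := hb n
    have h3 := hexp n
    rw [norm_mul, norm_mul, norm_eq_abs, norm_eq_abs, norm_eq_abs, abs_of_pos (exp_pos _)]
    calc _ ≤ (exp (t * |τ|) * exp (-t*n)) * (M * ((n:ℝ)+1)) * B := by gcongr
      _ = _ := by ring
  have hs0 : Summable (fun n : ℕ => exp (-t * |(n:ℝ)+τ|) * v n θ * v n φ) := by
    refine Summable.of_norm_bounded ((nexp_sum ht).mul_left (exp (t * |τ|) * M * B)) fun n => ?_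
    have h1 := h'.vb θ (by simpa using h'.r0.le) n
    have h2 := hb n
    have h3 := hexp n
    have hn : (0:ℝ) ≤ n := Nat.cast_nonneg n
    rw [norm_mul, norm_mul, norm_eq_abs, norm_eq_abs, norm_eq_abs, abs_of_pos (exp_pos _)]
    calc _ ≤ (exp (t * |τ|) * exp (-t*n)) * (M * ((n:ℝ)+1)) * B := by
          gcongr; exact h1.trans (le_mul_of_one_le_right hM (by linarith))
      _ = _ := by ring
  have key := hasDerivAt_tsum_of_isPreconnected (t := Metric.ball θ r) (y₀ := θ) (y := θ)
    (g := fun (n:ℕ) y => exp (-t * |(n:ℝ)+τ|) * v n y * v n φ)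
    (g' := fun (n:ℕ) y => exp (-t * |(n:ℝ)+τ|) * dv n y * v n φ)
    ((nexp_sum ht).mul_left (exp (t * |τ|) * M * B)) Metric.isOpen_ball
    (convex_ball θ r).isPreconnected
    (fun n y _ => ((h.hd n y).const_mul _).mul_const _) hbound (Metric.mem_ball_self h'.r0) hs0
    (Metric.mem_ball_self h'.r0)
  have e1 : hker τ v dv θ t φ = ∑' n : ℕ, exp (-t * |(n:ℝ)+τ|) * dv n θ * v n φ := by
    unfold hker UU
    congr 1
    ext n
    rcases n with _ | n
    · simp [h.dv0]
    · rw [abs_of_pos]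
      push_cast
      have hn : (0:ℝ) ≤ n := Nat.cast_nonneg n
      linarith
  rw [e1]
  exact key

def Eset (θ ε : ℝ) : Set ℝ := {φ | φ ∈ Ioo 0 π ∧ ε < |φ - θ|}

lemma Eset_meas (θ ε : ℝ) : MeasurableSet (Eset θ ε) :=
  measurableSet_Ioo.inter (isOpen_lt (f := fun _ : ℝ => ε) (g := fun φ : ℝ => |φ - θ|) continuous_const (by fun_prop)).measurableSet

lemma cos_low (hθ : θ ∈ Ioo 0 π) {ε : ℝ} (hε : 0 < ε) : ∃ k, 0 < k ∧ ∀ φ ∈ Eset θ ε, k ≤ |cos θ - cos φ| := by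
  have hc : IsCompact (Icc 0 π ∩ {φ | ε ≤ |φ - θ|}) :=
    isCompact_Icc.inter_right (isClosed_le continuous_const (by fun_prop))
  rcases (Icc 0 π ∩ {φ | ε ≤ |φ - θ|}).eq_empty_or_nonempty with h0 | h0
  · refine ⟨1, one_pos, fun φ hφ => ?_⟩
    have : φ ∈ Icc 0 π ∩ {φ | ε ≤ |φ - θ|} := ⟨Ioo_subset_Icc_self hφ.1, hφ.2.le⟩
    rw [h0] at this; exact this.elim
  · obtain ⟨x, hx, hx2⟩ := hc.exists_isMinOn h0 (f := fun φ => |cos θ - cos φ|) (by fun_prop)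
    refine ⟨|cos θ - cos x|, ?_, fun φ hφ => hx2 ⟨Ioo_subset_Icc_self hφ.1, hφ.2.le⟩⟩
    rw [abs_pos, sub_ne_zero]
    intro heq
    have := injOn_cos (Ioo_subset_Icc_self hθ) hx.1 heq
    have h3 := hx.2
    simp only [mem_setOf_eq, this, sub_self, abs_zero] at h3
    linarith

lemma hker_L1 (h : JData τ μ p v dv a b e f) (h' : LD p v dv θ r s M W Y) (hθ : θ ∈ Ioo 0 π) {ε : ℝ} (hε : 0 < ε) :
    ∃ C, 0 ≤ C ∧ ∀ t, 0 < t → ∫⁻ φ in Eset θ ε, ‖hker τ v dv θ t φ‖ₑ ∂μ ≤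
      ENNReal.ofReal (C * (exp (-(1/32)*t) / √t)) := by
  obtain ⟨k, hk, hkE⟩ := cos_low hθ hε
  obtain ⟨C, hC, hee⟩ := ee_bd h h'
  refine ⟨1/k * (1/2 * (μ.real univ + 16 * C^2)), by positivity, fun t ht => ?_⟩
  set δ := exp (-(1/32)*t) / √t with hδ
  have hst : 0 < √t := sqrt_pos.2 ht
  have hδ0 : 0 < δ := by positivity
  have hSδ : C^2 * (16/t * exp (-t/16)) / δ = 16 * C^2 * δ := by
    rw [div_eq_iff hδ0.ne', hδ, show exp (-t/16) = exp (-(1/32)*t) * exp (-(1/32)*t) by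
      rw [← exp_add]; ring_nf]
    nth_rewrite 1 [← mul_self_sqrt ht.le]
    field_simp
  have hN : ∀ N : ℕ, ∫⁻ φ in Eset θ ε, ‖(cos θ - cos φ)⁻¹ *
      ∑ n ∈ Finset.range (N+1), ee a b (cos θ) (UU τ dv θ t) n * v n φ‖ₑ ∂μ ≤
      ENNReal.ofReal (1/k * (1/2 * (μ.real univ + 16 * C^2)) * δ) := fun N => by
    obtain ⟨hi, hle⟩ := fin_abs h (ee a b (cos θ) (UU τ dv θ t)) (N+1) (geo_sq ht (N+1) (hee t ht)) hδ0
    calc _ ≤ ∫⁻ φ in Eset θ ε, ENNReal.ofReal (1/k) *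
          ‖∑ n ∈ Finset.range (N+1), ee a b (cos θ) (UU τ dv θ t) n * v n φ‖ₑ ∂μ := by
          refine setLIntegral_mono' (Eset_meas θ ε) fun φ hφ => ?_
          rw [enorm_mul]
          gcongr
          rw [← ofReal_norm_eq_enorm]
          apply ENNReal.ofReal_le_ofReal
          rw [norm_inv, norm_eq_abs, one_div]
          have := hkE φ hφ
          gcongr
      _ ≤ ∫⁻ φ, ENNReal.ofReal (1/k) *
          ‖∑ n ∈ Finset.range (N+1), ee a b (cos θ) (UU τ dv θ t) n * v n φ‖ₑ ∂μ := setLIntegral_le_lintegral _ _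
      _ = ENNReal.ofReal (1/k) * ENNReal.ofReal (∫ φ, |∑ n ∈ Finset.range (N+1),
          ee a b (cos θ) (UU τ dv θ t) n * v n φ| ∂μ) := by
          rw [lintegral_const_mul' _ _ ENNReal.ofReal_ne_top]
          congr 1
          exact (ofReal_integral_norm_eq_lintegral_enorm hi).symm
      _ ≤ _ := by
          rw [← ENNReal.ofReal_mul (by positivity)]
          apply ENNReal.ofReal_le_ofReal
          rw [hSδ] at hle
          calc _ ≤ 1/k * (1/2 * (δ * μ.real univ + 16 * C^2 * δ)) := by gcongr
            _ = _ := by ring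
  have hlim := lintegral_enorm_le_liminf_of_tendsto (μ := μ.restrict (Eset θ ε)) (f := hker τ v dv θ t)
    (G := fun N φ => (cos θ - cos φ)⁻¹ * ∑ n ∈ Finset.range (N+1), ee a b (cos θ) (UU τ dv θ t) n * v n φ) (by
      filter_upwards [ae_restrict_mem (Eset_meas θ ε)] with φ hφ
      have h0 : cos θ - cos φ ≠ 0 := by
        have := hkE φ hφ
        intro h0; rw [h0, abs_zero] at this; linarith
      have := (ee_tendsto h h' ht hφ.1).const_mul (cos θ - cos φ)⁻¹
      rwa [inv_mul_cancel_left₀ h0] at this) (fun N => by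
      have h1 : ∀ n, Measurable (v n) := fun n => (v_cont h n).measurable
      have h2 : Measurable (fun φ => (cos θ - cos φ)⁻¹ *
        ∑ n ∈ Finset.range (N+1), ee a b (cos θ) (UU τ dv θ t) n * v n φ) := by
        refine Measurable.mul (by fun_prop) (Finset.measurable_fun_sum _ fun n _ => (h1 n).const_mul _)
      exact h2.enorm.aemeasurable)
  refine hlim.trans ?_
  refine (liminf_le_liminf (Eventually.of_forall hN)).trans ?_
  simp

end RJ
end

section
namespace RJ

variable {τ : ℝ} {μ : Measure ℝ} {p : ℝ → ℝ} {v dv : ℕ → ℝ → ℝ} {a b : ℕ → ℝ} {e f : ℝ}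
  {θ r s M : ℝ} {W : ℝ → ℂ} {Y : ℂ}

lemma int_es {k : ℝ} (hk : 0 < k) : IntegrableOn (fun t : ℝ => exp (-k*t) / √t) (Ioi 0) := by
  have := integrableOn_rpow_mul_exp_neg_mul_rpow (s := -1/2) (p := 1) (b := k) (by norm_num) one_pos hk
  refine this.congr_fun (fun t ht => ?_) measurableSet_Ioi
  have ht : 0 < t := ht
  simp only [rpow_one]
  rw [show (-1/2:ℝ) = -(1/2) by norm_num, rpow_neg ht.le, ← sqrt_eq_rpow, div_eq_mul_inv, mul_comm]

lemma int_abs_v (h : JData τ μ p v dv a b e f) (n : ℕ) (A : Set ℝ) :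
    ∫ φ in A, ‖v n φ‖ ∂μ ≤ 1/2 * (μ.real univ + 1) := by
  have h1 := (fin_abs h (fun k => if k = n then 1 else 0) (n+1) (S := 1) (δ := 1) (by simp) one_pos)
  have e1 : ∀ φ, ∑ k ∈ Finset.range (n+1), (if k = n then (1:ℝ) else 0) * v k φ = v n φ := fun φ => by simp
  simp_rw [e1] at h1
  refine (setIntegral_le_integral h1.1.norm (ae_of_all _ fun _ => norm_nonneg _)).trans ?_
  simpa using h1.2

lemma int_E_v (h : JData τ μ p v dv a b e f) {ε : ℝ} (hε : 0 < ε) (hl : 0 < θ-ε) (hr : θ+ε < π) (n : ℕ) :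
    ∫ φ in Eset θ ε, v (n+1) φ ∂μ =
      (p (θ+ε) * dv (n+1) (θ+ε) - p (θ-ε) * dv (n+1) (θ-ε)) / (((n:ℝ)+1) * (n+1+2*τ)) := by
  obtain ⟨B, hB⟩ := h.bdd (n+1)
  have hi := int_of_bdd h (v_cont h (n+1)) hB
  have hE : (Eset θ ε : Set ℝ) =ᵐ[μ] ((Icc (θ-ε) (θ+ε))ᶜ : Set ℝ) := by
    filter_upwards [h.conc] with φ hφ
    apply propext
    show (φ ∈ Ioo 0 π ∧ ε < |φ - θ|) ↔ ¬ (φ ∈ Icc (θ-ε) (θ+ε))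
    have : φ ∈ Icc (θ-ε) (θ+ε) ↔ |φ-θ| ≤ ε := by
      rw [abs_le, mem_Icc]
      constructor <;> rintro ⟨h1, h2⟩ <;> constructor <;> linarith
    rw [this, not_le]
    exact ⟨fun h => h.2, fun h => ⟨hφ, h⟩⟩
  have hE2 : ∫ φ in Eset θ ε, v (n+1) φ ∂μ = ∫ φ in ((Icc (θ-ε) (θ+ε))ᶜ : Set ℝ), v (n+1) φ ∂μ :=
    setIntegral_congr_set hE
  rw [hE2, setIntegral_compl measurableSet_Icc hi, h.tot,
    h.int n _ _ hl (by linarith) hr]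
  ring

lemma int_E_hker (h : JData τ μ p v dv a b e f) (h' : LD p v dv θ r s M W Y) {ε : ℝ} (hε : 0 < ε) (hεr : ε ≤ r)
    {t : ℝ} (ht : 0 < t) : ∫ φ in Eset θ ε, hker τ v dv θ t φ ∂μ =
      ∑' n : ℕ, exp (-t*((n:ℝ)+1+τ)) * qc τ p dv θ ε n := by
  unfold hker
  have hl := h'.rl
  have hr := h'.rr
  have hi : ∀ n, Integrable (v n) (μ.restrict (Eset θ ε)) := fun n => by
    obtain ⟨B, hB⟩ := h.bdd n
    exact (int_of_bdd h (v_cont h n) hB).restrict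
  have hsm : Summable (fun n : ℕ => ∫ φ in Eset θ ε, ‖UU τ dv θ t n * v n φ‖ ∂μ) := by
    refine Summable.of_nonneg_of_le (fun n => integral_nonneg fun _ => norm_nonneg _) (fun n => ?_)
      ((UU_sum (τ := τ) h' ht).mul_right (1/2 * (μ.real univ + 1)))
    simp_rw [norm_mul]
    rw [integral_const_mul, norm_eq_abs]
    gcongr
    exact int_abs_v h n _
  rw [← integral_tsum_of_summable_integral_norm (fun n => (hi n).const_mul _) hsm]
  simp_rw [integral_const_mul]
  have hs2 : Summable (fun n : ℕ => UU τ dv θ t n * ∫ φ in Eset θ ε, v n φ ∂μ) := by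
    refine Summable.of_norm_bounded hsm fun n => ?_
    rw [← integral_const_mul]
    exact norm_integral_le_integral_norm _
  rw [hs2.tsum_eq_zero_add]
  have h0 : UU τ dv θ t 0 = 0 := by simp [UU, h.dv0]
  rw [h0, zero_mul, zero_add]
  congr 1
  ext n
  rw [int_E_v h hε (by linarith) (by linarith)]
  unfold UU qc
  push_cast
  ring

lemma hker_prod (h : JData τ μ p v dv a b e f) (h' : LD p v dv θ r s M W Y) (hθ : θ ∈ Ioo 0 π) {ε : ℝ} (hε : 0 < ε) :
    Integrable (Function.uncurry (fun t φ => hker τ v dv θ t φ))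
      ((volume.restrict (Ioi 0)).prod (μ.restrict (Eset θ ε))) := by
  haveI := h.fin
  obtain ⟨C, hC, hb⟩ := hker_L1 h h' hθ hε
  have hm : AEStronglyMeasurable (Function.uncurry (fun t φ => hker τ v dv θ t φ))
      ((volume.restrict (Ioi 0)).prod (μ.restrict (Eset θ ε))) := by
    refine aestronglyMeasurable_of_tendsto_ae (u := atTop)
      (f := fun (N : ℕ) (z : ℝ × ℝ) => ∑ n ∈ Finset.range N, UU τ dv θ z.1 n * v n z.2) (fun N => ?_) ?_
    · refine Continuous.aestronglyMeasurable (continuous_finsetSum _ fun n _ => ?_)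
      have := v_cont h n
      unfold UU
      fun_prop
    · rw [Measure.prod_restrict]
      filter_upwards [ae_restrict_mem (measurableSet_Ioi.prod (Eset_meas θ ε))] with z hz
      exact (hker_sum h h' hz.1 hz.2.1).hasSum.tendsto_sum_nat
  refine ⟨hm, ?_⟩
  rw [hasFiniteIntegral_iff_enorm, lintegral_prod _ hm.enorm]
  have hgInt : Integrable (fun t : ℝ => C * (exp (-(1/32)*t) / √t)) (volume.restrict (Ioi 0)) :=
    (int_es (by norm_num)).const_mul C
  calc _ ≤ ∫⁻ t in Ioi (0:ℝ), ENNReal.ofReal (C * (exp (-(1/32)*t) / √t)) :=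
        setLIntegral_mono' measurableSet_Ioi fun t ht => hb t ht
    _ < ⊤ := hgInt.lintegral_lt_top

lemma final (h : JData τ μ p v dv a b e f) (hθ : θ ∈ Ioo 0 π) :
    Tendsto (fun ε : ℝ => ∫ φ in Eset θ ε, (∫ t in Ioi (0:ℝ), hker τ v dv θ t φ) ∂μ)
      (nhdsWithin 0 (Ioi 0)) (nhds 0) := by
  obtain ⟨r, s, M, W, Y, h'⟩ := asymp h hθ
  haveI := h.fin
  have hτ := h.hτ
  have e1 : ∀ ε, ε ∈ Ioc 0 r → ∫ φ in Eset θ ε, (∫ t in Ioi (0:ℝ), hker τ v dv θ t φ) ∂μ =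
      ∫ t in Ioi (0:ℝ), ∑' n : ℕ, exp (-t*((n:ℝ)+1+τ)) * qc τ p dv θ ε n := fun ε hε => by
    rw [← integral_integral_swap (hker_prod h h' hθ hε.1)]
    exact setIntegral_congr_fun measurableSet_Ioi fun t ht => int_E_hker h h' hε.1 hε.2 ht
  have hm : ∀ ε, ε ∈ Ioc 0 r → AEStronglyMeasurable
      (fun t => ∑' n : ℕ, exp (-t*((n:ℝ)+1+τ)) * qc τ p dv θ ε n) (volume.restrict (Ioi 0)) := fun ε hε => by
    have := (hker_prod h h' hθ hε.1).integral_prod_left.aestronglyMeasurable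
    refine this.congr ?_
    filter_upwards [ae_restrict_mem measurableSet_Ioi] with t ht
    exact int_E_hker h h' hε.1 hε.2 ht
  obtain ⟨C, hC, hb⟩ := D_bound hτ h'
  have hp : ContinuousAt p θ := (h.psm.continuousOn).continuousAt (Ioo_mem_nhds hθ.1 hθ.2)
  have hI : Ioc 0 r ∈ nhdsWithin (0:ℝ) (Ioi 0) := Ioc_mem_nhdsGT h'.r0
  have key := tendsto_integral_filter_of_dominated_convergence (μ := volume.restrict (Ioi (0:ℝ)))
    (l := nhdsWithin (0:ℝ) (Ioi 0)) (F := fun ε t => ∑' n : ℕ, exp (-t*((n:ℝ)+1+τ)) * qc τ p dv θ ε n)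
    (f := fun _ => (0:ℝ)) (fun t => C * (exp (-(1/2+τ)*t) / √t))
    (by filter_upwards [hI] with ε hε using hm ε hε)
    (by
      filter_upwards [hI] with ε hε
      filter_upwards [ae_restrict_mem measurableSet_Ioi] with t ht
      have := hb ε hε.1 hε.2 t ht
      rwa [show -t*(1/2+τ) = -(1/2+τ)*t by ring] at this)
    ((int_es (by linarith)).const_mul C)
    (by
      filter_upwards [ae_restrict_mem measurableSet_Ioi] with t ht
      exact D_tendsto hτ h' hp h.cdv ht)
  rw [integral_zero] at key
  refine key.congr' ?_
  filter_upwards [hI] with ε hε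
  exact (e1 ε hε).symm

end RJ
end

/-- for every `θ ∈ (0,π)`, `pv ∫₀^π R_1(θ,φ) dμ_{α,β}(φ) = 0`. -/
theorem riesz_jacobi_first_order_kernel_pv_zero
    (α β : ℝ) (hα : -1 < α) (hβ : -1 < β)
    (c : ℕ → ℝ) (hc : JacobiNormalized α β c)
    (θ : ℝ) (hθ : θ ∈ Set.Ioo 0 π) :
    Filter.Tendsto
      (fun ε : ℝ => ∫ φ in {φ | φ ∈ Set.Ioo 0 π ∧ ε < |φ - θ|},
        rieszKer α β c 1 θ φ ∂(jacobiMeasure α β))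
      (nhdsWithin 0 (Set.Ioi 0)) (nhds 0) := by
  have h := RJ.jdata hα hβ hc
  refine (RJ.final h hθ).congr fun ε => ?_
  refine setIntegral_congr_fun (RJ.Eset_meas θ ε) fun φ hφ => ?_
  obtain ⟨r, s, M, W, Y, h'⟩ := RJ.asymp h hθ
  simp only [rieszKer, Nat.cast_one, Real.Gamma_one, div_one, one_mul, Nat.sub_self, pow_zero, mul_one,
    iteratedDeriv_one]
  refine setIntegral_congr_fun measurableSet_Ioi fun t ht => ?_
  have := (RJ.hker_deriv h h' ht hφ.1).deriv
  simp only [poissonKer, RJ.vv_eq]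
  exact this.symm

end
end

section
/- Let α, β > −1 and ε > 0 be fixed, and let ξ, ξ₁, ξ₂, κ₁, κ₂ ≥ 0 be fixed with α + ξ₁ + κ₁ ≥ −1/2 and β + ξ₂ + κ₂ ≥ −1/2. Let K be a fixed compact subset of (0,π). Then there is a constant C such that for all θ ∈ K and φ ∈ (0,π) with θ ≠ φ: ∬_{[−1,1]²} q(θ,φ,u,v)^{−(α+β+ξ₁+ξ₂+ξ+1/2)} dΠ_{α+ξ₁+κ₁}(u) dΠ_{β+ξ₂+κ₂}(v) ≤ C [ 1 + 𝟙_{{ξ = 1/2}} |θ−φ|^{−2ε} + 𝟙_{{ξ > 1/2}} |θ−φ|^{−(2ξ−1)} ]. -/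
open MeasureTheory Real Set
open scoped Classical

noncomputable section

/-- `log⁺ x = max (log x) 0`. -/
def logPlus (x : ℝ) : ℝ := max (Real.log x) 0

/-- The measure `dΠ_ν` on `[−1,1]`: for `ν > −1/2` the probability measure with density
`u ↦ Γ(ν+1)/(√π Γ(ν+1/2)) (1−u²)^{ν−1/2}`, and for `ν = −1/2` half the sum of the unit
point masses at `−1` and `1`. -/
def piMeasure (ν : ℝ) : Measure ℝ :=
  if ν = -1/2 then ((1:ENNReal)/2) • (Measure.dirac (-1) + Measure.dirac 1)
  else (volume.restrict (Set.Ioo (-1:ℝ) 1)).withDensity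
    (fun u => ENNReal.ofReal
      (Real.Gamma (ν+1) / (Real.sqrt π * Real.Gamma (ν+1/2)) * (1 - u^2) ^ (ν - 1/2)))

/-- `q(θ,φ,u,v) = 1 − u sin(θ/2)sin(φ/2) − v cos(θ/2)cos(φ/2)`. -/
def qFun (θ φ u v : ℝ) : ℝ :=
  1 - u * Real.sin (θ/2) * Real.sin (φ/2) - v * Real.cos (θ/2) * Real.cos (φ/2)

lemma pi_ae_mem (ν : ℝ) : ∀ᵐ u ∂(piMeasure ν), u ∈ Set.Icc (-1:ℝ) 1 := by
  unfold piMeasure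
  split_ifs with h
  · apply Measure.ae_smul_measure
    rw [ae_add_measure_iff]
    constructor
    · exact (ae_dirac_iff (p := fun x : ℝ => x ∈ Set.Icc (-1:ℝ) 1) measurableSet_Icc).2 (by norm_num)
    · exact (ae_dirac_iff (p := fun x : ℝ => x ∈ Set.Icc (-1:ℝ) 1) measurableSet_Icc).2 (by norm_num)
  · apply (withDensity_absolutelyContinuous _ _).ae_le
    filter_upwards [ae_restrict_mem measurableSet_Ioo] with u hu
    exact ⟨hu.1.le, hu.2.le⟩

lemma pi_half_le (f : ℝ → ENNReal) (hf : f (-1) ≤ f 1) :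
    ∫⁻ u, f u ∂(piMeasure (-1/2)) ≤ f 1 := by
  unfold piMeasure
  rw [if_pos rfl, lintegral_smul_measure, lintegral_add_measure, lintegral_dirac, lintegral_dirac]
  calc ((1:ENNReal)/2) • (f (-1) + f 1) ≤ ((1:ENNReal)/2) • (f 1 + f 1) := by
        simp only [smul_eq_mul]; gcongr
    _ = f 1 := by
        rw [smul_eq_mul, ← two_mul, ← mul_assoc, one_div, ENNReal.inv_mul_cancel (by simp) (by simp),
          one_mul]

lemma pi_le (ν : ℝ) (hν : -1/2 < ν) : ∃ c : ℝ, 0 ≤ c ∧ ∀ f : ℝ → ENNReal, Measurable f →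
    (∀ u ∈ Set.Ioo (0:ℝ) 1, f (-u) ≤ f u) →
    ∫⁻ u, f u ∂(piMeasure ν) ≤
      ENNReal.ofReal c * ∫⁻ x in Set.Ioc (0:ℝ) 1, ENNReal.ofReal (x ^ (ν - 1/2)) * f (1 - x) := by
  set G := Real.Gamma (ν+1) / (Real.sqrt π * Real.Gamma (ν+1/2)) with hG
  have hG0 : 0 ≤ G := by
    have := Real.Gamma_pos_of_pos (show 0 < ν + 1 by linarith)
    have := Real.Gamma_pos_of_pos (show 0 < ν + 1/2 by linarith)
    positivity
  set k : ℝ := 1 + 2 ^ (ν - 1/2) with hk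
  have hk0 : 0 ≤ k := by positivity
  have hkey : ∀ u ∈ Set.Ico (0:ℝ) 1, (1 - u^2) ^ (ν - 1/2) ≤ k * (1 - u) ^ (ν - 1/2) := by
    intro u hu
    have e : 1 - u^2 = (1 + u) * (1 - u) := by ring
    rw [e, Real.mul_rpow (by linarith [hu.1]) (by linarith [hu.2])]
    apply mul_le_mul_of_nonneg_right _ (Real.rpow_nonneg (by linarith [hu.2]) _)
    rcases le_total 0 (ν - 1/2) with h | h
    · have : (1 + u) ^ (ν - 1/2) ≤ 2 ^ (ν - 1/2) :=
        Real.rpow_le_rpow (by linarith [hu.1]) (by linarith [hu.2]) h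
      linarith
    · have : (1 + u) ^ (ν - 1/2) ≤ 1 := Real.rpow_le_one_of_one_le_of_nonpos (by linarith [hu.1]) h
      have : (0:ℝ) ≤ 2 ^ (ν - 1/2) := by positivity
      linarith
  refine ⟨2 * (G * k), by positivity, fun f hf hmono => ?_⟩
  let h : ℝ → ENNReal := (Set.Ioc (0:ℝ) 1).indicator
    (fun x => ENNReal.ofReal (G * k) * (ENNReal.ofReal (x ^ (ν - 1/2)) * f (1 - x)))
  have hh : Measurable h := by
    apply Measurable.indicator _ measurableSet_Ioc
    fun_prop
  have hhI : ∫⁻ x, h x = ENNReal.ofReal (G * k) *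
      ∫⁻ x in Set.Ioc (0:ℝ) 1, ENNReal.ofReal (x ^ (ν - 1/2)) * f (1 - x) := by
    rw [lintegral_indicator measurableSet_Ioc, lintegral_const_mul _ (by fun_prop)]
  unfold piMeasure
  rw [if_neg hν.ne', ← hG]
  refine (lintegral_withDensity_le_lintegral_mul _ (by fun_prop) _).trans ?_
  rw [← lintegral_indicator measurableSet_Ioo]
  calc _ ≤ ∫⁻ u, (h (1 - u) + h (1 + u)) := by
        apply lintegral_mono
        intro u
        apply Set.indicator_le' (f := fun _ => _) (g := fun u => h (1 - u) + h (1 + u)) _ _ u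
        · intro u hu
          rcases le_or_gt 0 u with h0 | h0
          · refine le_trans ?_ le_self_add
            have : (1 - u) ∈ Set.Ioc (0:ℝ) 1 := ⟨by linarith [hu.2], by linarith⟩
            simp only [h, Set.indicator_of_mem this, Pi.mul_apply]
            rw [sub_sub_cancel, ← mul_assoc, ← ENNReal.ofReal_mul (by positivity)]
            refine mul_le_mul' (ENNReal.ofReal_le_ofReal ?_) le_rfl
            rw [mul_assoc]
            exact mul_le_mul_of_nonneg_left (hkey u ⟨h0, hu.2⟩) hG0
          · refine le_trans ?_ le_add_self
            have : (1 + u) ∈ Set.Ioc (0:ℝ) 1 := ⟨by linarith [hu.1], by linarith⟩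
            simp only [h, Set.indicator_of_mem this, Pi.mul_apply]
            rw [show 1 - (1 + u) = -u by ring, ← mul_assoc, ← ENNReal.ofReal_mul (by positivity)]
            have h3 := hmono (-u) ⟨by linarith, by linarith [hu.1]⟩
            rw [neg_neg] at h3
            have h4 := hkey (-u) ⟨by linarith, by linarith [hu.1]⟩
            rw [neg_sq, sub_neg_eq_add] at h4
            refine mul_le_mul' (ENNReal.ofReal_le_ofReal ?_) h3
            rw [mul_assoc]
            exact mul_le_mul_of_nonneg_left h4 hG0
        · intro u hu
          exact zero_le
    _ = _ := by
        rw [lintegral_add_left (by fun_prop), lintegral_sub_left_eq_self h,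
          lintegral_add_left_eq_self h, hhI, ← two_mul, ← mul_assoc,
          ENNReal.ofReal_mul (p := 2) (by norm_num)]
        simp

lemma lint_Ioc (m D : ℝ) (hm : 0 < m) (hD : 0 ≤ D) :
    ∫⁻ x in Set.Ioc (0:ℝ) D, ENNReal.ofReal (x ^ (m - 1)) = ENNReal.ofReal (D ^ m / m) := by
  have hi : IntegrableOn (fun x : ℝ => x ^ (m-1)) (Set.Ioc 0 D) :=
    (intervalIntegrable_iff_integrableOn_Ioc_of_le hD).1
      (intervalIntegral.intervalIntegrable_rpow' (by linarith))
  rw [← ofReal_integral_eq_lintegral_ofReal hi, ← intervalIntegral.integral_of_le hD,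
    integral_rpow (Or.inl (by linarith))]
  · simp [Real.zero_rpow hm.ne']
  · filter_upwards [ae_restrict_mem measurableSet_Ioc] with x hx
    exact Real.rpow_nonneg hx.1.le _

lemma lint_Ioi (γ D : ℝ) (hγ : 0 < γ) (hD : 0 < D) :
    ∫⁻ x in Set.Ioi D, ENNReal.ofReal (x ^ (-γ - 1)) = ENNReal.ofReal (D ^ (-γ) / γ) := by
  rw [← ofReal_integral_eq_lintegral_ofReal (integrableOn_Ioi_rpow_of_lt (by linarith) hD),
    integral_Ioi_rpow_of_lt (by linarith) hD]
  · congr 1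
    rw [sub_add_cancel, neg_div_neg_eq]
  · filter_upwards [ae_restrict_mem measurableSet_Ioi] with x hx
    exact Real.rpow_nonneg (hD.trans hx).le _

lemma mono_aux (D P : ℝ) (hD : 0 < D) (hP : 0 ≤ P) (u : ℝ) (hu : u ∈ Set.Icc (0:ℝ) 1) :
    ENNReal.ofReal ((D + (1 - -u)) ^ (-P)) ≤ ENNReal.ofReal ((D + (1 - u)) ^ (-P)) :=
  ENNReal.ofReal_le_ofReal (Real.rpow_le_rpow_of_nonpos (by linarith [hu.2]) (by linarith [hu.1])
    (by linarith))

lemma lem1 (ν γ : ℝ) (hν : -1/2 ≤ ν) (hγ : 0 < γ) : ∃ C : ℝ, 0 ≤ C ∧ ∀ D : ℝ, 0 < D →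
    ∫⁻ v, ENNReal.ofReal ((D + (1 - v)) ^ (-(ν + 1/2 + γ))) ∂(piMeasure ν) ≤
      ENNReal.ofReal (C * D ^ (-γ)) := by
  rcases hν.eq_or_lt with h | h
  · refine ⟨1, zero_le_one, fun D hD => ?_⟩
    subst h
    refine (pi_half_le _ (mono_aux D _ hD (by linarith) 1 (by norm_num))).trans ?_
    norm_num
  · obtain ⟨c, hc, H⟩ := pi_le ν h
    set m := ν + 1/2 with hm
    have hm0 : 0 < m := by linarith
    refine ⟨c * (1 / m + 1 / γ), by positivity, fun D hD => ?_⟩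
    refine (H _ (by fun_prop) (fun u hu =>
      mono_aux D _ hD (by linarith) u ⟨hu.1.le, hu.2.le⟩)).trans ?_
    rw [mul_assoc, ENNReal.ofReal_mul hc]
    gcongr
    have hsub : Set.Ioc (0:ℝ) 1 ⊆ Set.Ioc 0 D ∪ Set.Ioi D := by
      intro x hx
      rcases le_or_gt x D with h | h
      · exact Or.inl ⟨hx.1, h⟩
      · exact Or.inr h
    refine (lintegral_mono_set hsub).trans ((lintegral_union_le _ _ _).trans ?_)
    have e1 : ∫⁻ x in Set.Ioc (0:ℝ) D, ENNReal.ofReal (x ^ (ν - 1/2)) *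
        ENNReal.ofReal ((D + (1 - (1 - x))) ^ (-(m + γ))) ≤ ENNReal.ofReal (D ^ (-γ) / m) := by
      calc _ ≤ ∫⁻ x in Set.Ioc (0:ℝ) D, ENNReal.ofReal (D ^ (-(m+γ))) *
            ENNReal.ofReal (x ^ (m - 1)) := by
            apply setLIntegral_mono (by fun_prop)
            intro x hx
            rw [mul_comm, show m - 1 = ν - 1/2 by rw [hm]; ring]
            gcongr ENNReal.ofReal ?_ * _
            exact Real.rpow_le_rpow_of_nonpos hD (by linarith [hx.1]) (by linarith)
        _ = _ := by
            rw [lintegral_const_mul _ (by fun_prop), lint_Ioc m D hm0 hD.le,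
              ← ENNReal.ofReal_mul (by positivity), ← mul_div_assoc, ← Real.rpow_add hD]
            congr 3; ring
    have e2 : ∫⁻ x in Set.Ioi D, ENNReal.ofReal (x ^ (ν - 1/2)) *
        ENNReal.ofReal ((D + (1 - (1 - x))) ^ (-(m + γ))) ≤ ENNReal.ofReal (D ^ (-γ) / γ) := by
      rw [← lint_Ioi γ D hγ hD]
      apply setLIntegral_mono (by fun_prop)
      intro x hx
      have hx0 : 0 < x := hD.trans hx
      rw [← ENNReal.ofReal_mul (by positivity)]
      apply ENNReal.ofReal_le_ofReal
      calc _ ≤ x ^ (ν - 1/2) * x ^ (-(m+γ)) := by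
            gcongr ?_ * ?_
            exact Real.rpow_le_rpow_of_nonpos hx0 (by linarith) (by linarith)
        _ = _ := by
            rw [← Real.rpow_add hx0]; congr 1; rw [hm]; ring
    refine (add_le_add e1 e2).trans ?_
    rw [← ENNReal.ofReal_add (by positivity) (by positivity)]
    apply ENNReal.ofReal_le_ofReal
    apply le_of_eq; ring

lemma lem2 (ν t : ℝ) (hν : -1/2 ≤ ν) (ht : 0 < t) (ht1 : t ≤ 1) : ∃ C : ℝ, 0 ≤ C ∧ ∀ D : ℝ, 0 < D →
    ∫⁻ v, ENNReal.ofReal ((D + (1 - v)) ^ (-((1 - t) * (ν + 1/2)))) ∂(piMeasure ν) ≤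
      ENNReal.ofReal C := by
  have hP : 0 ≤ (1 - t) * (ν + 1/2) := mul_nonneg (by linarith) (by linarith)
  rcases hν.eq_or_lt with h | h
  · refine ⟨1, zero_le_one, fun D hD => ?_⟩
    subst h
    refine (pi_half_le _ (mono_aux D _ hD hP 1 (by norm_num))).trans ?_
    norm_num
  · obtain ⟨c, hc, H⟩ := pi_le ν h
    set m := ν + 1/2 with hm
    have hm0 : 0 < m := by linarith
    have htm : 0 < t * m := by positivity
    refine ⟨c * (1 / (t * m)), by positivity, fun D hD => ?_⟩
    refine (H _ (by fun_prop) (fun u hu =>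
      mono_aux D _ hD hP u ⟨hu.1.le, hu.2.le⟩)).trans ?_
    rw [ENNReal.ofReal_mul hc]
    gcongr
    have := lint_Ioc (t * m) 1 htm zero_le_one
    rw [Real.one_rpow] at this
    rw [← this]
    apply setLIntegral_mono (by fun_prop)
    intro x hx
    have hx0 : 0 < x := hx.1
    rw [← ENNReal.ofReal_mul (by positivity)]
    apply ENNReal.ofReal_le_ofReal
    calc _ ≤ x ^ (ν - 1/2) * x ^ (-((1 - t) * m)) := by
          gcongr ?_ * ?_
          exact Real.rpow_le_rpow_of_nonpos hx0 (by linarith) (by linarith)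
      _ = _ := by
          rw [← Real.rpow_add hx0]; congr 1; rw [hm]; ring

lemma q_eq (θ φ u v : ℝ) : qFun θ φ u v = (1 - Real.cos ((θ - φ)/2)) +
    Real.sin (θ/2) * Real.sin (φ/2) * (1 - u) + Real.cos (θ/2) * Real.cos (φ/2) * (1 - v) := by
  unfold qFun
  rw [sub_div, Real.cos_sub]; ring

lemma sc_pos (φ : ℝ) (hφ : φ ∈ Set.Ioo 0 π) : 0 < Real.sin (φ/2) ∧ 0 < Real.cos (φ/2) :=
  ⟨Real.sin_pos_of_pos_of_lt_pi (by linarith [hφ.1]) (by linarith [hφ.2, hφ.1]),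
    Real.cos_pos_of_mem_Ioo ⟨by linarith [hφ.1, Real.pi_pos], by linarith [hφ.2]⟩⟩

lemma q_upper (θ φ u v : ℝ) (hθ : θ ∈ Set.Ioo 0 π) (hφ : φ ∈ Set.Ioo 0 π)
    (hu : u ∈ Set.Icc (-1:ℝ) 1) (hv : v ∈ Set.Icc (-1:ℝ) 1) : qFun θ φ u v ≤ 2 := by
  obtain ⟨a, b⟩ := sc_pos θ hθ
  obtain ⟨c, d⟩ := sc_pos φ hφ
  have h1 := Real.cos_le_one (θ/2 - φ/2)
  rw [Real.cos_sub] at h1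
  unfold qFun
  have h2 := mul_pos a c
  have h3 := mul_pos b d
  nlinarith [hu.1, hv.1]

lemma q_lower (K : Set ℝ) (hK : IsCompact K) (hKsub : K ⊆ Set.Ioo 0 π) :
    ∃ c : ℝ, 0 < c ∧ ∀ θ ∈ K, ∀ φ ∈ Set.Ioo 0 π, ∀ u ∈ Set.Icc (-1:ℝ) 1, ∀ v ∈ Set.Icc (-1:ℝ) 1,
      c * (|θ - φ| ^ 2 + (1 - u) + (1 - v)) ≤ qFun θ φ u v := by
  obtain ⟨s, hs, h⟩ := hK.exists_forall_le' (f := fun θ => min (Real.sin (θ/2)) (Real.cos (θ/2)))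
    (a := 0) (by fun_prop) (fun θ hθ => lt_min (sc_pos θ (hKsub hθ)).1 (sc_pos θ (hKsub hθ)).2)
  refine ⟨s^2/160, by positivity, fun θ hθ φ hφ u hu v hv => ?_⟩
  have h1 : s ≤ Real.sin (θ/2) := (h θ hθ).trans (min_le_left _ _)
  have h2 : s ≤ Real.cos (θ/2) := (h θ hθ).trans (min_le_right _ _)
  have hs1 : s ≤ 1 := h1.trans (Real.sin_le_one _)
  have hss : s^2 ≤ 1 := by nlinarith
  obtain ⟨c, d⟩ := sc_pos φ hφ
  have hθ' := hKsub hθ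
  set r := |θ - φ| with hr
  have hr0 : 0 ≤ r := abs_nonneg _
  have hd : r^2/20 ≤ 1 - Real.cos ((θ - φ)/2) := by
    have hb : |(θ - φ)/2| ≤ π := by
      rw [abs_le]; constructor <;> linarith [hθ'.1, hθ'.2, hφ.1, hφ.2]
    have h3 := Real.cos_le_one_sub_mul_cos_sq hb
    have hp : π^2 ≤ 10 := by nlinarith [Real.pi_lt_d2, Real.pi_pos]
    have h4 : (1:ℝ)/5 ≤ 2/π^2 := by
      rw [div_le_div_iff₀ (by norm_num) (by positivity)]; linarith
    have h5 : r^2 = (θ-φ)^2 := sq_abs _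
    have h6 := mul_le_mul_of_nonneg_right h4 (sq_nonneg ((θ-φ)/2))
    nlinarith
  have hx : 0 ≤ 1 - u := by linarith [hu.2]
  have hy : 0 ≤ 1 - v := by linarith [hv.2]
  have hx2 : 1 - u ≤ 2 := by linarith [hu.1]
  have hy2 : 1 - v ≤ 2 := by linarith [hv.1]
  have hs2 : 0 < s^2 := by positivity
  rw [q_eq]
  rcases le_or_gt r s with hrs | hrs
  · have e : |θ/2 - φ/2| = r/2 := by
      rw [← sub_div, abs_div, abs_two]
    have hsin := Real.abs_sin_sub_sin_le (θ/2) (φ/2)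
    have hcos := Real.abs_cos_sub_cos_le (θ/2) (φ/2)
    rw [e] at hsin hcos
    have a1 : s/2 ≤ Real.sin (φ/2) := by linarith [le_abs_self (Real.sin (θ/2) - Real.sin (φ/2))]
    have a2 : s/2 ≤ Real.cos (φ/2) := by linarith [le_abs_self (Real.cos (θ/2) - Real.cos (φ/2))]
    have b1 : s * (s/2) ≤ Real.sin (θ/2) * Real.sin (φ/2) := by gcongr; linarith
    have b2 : s * (s/2) ≤ Real.cos (θ/2) * Real.cos (φ/2) := by gcongr; linarith
    have d1 := mul_le_mul_of_nonneg_right b1 hx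
    have d2 := mul_le_mul_of_nonneg_right b2 hy
    have d3 : s^2 * r^2 ≤ 1 * r^2 := by gcongr
    nlinarith [mul_nonneg hs2.le hx, mul_nonneg hs2.le hy, sq_nonneg r]
  · have d1 : 0 ≤ Real.sin (θ/2) * Real.sin (φ/2) * (1 - u) := by
      have : 0 ≤ Real.sin (θ/2) := by linarith
      positivity
    have d2 : 0 ≤ Real.cos (θ/2) * Real.cos (φ/2) * (1 - v) := by
      have : 0 ≤ Real.cos (θ/2) := by linarith
      positivity
    have d3 : s^2 * r^2 ≤ 1 * r^2 := by gcongr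
    have d4 : s^2 ≤ r^2 := by gcongr
    have d5 : s^2 * (1 - u) ≤ s^2 * 2 := by gcongr
    have d6 : s^2 * (1 - v) ≤ s^2 * 2 := by gcongr
    nlinarith

lemma red (K : Set ℝ) (hKsub : K ⊆ Set.Ioo 0 π) (c : ℝ) (hc : 0 < c)
    (hq : ∀ θ ∈ K, ∀ φ ∈ Set.Ioo 0 π, ∀ u ∈ Set.Icc (-1:ℝ) 1, ∀ v ∈ Set.Icc (-1:ℝ) 1,
      c * (|θ - φ| ^ 2 + (1 - u) + (1 - v)) ≤ qFun θ φ u v)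
    (P₀ P : ℝ) (hP : 0 ≤ P) (hPP : P₀ ≤ P) :
    ∃ M : ℝ, 0 ≤ M ∧ ∀ μ ν : ℝ, ∀ θ ∈ K, ∀ φ ∈ Set.Ioo 0 π, θ ≠ φ → ∀ B : ℝ, 0 ≤ B →
      (∫⁻ u, ∫⁻ v, ENNReal.ofReal ((|θ - φ| ^ 2 + (1 - u) + (1 - v)) ^ (-P))
        ∂(piMeasure ν) ∂(piMeasure μ) ≤ ENNReal.ofReal B) →
      (∫ u, ∫ v, (qFun θ φ u v) ^ (-P₀) ∂(piMeasure ν) ∂(piMeasure μ)) ≤ M * B := by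
  set M : ℝ := 2 ^ (P - P₀) * c ^ (-P) with hM
  have hM0 : 0 ≤ M := by positivity
  refine ⟨M, hM0, fun μ ν θ hθ φ hφ hne B hB hI => ?_⟩
  have hr0 := abs_pos.2 (sub_ne_zero.2 hne)
  have hpt : ∀ u ∈ Set.Icc (-1:ℝ) 1, ∀ v ∈ Set.Icc (-1:ℝ) 1,
      ‖(qFun θ φ u v) ^ (-P₀)‖ₑ ≤ ENNReal.ofReal M *
        ENNReal.ofReal ((|θ - φ| ^ 2 + (1 - u) + (1 - v)) ^ (-P)) := by
    intro u hu v hv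
    have hX : 0 < |θ - φ| ^ 2 + (1 - u) + (1 - v) := by
      have := hu.2; have := hv.2
      have : 0 < |θ - φ| ^ 2 := by positivity
      linarith
    have h1 := hq θ hθ φ hφ u hu v hv
    have h2 := q_upper θ φ u v (hKsub hθ) hφ hu hv
    have hqp : 0 < qFun θ φ u v := lt_of_lt_of_le (by positivity) h1
    rw [Real.enorm_eq_ofReal (by positivity), ← ENNReal.ofReal_mul hM0]
    apply ENNReal.ofReal_le_ofReal
    calc (qFun θ φ u v) ^ (-P₀) = (qFun θ φ u v) ^ (P - P₀) * (qFun θ φ u v) ^ (-P) := by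
          rw [← Real.rpow_add hqp]; congr 1; ring
      _ ≤ 2 ^ (P - P₀) * (c * (|θ - φ| ^ 2 + (1 - u) + (1 - v))) ^ (-P) := by
          gcongr ?_ * ?_
          · exact Real.rpow_le_rpow hqp.le h2 (by linarith)
          · exact Real.rpow_le_rpow_of_nonpos (by positivity) h1 (by linarith)
      _ = _ := by
          rw [Real.mul_rpow hc.le hX.le, hM]; ring
  have key : ‖∫ u, ∫ v, (qFun θ φ u v) ^ (-P₀) ∂(piMeasure ν) ∂(piMeasure μ)‖ₑ ≤
      ENNReal.ofReal (M * B) := by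
    calc _ ≤ ∫⁻ u, ‖∫ v, (qFun θ φ u v) ^ (-P₀) ∂(piMeasure ν)‖ₑ ∂(piMeasure μ) :=
          enorm_integral_le_lintegral_enorm _
      _ ≤ ∫⁻ u, ENNReal.ofReal M * ∫⁻ v, ENNReal.ofReal ((|θ - φ| ^ 2 + (1 - u) + (1 - v)) ^ (-P))
            ∂(piMeasure ν) ∂(piMeasure μ) := by
          apply lintegral_mono_ae
          filter_upwards [pi_ae_mem μ] with u hu
          refine (enorm_integral_le_lintegral_enorm _).trans ?_
          rw [← lintegral_const_mul _ (by fun_prop)]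
          apply lintegral_mono_ae
          filter_upwards [pi_ae_mem ν] with v hv
          exact hpt u hu v hv
      _ ≤ _ := by
          rw [lintegral_const_mul' _ _ ENNReal.ofReal_ne_top, ENNReal.ofReal_mul hM0]
          gcongr
  rw [← ofReal_norm, ENNReal.ofReal_le_ofReal_iff (by positivity)] at key
  exact (Real.le_norm_self _).trans key

lemma bound_sup (μ ν γ : ℝ) (hμ : -1/2 ≤ μ) (hν : -1/2 ≤ ν) (hγ : 0 < γ) :
    ∃ C : ℝ, 0 ≤ C ∧ ∀ D : ℝ, 0 < D →
      ∫⁻ u, ∫⁻ v, ENNReal.ofReal ((D + (1 - u) + (1 - v)) ^ (-((μ + 1/2) + (ν + 1/2) + γ)))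
        ∂(piMeasure ν) ∂(piMeasure μ) ≤ ENNReal.ofReal (C * D ^ (-γ)) := by
  obtain ⟨C₁, hC₁, H₁⟩ := lem1 ν (μ + 1/2 + γ) hν (by linarith)
  obtain ⟨C₂, hC₂, H₂⟩ := lem1 μ γ hμ hγ
  refine ⟨C₁ * C₂, by positivity, fun D hD => ?_⟩
  calc _ ≤ ∫⁻ u, ENNReal.ofReal C₁ * ENNReal.ofReal ((D + (1 - u)) ^ (-(μ + 1/2 + γ)))
          ∂(piMeasure μ) := by
        apply lintegral_mono_ae
        filter_upwards [pi_ae_mem μ] with u hu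
        have := H₁ (D + (1 - u)) (by linarith [hu.2])
        rw [ENNReal.ofReal_mul hC₁] at this
        convert this using 6
        ring
    _ ≤ _ := by
        rw [lintegral_const_mul' _ _ ENNReal.ofReal_ne_top, mul_assoc, ENNReal.ofReal_mul hC₁]
        gcongr
        exact H₂ D hD

lemma bound_sub (μ ν t : ℝ) (hμ : -1/2 ≤ μ) (hν : -1/2 ≤ ν) (ht : 0 < t) (ht1 : t ≤ 1) :
    ∃ C : ℝ, 0 ≤ C ∧ ∀ D : ℝ, 0 < D →
      ∫⁻ u, ∫⁻ v, ENNReal.ofReal ((D + (1 - u) + (1 - v)) ^ (-((1 - t) * ((μ + 1/2) + (ν + 1/2)))))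
        ∂(piMeasure ν) ∂(piMeasure μ) ≤ ENNReal.ofReal C := by
  obtain ⟨C₁, hC₁, H₁⟩ := lem2 ν t hν ht ht1
  obtain ⟨C₂, hC₂, H₂⟩ := lem2 μ t hμ ht ht1
  have hP₁ : 0 ≤ (1 - t) * (μ + 1/2) := mul_nonneg (by linarith) (by linarith)
  have hP₂ : 0 ≤ (1 - t) * (ν + 1/2) := mul_nonneg (by linarith) (by linarith)
  refine ⟨C₁ * C₂, by positivity, fun D hD => ?_⟩
  calc _ ≤ ∫⁻ u, ENNReal.ofReal C₁ * ENNReal.ofReal ((D + (1 - u)) ^ (-((1 - t) * (μ + 1/2))))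
          ∂(piMeasure μ) := by
        apply lintegral_mono_ae
        filter_upwards [pi_ae_mem μ] with u hu
        have hu2 := hu.2
        calc _ ≤ ∫⁻ v, ENNReal.ofReal ((D + (1 - u)) ^ (-((1 - t) * (μ + 1/2)))) *
              ENNReal.ofReal ((D + (1 - v)) ^ (-((1 - t) * (ν + 1/2)))) ∂(piMeasure ν) := by
              apply lintegral_mono_ae
              filter_upwards [pi_ae_mem ν] with v hv
              have hv2 := hv.2
              have hDu : 0 < D + (1 - u) := by linarith
              rw [← ENNReal.ofReal_mul (by positivity)]
              apply ENNReal.ofReal_le_ofReal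
              rw [show -((1 - t) * ((μ + 1/2) + (ν + 1/2))) =
                -((1 - t) * (μ + 1/2)) + -((1 - t) * (ν + 1/2)) by ring,
                Real.rpow_add (by linarith)]
              exact mul_le_mul
                (Real.rpow_le_rpow_of_nonpos (by linarith) (by linarith) (by linarith))
                (Real.rpow_le_rpow_of_nonpos (by linarith) (by linarith) (by linarith))
                (Real.rpow_nonneg (by linarith) _) (Real.rpow_nonneg (by linarith) _)
          _ ≤ _ := by
              rw [lintegral_const_mul' _ _ ENNReal.ofReal_ne_top, mul_comm]
              gcongr
              exact H₁ D hD
    _ ≤ _ := by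
        rw [lintegral_const_mul' _ _ ENNReal.ofReal_ne_top, ENNReal.ofReal_mul hC₁]
        gcongr
        exact H₂ D hD

/-- estimate for the double `dΠ` integral of a negative power of `q`,
uniform in `θ` in a compact subset `K` of `(0,π)` and `φ ∈ (0,π)`, `θ ≠ φ`. -/
theorem q_double_integral_estimate_compact
    (α β : ℝ) (hα : -1 < α) (hβ : -1 < β) (ε : ℝ) (hε : 0 < ε)
    (ξ ξ₁ ξ₂ κ₁ κ₂ : ℝ) (hξ : 0 ≤ ξ) (hξ₁ : 0 ≤ ξ₁) (hξ₂ : 0 ≤ ξ₂)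
    (hκ₁ : 0 ≤ κ₁) (hκ₂ : 0 ≤ κ₂)
    (h₁ : -1/2 ≤ α + ξ₁ + κ₁) (h₂ : -1/2 ≤ β + ξ₂ + κ₂)
    (K : Set ℝ) (hK : IsCompact K) (hKsub : K ⊆ Set.Ioo 0 π) :
    ∃ C : ℝ, ∀ θ ∈ K, ∀ φ ∈ Set.Ioo 0 π, θ ≠ φ →
      (∫ u, ∫ v, (qFun θ φ u v) ^ (-(α + β + ξ₁ + ξ₂ + ξ + 1/2))
          ∂(piMeasure (β + ξ₂ + κ₂)) ∂(piMeasure (α + ξ₁ + κ₁))) ≤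
        C * (1 + (if ξ = 1/2 then |θ - φ| ^ (-(2*ε)) else 0) +
          (if 1/2 < ξ then |θ - φ| ^ (-(2*ξ - 1)) else 0)) := by
  obtain ⟨c₀, hc₀, hq⟩ := q_lower K hK hKsub
  have hm₁ : 0 ≤ α + ξ₁ + κ₁ + 1/2 := by linarith
  have hm₂ : 0 ≤ β + ξ₂ + κ₂ + 1/2 := by linarith
  rcases lt_or_ge ξ (1/2) with hlt | hge
  · skip
    set S := (α + ξ₁ + κ₁ + 1/2) + (β + ξ₂ + κ₂ + 1/2) with hS
    have hS0 : 0 ≤ S := by linarith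
    set t := (1/2 - ξ) / (S + 1) with ht
    have ht0 : 0 < t := div_pos (by linarith) (by linarith)
    have ht1 : t ≤ 1 := by rw [ht, div_le_one (by linarith)]; linarith
    have htS : t * S ≤ 1/2 - ξ := by
      have : t * (S + 1) = 1/2 - ξ := by rw [ht]; field_simp
      linarith
    obtain ⟨C, hC, H⟩ := bound_sub (α + ξ₁ + κ₁) (β + ξ₂ + κ₂) t h₁ h₂ ht0 ht1
    obtain ⟨M, hM, HM⟩ := red K hKsub c₀ hc₀ hq (α + β + ξ₁ + ξ₂ + ξ + 1/2) ((1 - t) * S)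
      (mul_nonneg (by linarith) hS0) (by linarith)
    refine ⟨M * C, fun θ hθ φ hφ hne => ?_⟩
    have hr : 0 < |θ - φ| ^ 2 := by have := abs_pos.2 (sub_ne_zero.2 hne); positivity
    have := HM _ _ θ hθ φ hφ hne C hC (H _ hr)
    rw [if_neg (by linarith), if_neg (by linarith)]
    simpa using this
  · skip
    have main : ∀ γ : ℝ, 0 < γ → ξ ≤ γ + 1/2 → ∃ C : ℝ, 0 ≤ C ∧ ∀ θ ∈ K, ∀ φ ∈ Set.Ioo 0 π, θ ≠ φ →
      (∫ u, ∫ v, (qFun θ φ u v) ^ (-(α + β + ξ₁ + ξ₂ + ξ + 1/2))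
          ∂(piMeasure (β + ξ₂ + κ₂)) ∂(piMeasure (α + ξ₁ + κ₁))) ≤ C * |θ - φ| ^ (-(2*γ)) := by
      intro γ hγ hξγ
      obtain ⟨C, hC, H⟩ := bound_sup (α + ξ₁ + κ₁) (β + ξ₂ + κ₂) γ h₁ h₂ hγ
      obtain ⟨M, hM, HM⟩ := red K hKsub c₀ hc₀ hq (α + β + ξ₁ + ξ₂ + ξ + 1/2)
        ((α + ξ₁ + κ₁ + 1/2) + (β + ξ₂ + κ₂ + 1/2) + γ) (by linarith) (by linarith)
      refine ⟨M * C, by positivity, fun θ hθ φ hφ hne => ?_⟩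
      have hr0 := abs_pos.2 (sub_ne_zero.2 hne)
      have hr : 0 < |θ - φ| ^ 2 := by positivity
      have := HM _ _ θ hθ φ hφ hne _ (by positivity) (H _ hr)
      rw [← Real.rpow_natCast, ← Real.rpow_mul hr0.le] at this
      rw [mul_assoc]
      convert this using 4
      push_cast; ring
    rcases hge.eq_or_lt with he | hgt
    · obtain ⟨C, hC, H⟩ := main ε hε (by linarith)
      refine ⟨C, fun θ hθ φ hφ hne => (H θ hθ φ hφ hne).trans ?_⟩
      rw [if_pos he.symm, if_neg (by linarith)]
      gcongr
      linarith
    · obtain ⟨C, hC, H⟩ := main (ξ - 1/2) (by linarith) (by linarith)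
      refine ⟨C, fun θ hθ φ hφ hne => (H θ hθ φ hφ hne).trans ?_⟩
      rw [if_neg hgt.ne', if_pos hgt, show 2 * (ξ - 1/2) = 2 * ξ - 1 by ring]
      gcongr
      linarith

end
end
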